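/- arXiv:1707.05766 — 6 statements merged into one kernel-verified Lean document; each statement's English description precedes it below -/
import Mathlib

section
/- (Theorem 1) There exists a universal constant c > 0 such that for every N ≥ 1, every collection of points x_1, …, x_N ∈ 𝕋², and every real X ≥ 0, one has Σ_{k ∈ ℤ², ‖k‖ ≤ X} |Σ_{n=1}^N e^{2πi⟨k, x_n⟩}|² ≥ c · Σ_{i,j=1}^N X² / (1 + X⁴ ‖x_i − x_j‖⁴). -/
open scoped Real BigOperators
open MeasureTheory

noncomputable section

/-- The `d`-dimensional torus `ℝ^d/ℤ^d`. -/
abbrev Torus (d : ℕ) := Fin d → AddCircle (1 : ℝ)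

/-- The character `e^{2πi⟨k,x⟩}` for `k ∈ ℤ^d`, `x ∈ 𝕋^d`. -/
def torusChar {d : ℕ} (k : Fin d → ℤ) (x : Torus d) : ℂ := ∏ m, fourier (k m) (x m)

/-- The torus (Euclidean) distance `min_{m ∈ ℤ^d} |x - y - m|`; each coordinate can be
minimized independently, giving the square root of the sum of squared circle distances. -/
def torusDist {d : ℕ} (x y : Torus d) : ℝ := Real.sqrt (∑ m, ‖x m - y m‖ ^ 2)

/-- The Euclidean norm of an integer vector `k ∈ ℤ^d`. -/
def znorm {d : ℕ} (k : Fin d → ℤ) : ℝ := Real.sqrt (∑ m, ((k m : ℝ)) ^ 2)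

lemma aux_fourier_bound (x : AddCircle (1 : ℝ)) : ‖(fourier 1 x : ℂ) - 1‖ ≤ 7 * ‖x‖ := by
  induction x using QuotientAddGroup.induction_on with
  | H y =>
    have h1 : ((y : ℝ) : AddCircle (1:ℝ)) = ((y - round y : ℝ) : AddCircle (1:ℝ)) := by
      rw [AddCircle.coe_sub, eq_comm, sub_eq_self, AddCircle.coe_eq_zero_iff]
      exact ⟨round y, by simp⟩
    change ‖(fourier 1 (y : AddCircle (1:ℝ)) : ℂ) - 1‖ ≤ 7 * ‖(y : AddCircle (1:ℝ))‖
    have h2 : ‖(y : AddCircle (1:ℝ))‖ = |y - round y| := by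
      rw [AddCircle.norm_eq]; simp
    rw [h2, h1, fourier_coe_apply]
    have h3 := Real.norm_exp_I_mul_ofReal_sub_one_le (x := 2 * π * (y - round y))
    have h4 : 2 * (π : ℂ) * Complex.I * ((1:ℤ):ℂ) * ((y - round y : ℝ) : ℂ) / ((1:ℝ):ℂ) =
        Complex.I * ((2 * π * (y - round y) : ℝ) : ℂ) := by
      push_cast; ring
    rw [h4]
    refine h3.trans ?_
    rw [Real.norm_eq_abs, abs_mul, abs_of_pos Real.two_pi_pos]
    gcongr
    have := Real.pi_lt_d2
    linarith

lemma aux_fourier_pow (a : ℕ) (x : AddCircle (1 : ℝ)) :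
    (fourier (a : ℤ) x : ℂ) = (fourier 1 x : ℂ) ^ a := by
  induction a with
  | zero => simp
  | succ n ih => 
    push_cast
    rw [fourier_add, ih, pow_succ]

/-- Dirichlet kernel lower bound near zero. -/
lemma aux_dir_small (z : ℂ) (hz : ‖z‖ = 1) (M : ℕ) (h : (M : ℝ) * ‖z - 1‖ ≤ 1 + ‖z - 1‖) :
    (M : ℝ) / 2 ≤ ‖∑ a ∈ Finset.range M, z ^ a‖ := by
  have hp : ∀ a : ℕ, ‖z ^ a - 1‖ ≤ a * ‖z - 1‖ := by
    intro a
    induction a with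
    | zero => simp
    | succ n ih =>
      have : z ^ (n+1) - 1 = z * (z ^ n - 1) + (z - 1) := by ring
      rw [this]
      refine (norm_add_le _ _).trans ?_
      rw [norm_mul, hz]
      push_cast
      linarith
  have h2 : ‖∑ a ∈ Finset.range M, (z ^ a - 1)‖ ≤ (M:ℝ) * (M - 1) / 2 * ‖z - 1‖ := by
    clear h
    induction M with
    | zero => simp
    | succ n ih =>
      rw [Finset.sum_range_succ]
      refine (norm_add_le _ _).trans ?_
      have := hp n
      push_cast
      nlinarith
  have h3 : ∑ a ∈ Finset.range M, (z ^ a - 1) = ∑ a ∈ Finset.range M, z ^ a - (M : ℂ) := by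
    simp [Finset.sum_sub_distrib]
  rw [h3] at h2
  have h4 : ‖(M:ℂ)‖ ≤ ‖∑ a ∈ Finset.range M, z ^ a‖ + ‖∑ a ∈ Finset.range M, z ^ a - (M : ℂ)‖ := by
    have := norm_sub_le (∑ a ∈ Finset.range M, z ^ a) (∑ a ∈ Finset.range M, z ^ a - (M : ℂ))
    simpa using this
  rw [Complex.norm_natCast] at h4
  have hM : (0:ℝ) ≤ M := by positivity
  nlinarith

/-- The averaged Fejer-type kernel. -/
def auxH (L : ℕ) (z : ℂ) : ℝ := ∑ M ∈ Finset.range L, ‖∑ a ∈ Finset.range (M+1), z ^ a‖ ^ 2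

lemma auxH_far (z : ℂ) (hz : ‖z‖ = 1) (L : ℕ) (h : 8 < L * ‖z - 1‖) :
    (L : ℝ) / ‖z - 1‖ ^ 2 ≤ auxH L z := by
  have ht : 0 < ‖z - 1‖ := by
    by_contra h'
    have : ‖z - 1‖ = 0 := le_antisymm (not_lt.1 h') (norm_nonneg _)
    rw [this] at h; simp at h; linarith
  have hz1 : z - 1 ≠ 0 := norm_pos_iff.1 ht
  have key : auxH L z * ‖z - 1‖ ^ 2 = ∑ M ∈ Finset.range L, ‖z ^ (M+1) - 1‖ ^ 2 := by
    unfold auxH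
    rw [Finset.sum_mul]
    refine Finset.sum_congr rfl fun M _ => ?_
    rw [← mul_pow, ← norm_mul, geom_sum_mul]
  have hsq : ∀ M : ℕ, ‖z ^ (M+1) - 1‖ ^ 2 = 2 - 2 * (z ^ (M+1)).re := by
    intro M
    have h1 : ‖z ^ (M+1)‖ ^ 2 = 1 := by simp [hz]
    rw [Complex.sq_norm, Complex.normSq_apply] at h1 ⊢
    simp only [Complex.sub_re, Complex.sub_im, Complex.one_re, Complex.one_im]
    linarith
  have hre : ∑ M ∈ Finset.range L, (z ^ (M+1)).re ≤ L / 4 := by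
    rw [← Complex.re_sum]
    refine (Complex.re_le_norm _).trans ?_
    have e : (∑ M ∈ Finset.range L, z ^ (M+1)) * (z - 1) = z * (z ^ L - 1) := by
      rw [← geom_sum_mul, ← mul_assoc, Finset.mul_sum]
      simp only [pow_succ']
    have e2 := congrArg norm e
    rw [norm_mul, norm_mul, hz, one_mul] at e2
    have e3 : ‖z ^ L - 1‖ ≤ 2 := by
      refine (norm_sub_le _ _).trans ?_
      simp [hz]; norm_num
    have : ‖∑ M ∈ Finset.range L, z ^ (M+1)‖ ≤ 2 / ‖z - 1‖ := by
      rw [le_div_iff₀ ht]; linarith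
    refine this.trans ?_
    rw [div_le_iff₀ ht]; linarith
  rw [div_le_iff₀ (by positivity), key]
  simp only [hsq]
  rw [Finset.sum_sub_distrib, ← Finset.mul_sum]
  simp
  have : (0:ℝ) ≤ L := by positivity
  linarith

lemma aux_cubes (K : ℕ) : (K:ℝ) ^ 3 / 12 ≤ ∑ M ∈ Finset.range K, (((M + 1 : ℕ) : ℝ) / 2) ^ 2 := by
  induction K with
  | zero => simp
  | succ n ih =>
    rw [Finset.sum_range_succ]
    have : (0:ℝ) ≤ n := by positivity
    refine le_trans ?_ (add_le_add_left ih _)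
    push_cast
    nlinarith

lemma auxH_near (z : ℂ) (hz : ‖z‖ = 1) (L : ℕ) (h : L * ‖z - 1‖ ≤ 8) :
    (L : ℝ) ^ 3 / 6144 ≤ auxH L z := by
  obtain ⟨K, hK1, hK2, hK3⟩ : ∃ K : ℕ, L ≤ 8 * K ∧ 8 * K ≤ L + 7 ∧ K ≤ L :=
    ⟨(L + 7) / 8, by omega, by omega, by omega⟩
  have hK1' : (L:ℝ) ≤ 8 * K := by exact_mod_cast hK1
  have h1 : (L:ℝ) ^ 3 / 6144 ≤ (K:ℝ) ^ 3 / 12 := by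
    have : (L:ℝ) ^ 3 ≤ (8 * K) ^ 3 := by gcongr
    nlinarith
  refine h1.trans ((aux_cubes K).trans ?_)
  unfold auxH
  refine le_trans (b := ∑ M ∈ Finset.range K, ‖∑ a ∈ Finset.range (M+1), z ^ a‖ ^ 2) ?_ ?_
  · refine Finset.sum_le_sum fun M hM => ?_
    have hM' := Finset.mem_range.1 hM
    gcongr
    apply aux_dir_small z hz
    have : 8 * M ≤ L := by omega
    have : 8 * (M:ℝ) ≤ L := by exact_mod_cast this
    push_cast
    nlinarith [norm_nonneg (z - 1)]
  · refine Finset.sum_le_sum_of_subset_of_nonneg ?_ fun _ _ _ => by positivity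
    intro a; simp; omega

lemma auxH_lower (z : ℂ) (hz : ‖z‖ = 1) (L : ℕ) :
    (L : ℝ) ^ 3 / (6144 * (1 + L ^ 2 * ‖z - 1‖ ^ 2)) ≤ auxH L z := by
  rcases le_or_gt (L * ‖z - 1‖) 8 with h | h
  · refine le_trans ?_ (auxH_near z hz L h)
    gcongr
    nlinarith [show 0 ≤ (L:ℝ) ^ 2 * ‖z - 1‖ ^ 2 by positivity]
  · refine le_trans ?_ (auxH_far z hz L h)
    have ht : 0 < ‖z - 1‖ := by
      by_contra h'
      have : ‖z - 1‖ = 0 := le_antisymm (not_lt.1 h') (norm_nonneg _)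
      rw [this] at h; simp at h; linarith
    rw [div_le_div_iff₀ (by positivity) (by positivity)]
    have : 0 ≤ (L:ℝ) ^ 3 * ‖z - 1‖ ^ 2 := by positivity
    have : (0:ℝ) ≤ L := by positivity
    nlinarith

lemma auxH_circle (x : AddCircle (1:ℝ)) (L : ℕ) :
    (L : ℝ) ^ 3 / (301056 * (1 + L ^ 2 * ‖x‖ ^ 2)) ≤ auxH L (fourier 1 x) := by
  refine le_trans ?_ (auxH_lower _ (by rw [fourier_apply]; exact Circle.norm_coe _) L)
  have h := aux_fourier_bound x
  have h2 : ‖(fourier 1 x : ℂ) - 1‖ ^ 2 ≤ (7 * ‖x‖) ^ 2 := by gcongr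
  apply div_le_div_of_nonneg_left (by positivity) (by positivity)
  have : (L:ℝ)^2 * ‖(fourier 1 x : ℂ) - 1‖ ^ 2 ≤ (L:ℝ)^2 * (7 * ‖x‖) ^ 2 := by gcongr
  nlinarith

lemma aux_prod_lower (x y : Torus 2) (L : ℕ) :
    (L : ℝ) ^ 6 / (2 * 301056 ^ 2 * (1 + L ^ 4 * torusDist x y ^ 4)) ≤
      auxH L (fourier 1 (x 0 - y 0)) * auxH L (fourier 1 (x 1 - y 1)) := by
  have h := mul_le_mul (auxH_circle (x 0 - y 0) L) (auxH_circle (x 1 - y 1) L) (by positivity)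
    (by unfold auxH; positivity)
  refine le_trans ?_ h
  have hd : torusDist x y ^ 4 = (‖x 0 - y 0‖ ^ 2 + ‖x 1 - y 1‖ ^ 2) ^ 2 := by
    unfold torusDist
    rw [show (4:ℕ) = 2 * 2 from rfl, pow_mul, Real.sq_sqrt (by positivity)]
    simp
  rw [hd, div_mul_div_comm]
  generalize ‖x 0 - y 0‖ = u
  generalize ‖x 1 - y 1‖ = v
  have e : (L:ℝ) ^ 6 = (L:ℝ) ^ 3 * (L:ℝ) ^ 3 := by ring
  rw [e]
  apply div_le_div_of_nonneg_left (by positivity) (by positivity)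
  have : (1 + (L:ℝ) ^ 2 * u ^ 2) * (1 + (L:ℝ) ^ 2 * v ^ 2) ≤
      2 * (1 + L ^ 4 * (u ^ 2 + v ^ 2) ^ 2) := by
    have : 0 ≤ (L:ℝ) ^ 4 * u ^ 4 := by positivity
    have : 0 ≤ (L:ℝ) ^ 4 * v ^ 4 := by positivity
    have : 0 ≤ (L:ℝ) ^ 4 * (u ^ 2 * v ^ 2) := by positivity
    nlinarith [sq_nonneg ((L:ℝ) ^ 2 * (u ^ 2 + v ^ 2) - 1)]
  nlinarith

lemma aux_dir_sq (u : AddCircle (1:ℝ)) (M : ℕ) :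
    ((‖∑ a ∈ Finset.range M, (fourier 1 u : ℂ) ^ a‖ ^ 2 : ℝ) : ℂ) =
      ∑ a ∈ Finset.range M, ∑ b ∈ Finset.range M, (fourier ((a:ℤ) - b) u : ℂ) := by
  rw [← Complex.normSq_eq_norm_sq, ← Complex.mul_conj, map_sum, Finset.sum_mul_sum]
  refine Finset.sum_congr rfl fun a _ => Finset.sum_congr rfl fun b _ => ?_
  rw [sub_eq_add_neg, fourier_add, fourier_neg, aux_fourier_pow, aux_fourier_pow]

lemma aux_char_sub {d : ℕ} (k : Fin d → ℤ) (x y : Torus d) :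
    torusChar k (x - y) = torusChar k x * (starRingEnd ℂ) (torusChar k y) := by
  unfold torusChar
  rw [map_prod, ← Finset.prod_mul_distrib]
  refine Finset.prod_congr rfl fun m _ => ?_
  rw [← fourier_neg]
  simp [fourier_apply, smul_sub, sub_eq_add_neg, AddCircle.toCircle_add]

lemma aux_S_sq {N d : ℕ} (k : Fin d → ℤ) (x : Fin N → Torus d) :
    ((‖∑ n, torusChar k (x n)‖ ^ 2 : ℝ) : ℂ) = ∑ i, ∑ j, torusChar k (x i - x j) := by
  rw [← Complex.normSq_eq_norm_sq, ← Complex.mul_conj, map_sum, Finset.sum_mul_sum]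
  simp only [aux_char_sub]

lemma aux_expand {N : ℕ} (x : Fin N → Torus 2) (P Q : ℕ) :
    ∑ i, ∑ j, ‖∑ a ∈ Finset.range P, (fourier 1 (x i 0 - x j 0) : ℂ) ^ a‖ ^ 2 *
      ‖∑ a ∈ Finset.range Q, (fourier 1 (x i 1 - x j 1) : ℂ) ^ a‖ ^ 2 =
    ∑ b ∈ Finset.range P ×ˢ Finset.range Q, ∑ a ∈ Finset.range P ×ˢ Finset.range Q,
      ‖∑ n, torusChar ![(a.1:ℤ) - b.1, (a.2:ℤ) - b.2] (x n)‖ ^ 2 := by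
  have h : ∀ u v : ℝ, (u : ℂ) = v → u = v := fun u v h => by exact_mod_cast h
  apply h
  simp only [Complex.ofReal_sum, Complex.ofReal_mul, aux_dir_sq, aux_S_sq]
  have e : ∀ i j, (∑ a ∈ Finset.range P, ∑ b ∈ Finset.range P,
        (fourier ((a:ℤ) - b) (x i 0 - x j 0) : ℂ)) *
      (∑ a ∈ Finset.range Q, ∑ b ∈ Finset.range Q,
        (fourier ((a:ℤ) - b) (x i 1 - x j 1) : ℂ)) =
      ∑ b ∈ Finset.range P ×ˢ Finset.range Q, ∑ a ∈ Finset.range P ×ˢ Finset.range Q,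
        torusChar ![(a.1:ℤ) - b.1, (a.2:ℤ) - b.2] (x i - x j) := by
    intro i j
    rw [Finset.sum_comm (s := Finset.range P), Finset.sum_comm (s := Finset.range Q),
      Finset.sum_mul_sum, Finset.sum_product]
    refine Finset.sum_congr rfl fun b _ => Finset.sum_congr rfl fun b' _ => ?_
    rw [Finset.sum_mul_sum, Finset.sum_product]
    simp [torusChar]
  simp only [e]
  rw [Finset.sum_congr rfl fun i _ => Finset.sum_comm, Finset.sum_comm]
  refine Finset.sum_congr rfl fun b _ => ?_
  rw [Finset.sum_congr rfl fun i _ => Finset.sum_comm, Finset.sum_comm]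

lemma aux_finite (X : ℝ) : Finite {k : Fin 2 → ℤ // znorm k ≤ X} := by
  have hs : {k : Fin 2 → ℤ | znorm k ≤ X} ⊆
      Set.Icc (fun _ => -⌈X⌉) (fun _ => ⌈X⌉) := by
    intro k hk
    have hb : ∀ m, |(k m : ℝ)| ≤ X := by
      intro m
      refine le_trans ?_ hk
      unfold znorm
      apply Real.le_sqrt_of_sq_le
      rw [sq_abs]
      exact Finset.single_le_sum (f := fun m => (k m : ℝ) ^ 2) (fun _ _ => by positivity)
        (Finset.mem_univ m)
    constructor <;> intro m
    · have := (abs_le.1 (hb m)).1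
      have h2 := Int.le_ceil X
      have : ((-⌈X⌉ : ℤ) : ℝ) ≤ k m := by push_cast; linarith
      exact_mod_cast this
    · have := (abs_le.1 (hb m)).2
      have h2 := Int.le_ceil X
      have : (k m : ℝ) ≤ ⌈X⌉ := by linarith
      exact_mod_cast this
  exact ((Set.finite_Icc _ _).subset hs).to_subtype

lemma aux_inner {N : ℕ} (x : Fin N → Torus 2) (X : ℝ) (hX : 0 ≤ X) (L P Q : ℕ)
    (hL : 2 * (L - 1 : ℝ) ≤ X) (hP : P ≤ L) (hQ : Q ≤ L) (b : ℕ × ℕ)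
    (hb : b ∈ Finset.range P ×ˢ Finset.range Q) :
    ∑ a ∈ Finset.range P ×ˢ Finset.range Q,
      ‖∑ n, torusChar ![(a.1:ℤ) - b.1, (a.2:ℤ) - b.2] (x n)‖ ^ 2 ≤
    ∑' k : {k : Fin 2 → ℤ // znorm k ≤ X}, ‖∑ n, torusChar k.1 (x n)‖ ^ 2 := by
  haveI := aux_finite X
  haveI := Fintype.ofFinite {k : Fin 2 → ℤ // znorm k ≤ X}
  rw [tsum_fintype]
  rw [Finset.mem_product, Finset.mem_range, Finset.mem_range] at hb
  have hz : ∀ a ∈ Finset.range P ×ˢ Finset.range Q,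
      znorm ![(a.1:ℤ) - b.1, (a.2:ℤ) - b.2] ≤ X := by
    intro a ha
    rw [Finset.mem_product, Finset.mem_range, Finset.mem_range] at ha
    have bd : ∀ s t R : ℕ, s < R → t < R → R ≤ L → ((s:ℝ) - t) ^ 2 ≤ (L - 1) ^ 2 := by
      intro s t R h1 h2 h3
      have h4 : (s:ℝ) + 1 ≤ L := by exact_mod_cast (by omega : s + 1 ≤ L)
      have h5 : (t:ℝ) + 1 ≤ L := by exact_mod_cast (by omega : t + 1 ≤ L)
      have : (0:ℝ) ≤ s := by positivity
      have : (0:ℝ) ≤ t := by positivity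
      apply sq_le_sq' <;> linarith
    have h1 := bd a.1 b.1 P ha.1 hb.1 hP
    have h2 := bd a.2 b.2 Q ha.2 hb.2 hQ
    unfold znorm
    apply Real.sqrt_le_iff.2 ⟨hX, ?_⟩
    simp
    have : (1:ℝ) ≤ L := by exact_mod_cast (by omega : 1 ≤ L)
    nlinarith
  rw [← Finset.sum_attach]
  let f : {a // a ∈ Finset.range P ×ˢ Finset.range Q} → {k : Fin 2 → ℤ // znorm k ≤ X} :=
    fun a => ⟨_, hz a.1 a.2⟩
  have hf : Function.Injective f := by
    intro a a' h
    have h1 := congrFun (congrArg Subtype.val h) 0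
    have h2 := congrFun (congrArg Subtype.val h) 1
    simp [f] at h1 h2
    exact Subtype.ext (Prod.ext h1 h2)
  calc _ = ∑ k ∈ Finset.univ.map ⟨f, hf⟩, ‖∑ n, torusChar k.1 (x n)‖ ^ 2 := by
        rw [Finset.sum_map]; rfl
    _ ≤ _ := Finset.sum_le_sum_of_subset_of_nonneg (Finset.subset_univ _)
        fun _ _ _ => by positivity

lemma aux_upper {N : ℕ} (x : Fin N → Torus 2) (X : ℝ) (hX : 0 ≤ X) (L : ℕ)
    (hL : 2 * (L - 1 : ℝ) ≤ X) :
    ∑ i, ∑ j, auxH L (fourier 1 (x i 0 - x j 0)) * auxH L (fourier 1 (x i 1 - x j 1)) ≤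
    (L:ℝ) ^ 4 * ∑' k : {k : Fin 2 → ℤ // znorm k ≤ X}, ‖∑ n, torusChar k.1 (x n)‖ ^ 2 := by
  set T := ∑' k : {k : Fin 2 → ℤ // znorm k ≤ X}, ‖∑ n, torusChar k.1 (x n)‖ ^ 2 with hT
  have hT0 : 0 ≤ T := tsum_nonneg fun _ => by positivity
  unfold auxH
  simp only [Finset.sum_mul_sum]
  rw [Finset.sum_congr rfl fun i _ => Finset.sum_comm, Finset.sum_comm]
  have : ∀ P ∈ Finset.range L, (∑ i, ∑ j, ∑ Q ∈ Finset.range L,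
      ‖∑ a ∈ Finset.range (P+1), (fourier 1 (x i 0 - x j 0) : ℂ) ^ a‖ ^ 2 *
      ‖∑ a ∈ Finset.range (Q+1), (fourier 1 (x i 1 - x j 1) : ℂ) ^ a‖ ^ 2) ≤ (L:ℝ) ^ 3 * T := by
    intro P hP
    rw [Finset.sum_congr rfl fun i _ => Finset.sum_comm, Finset.sum_comm]
    have : ∀ Q ∈ Finset.range L, (∑ i, ∑ j, 
      ‖∑ a ∈ Finset.range (P+1), (fourier 1 (x i 0 - x j 0) : ℂ) ^ a‖ ^ 2 *
      ‖∑ a ∈ Finset.range (Q+1), (fourier 1 (x i 1 - x j 1) : ℂ) ^ a‖ ^ 2) ≤ (L:ℝ) ^ 2 * T := by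
      intro Q hQ
      rw [Finset.mem_range] at hP hQ
      rw [aux_expand]
      refine (Finset.sum_le_card_nsmul _ _ T fun b hb =>
        aux_inner x X hX L (P+1) (Q+1) hL hP hQ b hb).trans ?_
      rw [Finset.card_product, Finset.card_range, Finset.card_range, nsmul_eq_mul]
      gcongr
      have : (P+1) * (Q+1) ≤ L ^ 2 := by rw [sq]; exact Nat.mul_le_mul hP hQ
      exact_mod_cast this
    refine (Finset.sum_le_card_nsmul _ _ _ this).trans (le_of_eq ?_)
    rw [Finset.card_range, nsmul_eq_mul]; ring
  refine (Finset.sum_le_card_nsmul _ _ _ this).trans (le_of_eq ?_)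
  rw [Finset.card_range, nsmul_eq_mul]; ring

lemma aux_dist_le (x y : Torus 2) : torusDist x y ^ 4 ≤ 1 := by
  have hd : torusDist x y ^ 4 = (‖x 0 - y 0‖ ^ 2 + ‖x 1 - y 1‖ ^ 2) ^ 2 := by
    unfold torusDist
    rw [show (4:ℕ) = 2 * 2 from rfl, pow_mul, Real.sq_sqrt (by positivity)]
    simp
  have h0 : ∀ u : AddCircle (1:ℝ), ‖u‖ ^ 2 ≤ 1 / 4 := by
    intro u
    have := AddCircle.norm_le_half_period (1:ℝ) (x := u) one_ne_zero
    rw [abs_one] at this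
    nlinarith [norm_nonneg u]
  rw [hd]
  have := h0 (x 0 - y 0)
  have := h0 (x 1 - y 1)
  apply pow_le_one₀ (by positivity)
  linarith

lemma aux_compare (X : ℝ) (hX : 0 ≤ X) (L : ℕ) (hL1 : 1 ≤ L) (hLX : X ≤ 2 * L)
    (hL : 2 * (L - 1 : ℝ) ≤ X) (r : ℝ) (hr0 : 0 ≤ r) (hr : r ≤ 1) :
    X ^ 2 / (1 + X ^ 4 * r) ≤ 4 * (L ^ 2 / (1 + L ^ 4 * r)) := by
  have hL1' : (1:ℝ) ≤ L := by exact_mod_cast hL1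
  rcases le_or_gt (L:ℝ) X with h | h
  · have h1 : X ^ 2 ≤ 4 * L ^ 2 := by nlinarith
    rw [← mul_div_assoc]
    gcongr
  · have hLe : L = 1 := by
      have : (L:ℝ) < 2 := by linarith
      have : L < 2 := by exact_mod_cast this
      omega
    subst hLe
    simp at h ⊢
    have h1 : X ^ 2 / (1 + X ^ 4 * r) ≤ 1 := by
      rw [div_le_one (by positivity)]
      have : 0 ≤ X ^ 4 * r := by positivity
      nlinarith
    refine h1.trans ?_
    rw [← div_eq_mul_inv, le_div_iff₀ (by linarith)]
    linarith

/-- Theorem 1. -/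
theorem theorem_one :
    ∃ c : ℝ, 0 < c ∧ ∀ (N : ℕ), 1 ≤ N → ∀ (x : Fin N → Torus 2) (X : ℝ), 0 ≤ X →
      c * ∑ i, ∑ j, X ^ 2 / (1 + X ^ 4 * torusDist (x i) (x j) ^ 4) ≤
        ∑' k : {k : Fin 2 → ℤ // znorm k ≤ X}, ‖∑ n, torusChar k.1 (x n)‖ ^ 2 := by
  refine ⟨1 / (8 * 301056 ^ 2), by norm_num, ?_⟩
  intro N _ x X hX
  obtain ⟨L, hL1, hLX, hL⟩ : ∃ L : ℕ, 1 ≤ L ∧ X ≤ 2 * L ∧ 2 * (L - 1 : ℝ) ≤ X := by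
    refine ⟨⌊X / 2⌋₊ + 1, by omega, ?_, ?_⟩
    · have := Nat.lt_floor_add_one (X / 2)
      push_cast; linarith
    · have := Nat.floor_le (show 0 ≤ X / 2 by positivity)
      push_cast; linarith
  have hL0 : (0:ℝ) < L := by exact_mod_cast hL1
  have hup := aux_upper x X hX L hL
  set T := ∑' k : {k : Fin 2 → ℤ // znorm k ≤ X}, ‖∑ n, torusChar k.1 (x n)‖ ^ 2 with hT
  have h4 : (0:ℝ) < (L:ℝ) ^ 4 := by positivity
  refine le_of_mul_le_mul_left (le_trans ?_ hup) h4
  rw [Finset.mul_sum, Finset.mul_sum]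
  refine Finset.sum_le_sum fun i _ => ?_
  rw [Finset.mul_sum, Finset.mul_sum]
  refine Finset.sum_le_sum fun j _ => ?_
  refine le_trans ?_ (aux_prod_lower (x i) (x j) L)
  have hr0 : 0 ≤ torusDist (x i) (x j) ^ 4 := by positivity
  have hc := aux_compare X hX L hL1 hLX hL _ hr0 (aux_dist_le _ _)
  calc (L:ℝ) ^ 4 * (1 / (8 * 301056 ^ 2) * (X ^ 2 / (1 + X ^ 4 * torusDist (x i) (x j) ^ 4)))
      ≤ (L:ℝ) ^ 4 * (1 / (8 * 301056 ^ 2) *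
        (4 * (L ^ 2 / (1 + L ^ 4 * torusDist (x i) (x j) ^ 4)))) := by gcongr
    _ = _ := by
      have : (1 + L ^ 4 * torusDist (x i) (x j) ^ 4) ≠ 0 := by positivity
      field_simp
      norm_num
end
end

section
/- (Corollary 1) There exists a universal constant c > 0 such that for every N ≥ 1 and every collection of points x_1, …, x_N ∈ 𝕋², there exist a center x ∈ 𝕋² and a radius r ∈ {1/4, 1/2} such that the closed metric ball D = {y ∈ 𝕋² : ‖y − x‖ ≤ r} satisfies |#{1 ≤ i ≤ N : x_i ∈ D} − N·πr²| ≥ c · ( N^{−3/2} · Σ_{i,j=1}^N N / (1 + N² ‖x_i − x_j‖⁴) )^{1/2}. -/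
open scoped Real BigOperators
open MeasureTheory

noncomputable section

def FrC (X : ℝ) : ℝ := ∫ w in (0:ℝ)..X, Real.cos (w^2)
def FrS (X : ℝ) : ℝ := ∫ w in (0:ℝ)..X, Real.sin (w^2)

/-- A tail estimate for oscillating integrals with quadratic phase. -/
lemma tail_bound (f g : ℝ → ℝ) (hf : Continuous f) (hg : ∀ x, |g x| ≤ 1)
    (hgc : Continuous g)
    (hd : ∀ x, HasDerivAt g (2 * x * f x) x) {X Y : ℝ} (hX : 0 < X) (hXY : X ≤ Y) :
    |∫ w in X..Y, f w| ≤ 2 / X := by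
  have hpos : ∀ x ∈ Set.uIcc X Y, 0 < x := by
    intro x hx
    rw [Set.uIcc_of_le hXY] at hx
    linarith [hx.1]
  have hu : ∀ x ∈ Set.uIcc X Y, HasDerivAt (fun x : ℝ => (2 * x)⁻¹) (-(2 * x ^ 2)⁻¹) x := by
    intro x hx
    have h0 := (hpos x hx).ne'
    have h1 : HasDerivAt (fun x : ℝ => 2 * x) 2 x := by
      simpa using (hasDerivAt_id x).const_mul (2:ℝ)
    have h2 := h1.inv (by positivity)
    refine h2.congr_deriv ?_
    field_simp
  have hinvc : ContinuousOn (fun x : ℝ => -(2 * x ^ 2)⁻¹) (Set.uIcc X Y) := by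
    apply ContinuousOn.neg
    apply ContinuousOn.inv₀ (by fun_prop)
    intro x hx
    have := hpos x hx
    positivity
  have hp := intervalIntegral.integral_mul_deriv_eq_deriv_mul (a := X) (b := Y) hu
    (fun x _ => hd x) (hinvc.intervalIntegrable)
    (Continuous.intervalIntegrable (by fun_prop) _ _)
  have he : ∫ w in X..Y, f w = ∫ x in X..Y, (2 * x)⁻¹ * (2 * x * f x) := by
    apply intervalIntegral.integral_congr
    intro x hx
    have h0 := (hpos x hx).ne'
    simp only
    field_simp
  rw [he, hp]
  have hY : 0 < Y := by linarith
  have hIntg : |∫ x in X..Y, -(2 * x ^ 2)⁻¹ * g x| ≤ ∫ x in X..Y, (2 * x ^ 2)⁻¹ := by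
    have := intervalIntegral.norm_integral_le_of_norm_le (μ := volume) (a := X) (b := Y)
      (f := fun x => -(2 * x ^ 2)⁻¹ * g x) (g := fun x => (2 * x ^ 2)⁻¹) hXY
      (by
        filter_upwards with x hx
        rw [Real.norm_eq_abs, abs_mul, abs_neg, abs_of_nonneg (by positivity : (0:ℝ) ≤ (2 * x ^ 2)⁻¹)]
        have : (0:ℝ) ≤ (2 * x ^ 2)⁻¹ := by positivity
        nlinarith [hg x])
      (by
        have := hinvc.neg.intervalIntegrable (μ := volume)
        exact this.congr (by intro x _; simp))
    simpa using this
  have hval : ∫ x in X..Y, (2 * x ^ 2)⁻¹ = (2 * X)⁻¹ - (2 * Y)⁻¹ := by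
    have := intervalIntegral.integral_eq_sub_of_hasDerivAt hu hinvc.intervalIntegrable
    simp only [intervalIntegral.integral_neg] at this
    linarith
  have e1 : |(2 * Y)⁻¹ * g Y| ≤ (2 * Y)⁻¹ := by
    rw [abs_mul, abs_of_pos (by positivity)]
    have : 0 < (2 * Y)⁻¹ := by positivity
    nlinarith [hg Y]
  have e2 : |(2 * X)⁻¹ * g X| ≤ (2 * X)⁻¹ := by
    rw [abs_mul, abs_of_pos (by positivity)]
    have : 0 < (2 * X)⁻¹ := by positivity
    nlinarith [hg X]
  have e3 : (2 / X) = 4 * (2 * X)⁻¹ := by field_simp; norm_num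
  rw [e3]
  have e4 : 0 < (2 * X)⁻¹ := by positivity
  have e5 : 0 < (2 * Y)⁻¹ := by positivity
  rw [hval] at hIntg
  rw [abs_le] at *
  constructor <;> linarith [e1.1, e1.2, e2.1, e2.2, hIntg.1, hIntg.2]

lemma FrC_diff {X Y : ℝ} (hX : 0 < X) (hXY : X ≤ Y) : |FrC Y - FrC X| ≤ 2 / X := by
  have h : FrC Y - FrC X = ∫ w in X..Y, Real.cos (w^2) := by
    unfold FrC
    rw [intervalIntegral.integral_interval_sub_left] <;>
      exact Continuous.intervalIntegrable (by fun_prop) _ _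
  rw [h]
  refine tail_bound _ (fun x => Real.sin (x^2)) (by fun_prop) (fun x => Real.abs_sin_le_one _)
    (by fun_prop) ?_ hX hXY
  intro x
  have := (hasDerivAt_pow 2 x).sin
  refine this.congr_deriv ?_
  simp; ring

lemma FrS_diff {X Y : ℝ} (hX : 0 < X) (hXY : X ≤ Y) : |FrS Y - FrS X| ≤ 2 / X := by
  have h : FrS Y - FrS X = ∫ w in X..Y, Real.sin (w^2) := by
    unfold FrS
    rw [intervalIntegral.integral_interval_sub_left] <;>
      exact Continuous.intervalIntegrable (by fun_prop) _ _
  rw [h]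
  refine tail_bound _ (fun x => -Real.cos (x^2)) (by fun_prop)
    (fun x => by rw [abs_neg]; exact Real.abs_cos_le_one _)
    (by fun_prop) ?_ hX hXY
  intro x
  have := (hasDerivAt_pow 2 x).cos.neg
  refine this.congr_deriv ?_
  simp; ring

lemma FrS_one : (29:ℝ)/100 ≤ FrS 1 := by
  have h1 : ∫ w in (0:ℝ)..1, (w^2 - w^6/4) ≤ FrS 1 := by
    unfold FrS
    apply intervalIntegral.integral_mono_on (by norm_num)
    · exact Continuous.intervalIntegrable (by fun_prop) _ _
    · exact Continuous.intervalIntegrable (by fun_prop) _ _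
    · intro x hx
      rcases eq_or_lt_of_le hx.1 with h | h
      · subst h; simp
      · have := Real.sin_gt_sub_cube (x := x^2) (by positivity)
        have e : (x^2)^3 = x^6 := by ring
        rw [e] at this
        have h6 : 0 < x^6 := by positivity
        linarith
  have h2 : ∫ w in (0:ℝ)..1, (w^2 - w^6/4) = 1/3 - 1/28 := by
    rw [intervalIntegral.integral_sub, intervalIntegral.integral_div] 
    · simp [integral_pow]; norm_num
    · exact Continuous.intervalIntegrable (by fun_prop) _ _
    · exact Continuous.intervalIntegrable (by fun_prop) _ _
  rw [h2] at h1
  refine le_trans ?_ h1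
  norm_num

lemma FrS_lower {X : ℝ} (hX : 1 ≤ X) : (4:ℝ)/100 ≤ FrS X := by
  have h : FrS X - FrS 1 = ∫ w in (1:ℝ)..X, Real.sin (w^2) := by
    unfold FrS
    rw [intervalIntegral.integral_interval_sub_left] <;>
      exact Continuous.intervalIntegrable (by fun_prop) _ _
  have hpos : ∀ x ∈ Set.uIcc 1 X, 0 < x := by
    intro x hx
    rw [Set.uIcc_of_le hX] at hx
    linarith [hx.1]
  have hu : ∀ x ∈ Set.uIcc 1 X, HasDerivAt (fun x : ℝ => (2 * x)⁻¹) (-(2 * x ^ 2)⁻¹) x := by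
    intro x hx
    have h0 := (hpos x hx).ne'
    have h1 : HasDerivAt (fun x : ℝ => 2 * x) 2 x := by
      simpa using (hasDerivAt_id x).const_mul (2:ℝ)
    have h2 := h1.inv (by positivity)
    refine h2.congr_deriv ?_
    field_simp
  have hinvc : ContinuousOn (fun x : ℝ => -(2 * x ^ 2)⁻¹) (Set.uIcc 1 X) := by
    apply ContinuousOn.neg
    apply ContinuousOn.inv₀ (by fun_prop)
    intro x hx
    have := hpos x hx
    positivity
  have hd : ∀ x ∈ Set.uIcc 1 X, HasDerivAt (fun x : ℝ => 1 - Real.cos (x^2))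
      (2 * x * Real.sin (x^2)) x := by
    intro x _
    have := (hasDerivAt_pow 2 x).cos.const_sub 1
    refine this.congr_deriv ?_
    simp; ring
  have hp := intervalIntegral.integral_mul_deriv_eq_deriv_mul (a := 1) (b := X) hu
    hd (hinvc.intervalIntegrable)
    (Continuous.intervalIntegrable (by fun_prop) _ _)
  have he : ∫ w in (1:ℝ)..X, Real.sin (w^2) = ∫ x in (1:ℝ)..X, (2 * x)⁻¹ * (2 * x * Real.sin (x^2)) := by
    apply intervalIntegral.integral_congr
    intro x hx
    have h0 := (hpos x hx).ne'
    simp only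
    field_simp
  have hneg : ∫ x in (1:ℝ)..X, -(2 * x ^ 2)⁻¹ * (1 - Real.cos (x^2)) ≤ 0 := by
    rw [← neg_nonneg, ← intervalIntegral.integral_neg]
    apply intervalIntegral.integral_nonneg hX
    intro x hx
    have h1 := Real.cos_le_one (x^2)
    have h2 : (0:ℝ) ≤ (2 * x ^ 2)⁻¹ := by positivity
    nlinarith
  have h3 : 0 ≤ (2 * X)⁻¹ * (1 - Real.cos (X^2)) := by
    have h1 := Real.cos_le_one (X^2)
    apply mul_nonneg (by positivity) (by linarith)
  have h4 : (2 * (1:ℝ))⁻¹ * (1 - Real.cos (1^2)) ≤ 1/4 := by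
    have := Real.one_sub_sq_div_two_le_cos (x := 1)
    norm_num at this ⊢
    linarith
  have := FrS_one
  rw [he, hp] at h
  linarith

/-- boundary-type estimate -/
lemma osc_bound (k k' : ℝ → ℝ) (hk : ∀ x ∈ Set.uIcc (0:ℝ) 1, HasDerivAt k (k' x) x)
    (hk' : ContinuousOn k' (Set.uIcc 0 1)) :
    ∃ K : ℝ, 0 < K ∧ ∀ t : ℝ, 0 < t →
      |∫ u in (0:ℝ)..1, u * k u * Real.sin (t * (1 - u^2))| ≤ K / t := by
  obtain ⟨M, hM⟩ := isCompact_uIcc.exists_bound_of_continuousOn hk'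
  refine ⟨|k 1| + |k 0| + |M| + 1, by positivity, ?_⟩
  intro t ht
  have hd : ∀ x ∈ Set.uIcc (0:ℝ) 1, HasDerivAt (fun u : ℝ => Real.cos (t * (1 - u^2)))
      (2 * t * x * Real.sin (t * (1 - x^2))) x := by
    intro x _
    have := (((hasDerivAt_pow 2 x).const_sub 1).const_mul t).cos
    refine this.congr_deriv ?_
    simp; ring
  have hp := intervalIntegral.integral_mul_deriv_eq_deriv_mul (a := 0) (b := 1) hk
    hd (hk'.intervalIntegrable)
    (Continuous.intervalIntegrable (by fun_prop) _ _)
  have he : ∫ u in (0:ℝ)..1, u * k u * Real.sin (t * (1 - u^2)) =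
      (2 * t)⁻¹ * ∫ x in (0:ℝ)..1, k x * (2 * t * x * Real.sin (t * (1 - x^2))) := by
    rw [← intervalIntegral.integral_const_mul]
    congr 1
    ext x
    field_simp
  have hb : |∫ x in (0:ℝ)..1, k' x * Real.cos (t * (1 - x^2))| ≤ |M| := by
    have := intervalIntegral.norm_integral_le_of_norm_le_const (a := (0:ℝ)) (b := 1) (C := |M|)
      (f := fun x => k' x * Real.cos (t * (1 - x^2))) (by
        intro x hx
        rw [norm_mul]
        have h1 := hM x (Set.uIoc_subset_uIcc hx)
        have h2 := Real.abs_cos_le_one (t * (1 - x^2))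
        rw [← Real.norm_eq_abs] at h2
        have h3 := norm_nonneg (k' x)
        have h4 := le_abs_self M
        nlinarith)
    simpa using this
  rw [he, hp, abs_mul, abs_of_pos (by positivity : 0 < (2 * t)⁻¹)]
  have h1 : |k 1 * Real.cos (t * (1 - 1^2))| ≤ |k 1| := by
    rw [abs_mul]
    nlinarith [abs_nonneg (k 1), Real.abs_cos_le_one (t * (1 - 1^2))]
  have h0 : |k 0 * Real.cos (t * (1 - 0^2))| ≤ |k 0| := by
    rw [abs_mul]
    nlinarith [abs_nonneg (k 0), Real.abs_cos_le_one (t * (1 - 0^2))]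
  have h5 : |k 1 * Real.cos (t * (1 - 1^2)) - k 0 * Real.cos (t * (1 - 0^2)) -
     ∫ x in (0:ℝ)..1, k' x * Real.cos (t * (1 - x^2))| ≤ |k 1| + |k 0| + |M| := by
    rw [abs_le] at *
    constructor <;> linarith [h1.1, h1.2, h0.1, h0.2, hb.1, hb.2]
  rw [div_eq_inv_mul]
  apply mul_le_mul _ (by linarith) (abs_nonneg _) (by positivity)
  apply inv_anti₀ ht (by linarith)

def Fz (t : ℝ) : ℝ := ∫ u in (0:ℝ)..1, u^2 * √(2 - u^2) * Real.cos (t * (1 - u^2))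

def Pz (t : ℝ) : ℝ := ∫ u in (0:ℝ)..1, (2 * (1 - u^2) / √(2 - u^2)) * Real.sin (t * (1 - u^2))

lemma sq_pos_aux {x : ℝ} (hx : x ∈ Set.uIcc (0:ℝ) 1) : 0 < 2 - x^2 := by
  rw [Set.uIcc_of_le (by norm_num)] at hx
  nlinarith [hx.1, hx.2]

lemma h_cont : ContinuousOn (fun u : ℝ => 2 * (1 - u^2) / √(2 - u^2)) (Set.uIcc 0 1) := by
  apply ContinuousOn.div (by fun_prop) (by fun_prop)
  intro x hx
  exact (Real.sqrt_pos.mpr (sq_pos_aux hx)).ne'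

lemma Fz_eq {t : ℝ} (ht : 0 < t) : Fz t = (2 * t)⁻¹ * Pz t := by
  have hu : ∀ x ∈ Set.uIcc (0:ℝ) 1, HasDerivAt (fun u : ℝ => u * √(2 - u^2))
      (2 * (1 - x^2) / √(2 - x^2)) x := by
    intro x hx
    have h0 := sq_pos_aux hx
    have h1 := (hasDerivAt_id x).mul (((hasDerivAt_pow 2 x).const_sub 2).sqrt h0.ne')
    refine h1.congr_deriv ?_
    have h2 := Real.sqrt_pos.mpr h0
    have h3 := Real.sq_sqrt h0.le
    simp only [id]
    field_simp
    have e : x ^ (2 - 1) = x := by norm_num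
    rw [e]
    push_cast
    nlinarith
  have hv : ∀ x ∈ Set.uIcc (0:ℝ) 1, HasDerivAt (fun u : ℝ => -Real.sin (t * (1 - u^2)))
      (2 * t * x * Real.cos (t * (1 - x^2))) x := by
    intro x _
    have := (((hasDerivAt_pow 2 x).const_sub 1).const_mul t).sin.neg
    refine this.congr_deriv ?_
    simp; ring
  have hp := intervalIntegral.integral_mul_deriv_eq_deriv_mul (a := 0) (b := 1) hu
    hv (h_cont.intervalIntegrable)
    (Continuous.intervalIntegrable (by fun_prop) _ _)
  have he : Fz t =
      (2 * t)⁻¹ * ∫ x in (0:ℝ)..1, (x * √(2 - x^2)) * (2 * t * x * Real.cos (t * (1 - x^2))) := by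
    unfold Fz
    rw [← intervalIntegral.integral_const_mul]
    congr 1
    ext x
    field_simp
  rw [he, hp]
  simp [Pz]

def kz (u : ℝ) : ℝ := u * (4 * u^2 - 6) / (√(2 - u^2) * (2 * (1 - u^2) + √(4 - 2 * u^2)))

lemma kz_eq {u : ℝ} (hu : u ∈ Set.uIcc (0:ℝ) 1) :
    2 * (1 - u^2) / √(2 - u^2) = √2 + u * kz u := by
  have h0 := sq_pos_aux hu
  have h1 : √(4 - 2 * u^2) = √2 * √(2 - u^2) := by
    rw [← Real.sqrt_mul (by norm_num)]; congr 1; ring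
  have h2 := Real.sqrt_pos.mpr h0
  have h3 := Real.sq_sqrt h0.le
  have h4 : √2^2 = (2:ℝ) := Real.sq_sqrt (by norm_num)
  have h5 : 0 < √(2:ℝ) := by positivity
  have h6 : 0 ≤ 1 - u^2 := by
    rw [Set.uIcc_of_le (by norm_num)] at hu
    nlinarith [hu.1, hu.2]
  unfold kz
  rw [h1]
  set q := √(2 - u^2)
  have h7 : 0 < 2 * (1 - u^2) + √2 * q := by positivity
  field_simp
  have e : u^2 = 2 - q^2 := by linarith
  rw [e]
  set s := √(2:ℝ)
  linear_combination (-q^2) * h4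

lemma kz_deriv : ∃ k' : ℝ → ℝ, (∀ x ∈ Set.uIcc (0:ℝ) 1, HasDerivAt kz (k' x) x) ∧
    ContinuousOn k' (Set.uIcc 0 1) := by
  have hc : ContDiffOn ℝ 1 kz (Set.Ioo (-1.1) 1.1) := by
    unfold kz
    have hp : ∀ x ∈ Set.Ioo (-1.1:ℝ) 1.1, x^2 < 1.21 := by
      intro x hx
      nlinarith [hx.1, hx.2]
    apply ContDiffOn.div (by fun_prop)
    · apply ContDiffOn.mul
      · apply ContDiffOn.sqrt (by fun_prop)
        intro x hx
        have := hp x hx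
        linarith
      · apply ContDiffOn.add (by fun_prop)
        apply ContDiffOn.sqrt (by fun_prop)
        intro x hx
        have := hp x hx
        linarith
    · intro x hx
      have := hp x hx
      have h1 : 0 < √(2 - x^2) := Real.sqrt_pos.mpr (by linarith)
      have h2 : 1 < √(4 - 2 * x^2) := by
        rw [Real.lt_sqrt (by norm_num)]; linarith
      have : 0 < 2 * (1 - x^2) + √(4 - 2 * x^2) := by linarith
      positivity
  have hsub : Set.uIcc (0:ℝ) 1 ⊆ Set.Ioo (-1.1) 1.1 := by
    rw [Set.uIcc_of_le (by norm_num)]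
    intro x hx
    constructor <;> linarith [hx.1, hx.2]
  refine ⟨deriv kz, ?_, ?_⟩
  · intro x hx
    have := (hc.differentiableOn (by norm_num)).differentiableAt (isOpen_Ioo.mem_nhds (hsub hx))
    exact this.hasDerivAt
  · exact (hc.continuousOn_deriv_of_isOpen isOpen_Ioo le_rfl).mono hsub

lemma Pz_asymp : ∃ K : ℝ, 0 < K ∧ ∀ t : ℝ, 0 < t →
    |√t * Pz t - √2 * (Real.sin t * FrC (√t) - Real.cos t * FrS (√t))| ≤ K / √t := by
  obtain ⟨k', h1, h2⟩ := kz_deriv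
  obtain ⟨K, hK, hb⟩ := osc_bound kz k' h1 h2
  refine ⟨K, hK, ?_⟩
  intro t ht
  have hkc : ContinuousOn kz (Set.uIcc 0 1) := fun x hx => (h1 x hx).continuousAt.continuousWithinAt
  have hst : 0 < √t := Real.sqrt_pos.mpr ht
  have hs : √t^2 = t := Real.sq_sqrt ht.le
  have e1 : Pz t = √2 * (∫ u in (0:ℝ)..1, Real.sin (t * (1 - u^2))) +
      ∫ u in (0:ℝ)..1, u * kz u * Real.sin (t * (1 - u^2)) := by
    unfold Pz
    rw [← intervalIntegral.integral_const_mul, ← intervalIntegral.integral_add]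
    · apply intervalIntegral.integral_congr
      intro x hx
      simp only
      rw [kz_eq hx]
      ring
    · exact Continuous.intervalIntegrable (by fun_prop) _ _
    · apply ContinuousOn.intervalIntegrable
      fun_prop
  have e2 : √t * (∫ u in (0:ℝ)..1, Real.sin (t * (1 - u^2))) =
      Real.sin t * FrC (√t) - Real.cos t * FrS (√t) := by
    have := intervalIntegral.integral_comp_mul_left (a := 0) (b := 1)
      (fun w => Real.sin (t - w^2)) hst.ne'
    have e3 : ∫ u in (0:ℝ)..1, Real.sin (t * (1 - u^2)) =
      ∫ u in (0:ℝ)..1, Real.sin (t - (√t * u)^2) := by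
      congr 1; ext u; congr 1; rw [mul_pow, hs]; ring
    rw [e3, this, smul_eq_mul, ← mul_assoc, mul_inv_cancel₀ hst.ne', one_mul, mul_zero, mul_one]
    unfold FrC FrS
    rw [← intervalIntegral.integral_const_mul, ← intervalIntegral.integral_const_mul,
      ← intervalIntegral.integral_sub]
    · congr 1; ext w; rw [Real.sin_sub]
    · exact Continuous.intervalIntegrable (by fun_prop) _ _
    · exact Continuous.intervalIntegrable (by fun_prop) _ _
  have e4 : √t * Pz t - √2 * (Real.sin t * FrC (√t) - Real.cos t * FrS (√t)) =
      √t * ∫ u in (0:ℝ)..1, u * kz u * Real.sin (t * (1 - u^2)) := by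
    rw [e1, ← e2]; ring
  rw [e4, abs_mul, abs_of_pos hst]
  calc _ ≤ √t * (K / t) := by
        apply mul_le_mul_of_nonneg_left (hb t ht) hst.le
    _ = K / √t := by
        nth_rewrite 2 [← hs]
        field_simp

set_option maxHeartbeats 1000000 in
lemma Fz_lower : ∃ c T : ℝ, 0 < c ∧ 1 ≤ T ∧ ∀ t : ℝ, T ≤ t →
    c ≤ t^3 * (Fz t ^ 2 + Fz (2 * t) ^ 2) := by
  obtain ⟨K, hK, hP⟩ := Pz_asymp
  refine ⟨1/100000000, (1000 * (K + 3)) ^ 2, by norm_num, by nlinarith, ?_⟩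
  intro t hT
  have ht : 1 ≤ t := by nlinarith
  have ht0 : 0 < t := by linarith
  set s := √t with hs
  have hs1 : 1000 * (K + 3) ≤ s := by
    rw [hs]; exact Real.le_sqrt_of_sq_le hT
  have hs0 : 0 < s := by nlinarith
  have hss : s^2 = t := Real.sq_sqrt ht0.le
  set s2 := √(2 * t) with hs2
  have hss2 : s2^2 = 2 * t := Real.sq_sqrt (by linarith)
  have hle : s ≤ s2 := Real.sqrt_le_sqrt (by linarith)
  have a1 := hP t ht0
  have a2 := hP (2 * t) (by linarith)
  rw [← hs] at a1
  rw [← hs2] at a2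
  have b1 := FrC_diff hs0 hle
  have b2 := FrS_diff hs0 hle
  have b3 := FrS_lower (X := s) (by nlinarith)
  have k1 : K / s ≤ 1/1000 := by
    rw [div_le_iff₀ hs0]; linarith
  have k2 : K / s2 ≤ 1/1000 := by
    rw [div_le_iff₀ (by linarith)]; linarith
  have k3 : 2 / s ≤ 1/1000 := by
    rw [div_le_iff₀ hs0]; linarith
  have r1 : 1 ≤ √(2:ℝ) := Real.one_le_sqrt.mpr (by norm_num)
  have r2 : √(2:ℝ) ≤ 3/2 := by
    rw [Real.sqrt_le_left (by norm_num)]; norm_num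
  -- combine
  have id1 : (s2 * Pz (2 * t)) - 2 * Real.cos t * (s * Pz t) =
      √2 * FrS s
      + (s2 * Pz (2 * t) - √2 * (Real.sin (2 * t) * FrC s2 - Real.cos (2 * t) * FrS s2))
      - 2 * Real.cos t * (s * Pz t - √2 * (Real.sin t * FrC s - Real.cos t * FrS s))
      + √2 * (Real.sin (2 * t) * (FrC s2 - FrC s) - Real.cos (2 * t) * (FrS s2 - FrS s)) := by
    rw [Real.sin_two_mul, Real.cos_two_mul]
    ring
  set E2 := s2 * Pz (2 * t) - √2 * (Real.sin (2 * t) * FrC s2 - Real.cos (2 * t) * FrS s2)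
  set E1 := s * Pz t - √2 * (Real.sin t * FrC s - Real.cos t * FrS s)
  have c1 : |2 * Real.cos t * E1| ≤ 2/1000 := by
    rw [abs_mul, abs_mul, abs_two]
    have := Real.abs_cos_le_one t
    nlinarith [abs_nonneg E1, abs_nonneg (Real.cos t)]
  have c2 : |Real.sin (2 * t) * (FrC s2 - FrC s)| ≤ 1/1000 := by
    rw [abs_mul]
    have := Real.abs_sin_le_one (2 * t)
    nlinarith [abs_nonneg (FrC s2 - FrC s), abs_nonneg (Real.sin (2 * t))]
  have c3 : |Real.cos (2 * t) * (FrS s2 - FrS s)| ≤ 1/1000 := by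
    rw [abs_mul]
    have := Real.abs_cos_le_one (2 * t)
    nlinarith [abs_nonneg (FrS s2 - FrS s), abs_nonneg (Real.cos (2 * t))]
  have c4 : |√2 * (Real.sin (2 * t) * (FrC s2 - FrC s) - Real.cos (2 * t) * (FrS s2 - FrS s))|
      ≤ 3/1000 := by
    rw [abs_mul, abs_of_nonneg (by positivity)]
    have : |Real.sin (2 * t) * (FrC s2 - FrC s) - Real.cos (2 * t) * (FrS s2 - FrS s)| ≤ 2/1000 := by
      rw [abs_le] at *
      constructor <;> linarith [c2.1, c2.2, c3.1, c3.2]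
    nlinarith [abs_nonneg (Real.sin (2 * t) * (FrC s2 - FrC s) - Real.cos (2 * t) * (FrS s2 - FrS s))]
  have c5 : (4:ℝ)/100 ≤ √2 * FrS s := by nlinarith
  have main : 3/100 ≤ |s2 * Pz (2 * t)| + 2 * |s * Pz t| := by
    have d1 : 3/100 ≤ (s2 * Pz (2 * t)) - 2 * Real.cos t * (s * Pz t) := by
      rw [id1]
      have := (abs_le.mp (a2.trans k2)).1
      have := (abs_le.mp c1).2
      have := (abs_le.mp c4).1
      linarith
    have d2 : |2 * Real.cos t * (s * Pz t)| ≤ 2 * |s * Pz t| := by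
      rw [abs_mul, abs_mul, abs_two]
      apply mul_le_mul_of_nonneg_right _ (abs_nonneg _)
      linarith [Real.abs_cos_le_one t]
    have d3 := (abs_le.mp d2).1
    have d4 := le_abs_self (s2 * Pz (2 * t))
    linarith
  have main2 : (3/100)^2 ≤ 5 * ((s2 * Pz (2 * t))^2 + (s * Pz t)^2) := by
    rw [← sq_abs (s2 * Pz (2 * t)), ← sq_abs (s * Pz t)]
    set A := |s2 * Pz (2 * t)|
    set B := |s * Pz t|
    have : (3/100)^2 ≤ (A + 2 * B)^2 := by
      apply pow_le_pow_left₀ (by norm_num) main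
    nlinarith [sq_nonneg (2 * A - B)]
  rw [mul_pow, mul_pow, hss, hss2] at main2
  rw [Fz_eq ht0, Fz_eq (by linarith : 0 < 2 * t)]
  have fin : t^3 * (((2 * t)⁻¹ * Pz t)^2 + ((2 * (2 * t))⁻¹ * Pz (2 * t))^2) =
      t * Pz t^2 / 4 + t * Pz (2 * t)^2 / 16 := by
    field_simp
    ring
  rw [fin]
  nlinarith [mul_nonneg ht0.le (sq_nonneg (Pz t)), mul_nonneg ht0.le (sq_nonneg (Pz (2 * t)))]

abbrev muT : Measure (Torus 2) :=
  Measure.pi (fun _ : Fin 2 => (AddCircle.haarAddCircle : Measure (AddCircle (1:ℝ))))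

def tball (r : ℝ) : Set (Torus 2) := {y | torusDist y 0 ≤ r}

lemma tball_meas (r : ℝ) : MeasurableSet (tball r) := by
  apply IsClosed.measurableSet
  unfold tball torusDist
  apply isClosed_le _ continuous_const
  fun_prop

def indC (r : ℝ) : Torus 2 → ℂ := (tball r).indicator (fun _ => 1)

lemma indC_norm (r : ℝ) (y : Torus 2) : ‖indC r y‖ ≤ 1 := by
  unfold indC
  by_cases h : y ∈ tball r <;> simp [h]

lemma indC_meas (r : ℝ) : Measurable (indC r) :=
  measurable_const.indicator (tball_meas r)

lemma mF_norm (k : Fin 2 → ℤ) (y : Torus 2) : ‖UnitAddTorus.mFourier k y‖ = 1 := by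
  simp only [UnitAddTorus.mFourier, ContinuousMap.coe_mk, norm_prod, fourier_apply,
    Circle.norm_coe, Finset.prod_const_one]

lemma coeff_integrable (k : Fin 2 → ℤ) (r : ℝ) :
    Integrable (fun y : Torus 2 => UnitAddTorus.mFourier k y * indC r y) muT := by
  apply Integrable.of_bound (C := 1)
  · apply AEStronglyMeasurable.mul
    · exact (UnitAddTorus.mFourier k).continuous.aestronglyMeasurable
    · exact (indC_meas r).aestronglyMeasurable
  · filter_upwards with y
    rw [norm_mul, mF_norm, one_mul]
    exact indC_norm r y

/-- The real disk integral over the line. -/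
lemma line_integral {r : ℝ} (hr : 0 < r) (l : ℝ) :
    ∫ a : ℝ, 2 * √(r^2 - a^2) * Real.cos (l * a) = 8 * r^2 * Fz (l * r) := by
  have hsupp : ∀ a ∉ Set.Ioc (-r) r, 2 * √(r^2 - a^2) * Real.cos (l * a) = 0 := by
    intro a ha
    have : √(r^2 - a^2) = 0 := by
      apply Real.sqrt_eq_zero_of_nonpos
      rw [Set.mem_Ioc, not_and_or] at ha
      rcases ha with h | h
      · nlinarith
      · nlinarith
    rw [this]; ring
  rw [← setIntegral_eq_integral_of_forall_compl_eq_zero hsupp,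
    ← intervalIntegral.integral_of_le (by linarith)]
  have hc : Continuous (fun a : ℝ => 2 * √(r^2 - a^2) * Real.cos (l * a)) := by fun_prop
  rw [← intervalIntegral.integral_add_adjacent_intervals (b := 0)
    (hc.intervalIntegrable _ _) (hc.intervalIntegrable _ _)]
  have hneg : ∫ a in (-r)..0, 2 * √(r^2 - a^2) * Real.cos (l * a) =
      ∫ a in (0:ℝ)..r, 2 * √(r^2 - a^2) * Real.cos (l * a) := by
    have := intervalIntegral.integral_comp_neg (a := 0) (b := r)
      (fun a : ℝ => 2 * √(r^2 - a^2) * Real.cos (l * a))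
    simp only [neg_zero] at this
    rw [← this]
    congr 1; ext x; simp
  rw [hneg]
  have hsub := intervalIntegral.integral_comp_mul_deriv (a := 1) (b := 0)
    (f := fun u => r * (1 - u^2)) (f' := fun u => - (2 * r * u))
    (g := fun a : ℝ => 2 * √(r^2 - a^2) * Real.cos (l * a)) (by
      intro x _
      have := (((hasDerivAt_pow 2 x).const_sub 1).const_mul r)
      refine this.congr_deriv ?_
      simp; ring) (by fun_prop) hc
  simp only [Function.comp] at hsub
  have e1 : r * (1 - 1^2) = 0 := by ring
  have e2 : r * (1 - 0^2) = r := by ring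
  rw [e1, e2] at hsub
  rw [← hsub, intervalIntegral.integral_symm, ← intervalIntegral.integral_neg]
  unfold Fz
  rw [← two_mul, ← intervalIntegral.integral_const_mul, ← intervalIntegral.integral_const_mul]
  apply intervalIntegral.integral_congr
  intro u hu
  rw [Set.uIcc_of_le (by norm_num)] at hu
  simp only
  have e3 : r^2 - (r * (1 - u^2))^2 = (r * u)^2 * (2 - u^2) := by ring
  have hru : 0 ≤ r * u := mul_nonneg hr.le hu.1
  rw [e3, Real.sqrt_mul (by positivity), Real.sqrt_sq hru]
  have e4 : l * (r * (1 - u^2)) = l * r * (1 - u^2) := by ring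
  rw [e4]
  ring

lemma slice_integral (r a : ℝ) :
    ∫ b : ℝ, (if a^2 + b^2 ≤ r^2 then (1:ℝ) else 0) = 2 * √(r^2 - a^2) := by
  by_cases h : 0 ≤ r^2 - a^2
  · have : (fun b : ℝ => if a^2 + b^2 ≤ r^2 then (1:ℝ) else 0) =
        (Set.Icc (-√(r^2 - a^2)) (√(r^2 - a^2))).indicator (fun _ => 1) := by
      ext b
      rw [Set.indicator_apply]
      congr 1
      rw [Set.mem_Icc, ← abs_le, eq_iff_iff]
      constructor
      · intro h1
        apply Real.abs_le_sqrt; linarith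
      · intro h1
        have := (Real.le_sqrt (abs_nonneg b) h).mp h1
        rw [sq_abs] at this; linarith
    rw [this, integral_indicator measurableSet_Icc]
    have := Real.sqrt_nonneg (r^2 - a^2)
    simp
    ring
  · have h0 : √(r^2 - a^2) = 0 := Real.sqrt_eq_zero_of_nonpos (by linarith)
    have : (fun b : ℝ => if a^2 + b^2 ≤ r^2 then (1:ℝ) else 0) = fun _ => 0 := by
      ext b
      rw [if_neg]
      nlinarith [sq_nonneg b]
    rw [this, h0]; simp

lemma plane_integral {r : ℝ} (hr : 0 < r) (l : ℝ) :
    ∫ p : ℝ × ℝ, (if p.1^2 + p.2^2 ≤ r^2 then (1:ℝ) else 0) * Real.cos (l * p.1)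
      = 8 * r^2 * Fz (l * r) := by
  rw [← line_integral hr l]
  have hIntg : Integrable (fun p : ℝ × ℝ =>
      (if p.1^2 + p.2^2 ≤ r^2 then (1:ℝ) else 0) * Real.cos (l * p.1)) (volume.prod volume) := by
    have hm : MeasurableSet {p : ℝ × ℝ | p.1^2 + p.2^2 ≤ r^2} := by
      apply IsClosed.measurableSet
      apply isClosed_le <;> fun_prop
    have hsub : {p : ℝ × ℝ | p.1^2 + p.2^2 ≤ r^2} ⊆ Set.Icc (-r, -r) (r, r) := by
      intro p hp
      simp only [Set.mem_ofPred_eq] at hp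
      have h1 := abs_le_of_sq_le_sq' (by nlinarith [sq_nonneg p.2] : p.1^2 ≤ r^2) hr.le
      have h2 := abs_le_of_sq_le_sq' (by nlinarith [sq_nonneg p.1] : p.2^2 ≤ r^2) hr.le
      exact ⟨⟨h1.1, h2.1⟩, ⟨h1.2, h2.2⟩⟩
    have hfin : (volume : Measure (ℝ × ℝ)) {p : ℝ × ℝ | p.1^2 + p.2^2 ≤ r^2} < ⊤ :=
      lt_of_le_of_lt (measure_mono hsub) isCompact_Icc.measure_lt_top
    have h1 : Integrable (({p : ℝ × ℝ | p.1^2 + p.2^2 ≤ r^2}).indicator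
        (fun p : ℝ × ℝ => Real.cos (l * p.1))) (volume : Measure (ℝ × ℝ)) := by
      rw [integrable_indicator_iff hm]
      apply Measure.integrableOn_of_bounded (M := 1) hfin.ne
      · exact Continuous.aestronglyMeasurable (by fun_prop)
      · filter_upwards with p
        exact Real.abs_cos_le_one _
    refine h1.congr ?_
    filter_upwards with p
    by_cases h : p.1^2 + p.2^2 ≤ r^2 <;> simp [Set.indicator, h]
  rw [Measure.volume_eq_prod, integral_prod _ hIntg]
  congr 1
  ext a
  simp only
  rw [integral_mul_const, slice_integral]

lemma rot_integral {r : ℝ} (hr : 0 < r) (k : Fin 2 → ℤ) (hk : k ≠ 0) :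
    ∫ x : Fin 2 → ℝ, (if x 0^2 + x 1^2 ≤ r^2 then (1:ℝ) else 0) *
        Real.cos (2 * π * (k 0 * x 0 + k 1 * x 1))
      = 8 * r^2 * Fz (2 * π * √((k 0:ℝ)^2 + (k 1:ℝ)^2) * r) := by
  rw [← Complex.volume_preserving_equiv_pi.integral_comp']
  have hkp : 0 < (k 0:ℝ)^2 + (k 1:ℝ)^2 := by
    by_contra hcon
    apply hk
    have h0 : (k 0:ℝ)^2 = 0 := by nlinarith [sq_nonneg (k 0:ℝ), sq_nonneg (k 1:ℝ)]
    have h1 : (k 1:ℝ)^2 = 0 := by nlinarith [sq_nonneg (k 0:ℝ), sq_nonneg (k 1:ℝ)]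
    ext i
    fin_cases i
    · simpa using h0
    · simpa using h1
  set K := √((k 0:ℝ)^2 + (k 1:ℝ)^2) with hK
  have hK0 : 0 < K := Real.sqrt_pos.mpr hkp
  have hKK : K^2 = (k 0:ℝ)^2 + (k 1:ℝ)^2 := Real.sq_sqrt hkp.le
  set w : ℂ := ⟨k 0 / K, k 1 / K⟩ with hw
  have hwn : Complex.normSq w = 1 := by
    rw [Complex.normSq_apply]
    simp only [hw]
    field_simp
    linarith
  have hwm : w ∈ Submonoid.unitSphere ℂ := by
    have : ‖w‖^2 = 1 := by rw [← Complex.normSq_eq_norm_sq, hwn]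
    have h0 := norm_nonneg w
    have h1 : ‖w‖ = 1 := by nlinarith
    simpa [Submonoid.unitSphere] using h1
  let ω : Circle := ⟨w, hwm⟩
  have hmp := (rotation ω).measurePreserving
  have hme : MeasurableEmbedding (rotation ω) := (rotation ω).toHomeomorph.measurableEmbedding
  rw [← hmp.integral_comp hme]
  rw [← plane_integral hr, ← Complex.volume_preserving_equiv_real_prod.integral_comp']
  congr 1
  ext z
  have hre : (w * z).re = (k 0 / K) * z.re - (k 1 / K) * z.im := by simp [hw]
  have him : (w * z).im = (k 0 / K) * z.im + (k 1 / K) * z.re := by simp [hw]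
  have hωw : (rotation ω) z = w * z := by rw [rotation_apply]
  have hP0 : Complex.measurableEquivPi ((rotation ω) z) 0 = (w * z).re := by
    rw [hωw]; simp
  have hP1 : Complex.measurableEquivPi ((rotation ω) z) 1 = (w * z).im := by
    rw [hωw]; simp
  simp only [hP0, hP1, Complex.measurableEquivRealProd_apply]
  have e1 : (w * z).re^2 + (w * z).im^2 = z.re^2 + z.im^2 := by
    rw [hre, him]
    field_simp
    rw [hKK]; ring
  have e2 : (k 0:ℝ) * (w * z).re + k 1 * (w * z).im = K * z.re := by
    rw [hre, him]
    field_simp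
    rw [hKK]; ring
  simp only [e1, e2, mul_assoc]
  by_cases h : z.re ^ 2 + z.im ^ 2 ≤ r ^ 2
  · simp [h]
  · simp [h]

lemma coeff_re {r : ℝ} (hr : 0 < r) (hr2 : r ≤ 1/2) (k : Fin 2 → ℤ) (hk : k ≠ 0) :
    (∫ y, UnitAddTorus.mFourier (-k) y * indC r y ∂muT).re
      = 8 * r^2 * Fz (2 * π * √((k 0:ℝ)^2 + (k 1:ℝ)^2) * r) := by
  rw [← rot_integral hr k hk]
  have h1 := integral_re (coeff_integrable (-k) r)
  simp only [RCLike.re_to_complex] at h1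
  rw [← h1]
  have h2 := UnitAddTorus.integral_preimage (d := Fin 2)
    (fun y => (UnitAddTorus.mFourier (-k) y * indC r y).re) (fun _ => -(1/2))
  refine Eq.trans h2 ?_
  have hset : ({x : Fin 2 → ℝ | ∀ i, x i ∈ Set.Ioc (-(1/2):ℝ) (-(1/2) + 1)} : Set (Fin 2 → ℝ))
      =ᵐ[volume] Set.Icc (fun _ => -(1/2):Fin 2 → ℝ) (fun _ => (1/2)) := by
    have := Measure.univ_pi_Ioc_ae_eq_Icc (μ := fun _ : Fin 2 => (volume : Measure ℝ))
      (f := fun _ => (-(1/2):ℝ)) (g := fun _ => (1/2:ℝ))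
    have e : ({x : Fin 2 → ℝ | ∀ i, x i ∈ Set.Ioc (-(1/2):ℝ) (-(1/2) + 1)} : Set (Fin 2 → ℝ)) =
      Set.univ.pi fun _ => Set.Ioc (-(1/2):ℝ) (1/2) := by
      ext x
      simp only [Set.mem_ofPred_eq, Set.mem_univ_pi]
      norm_num
    rw [e]
    exact this
  rw [setIntegral_congr_set hset]
  rw [← setIntegral_eq_integral_of_forall_compl_eq_zero
    (s := Set.Icc (fun _ => -(1/2):Fin 2 → ℝ) (fun _ => (1/2)))
    (f := fun x : Fin 2 → ℝ => (if x 0^2 + x 1^2 ≤ r^2 then (1:ℝ) else 0) *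
        Real.cos (2 * π * (k 0 * x 0 + k 1 * x 1)))]
  · apply setIntegral_congr_fun measurableSet_Icc
    intro x hx
    simp only
    have hn : ∀ i, ‖(x i : AddCircle (1:ℝ))‖ = |x i| := by
      intro i
      rw [AddCircle.norm_coe_eq_abs_iff _ (by norm_num), abs_one, abs_le]
      exact ⟨hx.1 i, hx.2 i⟩
    have hmem : ((fun i => (x i : AddCircle (1:ℝ))) : Torus 2) ∈ tball r ↔ x 0^2 + x 1^2 ≤ r^2 := by
      unfold tball torusDist
      simp only [Set.mem_ofPred_eq, Pi.zero_apply, sub_zero, hn, sq_abs, Fin.sum_univ_two]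
      rw [Real.sqrt_le_left hr.le]
    have hF : UnitAddTorus.mFourier (-k) (fun i => (x i : AddCircle (1:ℝ))) =
        Complex.exp (((-(2 * π * (k 0 * x 0 + k 1 * x 1)) : ℝ) : ℂ) * Complex.I) := by
      simp only [UnitAddTorus.mFourier, ContinuousMap.coe_mk, Fin.prod_univ_two, Pi.neg_apply]
      rw [fourier_coe_apply, fourier_coe_apply, ← Complex.exp_add]
      congr 1
      push_cast
      ring
    rw [hF]
    unfold indC
    by_cases h : x 0^2 + x 1^2 ≤ r^2
    · rw [Set.indicator_of_mem (hmem.mpr h), if_pos h, mul_one, one_mul,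
        Complex.exp_ofReal_mul_I_re, Real.cos_neg]
    · rw [Set.indicator_of_notMem (fun h' => h (hmem.mp h')), if_neg h]
      simp
  · intro x hx
    rw [if_neg, zero_mul]
    intro hcon
    apply hx
    have h1 := abs_le_of_sq_le_sq' (by nlinarith [sq_nonneg (x 1)] : x 0^2 ≤ r^2) hr.le
    have h2 := abs_le_of_sq_le_sq' (by nlinarith [sq_nonneg (x 0)] : x 1^2 ≤ r^2) hr.le
    constructor
    · intro i; fin_cases i
      · simp; linarith [h1.1]
      · simp; linarith [h2.1]
    · intro i; fin_cases i
      · simp; linarith [h1.2]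
      · simp; linarith [h2.2]

lemma int_mF_zero (k : Fin 2 → ℤ) (hk : k ≠ 0) :
    ∫ y, UnitAddTorus.mFourier (-k) y ∂muT = 0 := by
  have h := (UnitAddTorus.orthonormal_mFourier (d := Fin 2)).2 hk
  simp only [ContinuousMap.inner_toLp] at h
  simp only [UnitAddTorus.mFourier_zero, ContinuousMap.one_apply, one_mul] at h
  rw [← h]
  apply integral_congr_ae
  filter_upwards with y
  rw [UnitAddTorus.mFourier_neg]

lemma mF_add (k : Fin 2 → ℤ) (y z : Torus 2) :
    UnitAddTorus.mFourier k (y + z) = UnitAddTorus.mFourier k y * UnitAddTorus.mFourier k z := by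
  simp only [UnitAddTorus.mFourier, ContinuousMap.coe_mk, Fin.prod_univ_two, Pi.add_apply,
    fourier_apply, smul_add, AddCircle.toCircle_add, Circle.coe_mul]
  ring

lemma coeff_shift (k : Fin 2 → ℤ) (r : ℝ) (x : Torus 2) :
    ∫ y, UnitAddTorus.mFourier (-k) y * indC r (y - x) ∂muT =
      UnitAddTorus.mFourier (-k) x * ∫ y, UnitAddTorus.mFourier (-k) y * indC r y ∂muT := by
  rw [← integral_const_mul]
  rw [← integral_add_right_eq_self _ x]
  congr 1
  ext y
  rw [mF_add, add_sub_cancel_right]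
  ring

def SS {N : ℕ} (x : Fin N → Torus 2) (k : Fin 2 → ℤ) : ℂ :=
  ∑ i, UnitAddTorus.mFourier (-k) (x i)

lemma torusDist_indC (r : ℝ) (x y : Torus 2) :
    indC r (y - x) = if torusDist x y ≤ r then 1 else 0 := by
  unfold indC
  have : y - x ∈ tball r ↔ torusDist x y ≤ r := by
    unfold tball torusDist
    simp only [Set.mem_ofPred_eq, Pi.zero_apply, sub_zero, Pi.sub_apply, norm_sub_rev]
  by_cases h : torusDist x y ≤ r
  · rw [Set.indicator_of_mem (this.mpr h), if_pos h]
  · rw [Set.indicator_of_notMem (fun h' => h (this.mp h')), if_neg h]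

lemma bessel_ineq {N : ℕ} (x : Fin N → Torus 2) (r C0 B : ℝ)
    (hB : ∀ y : Torus 2, |(Nat.card {i : Fin N // torusDist (x i) y ≤ r} : ℝ) - C0| ≤ B)
    (s : Finset (Fin 2 → ℤ)) (hs : ∀ k ∈ s, k ≠ 0) :
    ∑ k ∈ s, ‖SS x k‖^2 * ‖∫ y, UnitAddTorus.mFourier (-k) y * indC r y ∂muT‖^2 ≤ B^2 := by
  set D : Torus 2 → ℂ := fun y => (∑ i, indC r (y - x i)) - (C0 : ℂ) with hD
  have hDm : Measurable D := by
    apply Measurable.sub _ measurable_const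
    apply Finset.measurable_sum
    intro i _
    exact (indC_meas r).comp (measurable_id.sub_const _)
  have hDn : ∀ y, ‖D y‖ ≤ B := by
    intro y
    have e : D y = (((Nat.card {i : Fin N // torusDist (x i) y ≤ r} : ℝ) - C0 : ℝ) : ℂ) := by
      simp only [hD, torusDist_indC]
      push_cast
      congr 1
      rw [Finset.sum_boole, Nat.card_eq_fintype_card, Fintype.card_subtype]
    rw [e, Complex.norm_real]
    exact hB y
  have hmem : MemLp D 2 muT := MemLp.of_bound hDm.aestronglyMeasurable B (by
    filter_upwards with y using hDn y)
  have hsum := UnitAddTorus.hasSum_sq_mFourierCoeff (d := Fin 2) (hmem.toLp D)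
  have hle := sum_le_hasSum s (fun k _ => by positivity) hsum
  have hIntg : ∫ t, ‖hmem.toLp D t‖^2 ∂muT ≤ B^2 := by
    have e : ∫ t, ‖hmem.toLp D t‖^2 ∂muT = ∫ t, ‖D t‖^2 ∂muT := by
      apply integral_congr_ae
      filter_upwards [hmem.coeFn_toLp] with t ht
      rw [ht]
    rw [e]
    have h1 : ∫ t, ‖D t‖^2 ∂muT ≤ ∫ t, B^2 ∂muT := by
      apply integral_mono_of_nonneg
      · filter_upwards with t; positivity
      · exact integrable_const _
      · filter_upwards with t
        exact pow_le_pow_left₀ (norm_nonneg _) (hDn t) 2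
    simpa using h1
  have hco : ∀ k ∈ s, UnitAddTorus.mFourierCoeff (hmem.toLp D) k =
      SS x k * ∫ y, UnitAddTorus.mFourier (-k) y * indC r y ∂muT := by
    intro k hk
    have e1 : UnitAddTorus.mFourierCoeff (hmem.toLp D) k =
        ∫ y, UnitAddTorus.mFourier (-k) y * D y ∂muT := by
      unfold UnitAddTorus.mFourierCoeff
      apply integral_congr_ae
      filter_upwards [hmem.coeFn_toLp] with t ht
      rw [ht, smul_eq_mul]
    rw [e1]
    have hi : ∀ i, Integrable (fun y => UnitAddTorus.mFourier (-k) y * indC r (y - x i)) muT := by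
      intro i
      apply Integrable.of_bound (C := 1)
      · apply AEStronglyMeasurable.mul
        · exact (UnitAddTorus.mFourier (-k)).continuous.aestronglyMeasurable
        · exact ((indC_meas r).comp (measurable_id.sub_const _)).aestronglyMeasurable
      · filter_upwards with y
        rw [norm_mul, mF_norm, one_mul]
        exact indC_norm r _
    have hi2 : Integrable (fun y => UnitAddTorus.mFourier (-k) y * (C0 : ℂ)) muT := by
      apply Integrable.mul_const
      apply Integrable.of_bound (C := 1)
      · exact (UnitAddTorus.mFourier (-k)).continuous.aestronglyMeasurable
      · filter_upwards with y
        rw [mF_norm]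
    have e2 : ∀ y, UnitAddTorus.mFourier (-k) y * D y =
        (∑ i, UnitAddTorus.mFourier (-k) y * indC r (y - x i))
          - UnitAddTorus.mFourier (-k) y * (C0 : ℂ) := by
      intro y
      simp only [hD, mul_sub, Finset.mul_sum]
    simp only [e2]
    rw [integral_sub (integrable_finsetSum _ (fun i _ => hi i)) hi2,
      integral_finsetSum _ (fun i _ => hi i), integral_mul_const, int_mF_zero k (hs k hk),
      zero_mul, sub_zero]
    simp only [coeff_shift]
    rw [← Finset.sum_mul]
    rfl
  calc _ = ∑ k ∈ s, ‖UnitAddTorus.mFourierCoeff (hmem.toLp D) k‖^2 := by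
        apply Finset.sum_congr rfl
        intro k hk
        rw [hco k hk, norm_mul, mul_pow]
    _ ≤ _ := hle
    _ ≤ B^2 := hIntg

def rho (n : ℕ) : ℝ := 1 - 1 / n

lemma rho_nonneg {n : ℕ} (hn : 1 ≤ n) : 0 ≤ rho n := by
  unfold rho
  have : (1:ℝ) ≤ n := by exact_mod_cast hn
  have : (1:ℝ) / n ≤ 1 := by rw [div_le_one (by linarith)]; exact this
  linarith

lemma rho_le_one (n : ℕ) : rho n ≤ 1 := by
  unfold rho
  have : (0:ℝ) ≤ 1 / n := by positivity
  linarith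

lemma rho_pow {n : ℕ} (hn : 1 ≤ n) : rho n ^ n ≤ 1/2 := by
  have h1 := Real.one_sub_div_pow_le_exp_neg (n := n) (t := 1) (by exact_mod_cast hn)
  refine h1.trans ?_
  rw [Real.exp_neg, ← one_div]
  apply one_div_le_one_div_of_le (by norm_num)
  have := Real.add_one_le_exp (1:ℝ)
  linarith

def gk (n : ℕ) (a : AddCircle (1:ℝ)) : ℂ :=
  ∑ p ∈ Finset.range n, ((rho n : ℂ) * fourier 1 a) ^ p

lemma fourier_one_sub (a : AddCircle (1:ℝ)) : ‖(fourier 1 a : ℂ) - 1‖ ≤ 2 * π * ‖a‖ := by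
  induction a using QuotientAddGroup.induction_on with
  | H t =>
    have h1 : ((t : ℝ) : AddCircle (1:ℝ)) = ((t - round t : ℝ) : AddCircle (1:ℝ)) := by
      rw [AddCircle.coe_sub]
      have : ((round t : ℝ) : AddCircle (1:ℝ)) = 0 := by
        rw [AddCircle.coe_eq_zero_iff]
        exact ⟨round t, by simp⟩
      rw [this, sub_zero]
    have h2 : ‖((t : ℝ) : AddCircle (1:ℝ))‖ = |t - round t| := UnitAddCircle.norm_eq
    change ‖(fourier 1 ((t : ℝ) : AddCircle (1:ℝ)) : ℂ) - 1‖ ≤ 2 * π * ‖((t : ℝ) : AddCircle (1:ℝ))‖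
    rw [h2, h1, fourier_coe_apply]
    have h3 := Real.norm_exp_I_mul_ofReal_sub_one_le (x := 2 * π * (t - round t))
    have e : (2 * (π:ℂ) * Complex.I * ((1:ℤ):ℂ) * ((t - round t : ℝ) : ℂ) / ((1:ℝ):ℂ)) =
        Complex.I * ((2 * π * (t - round t) : ℝ) : ℂ) := by
      push_cast; ring
    rw [e]
    refine h3.trans ?_
    rw [Real.norm_eq_abs, abs_mul, abs_of_pos (by positivity)]

lemma gk_lower {n : ℕ} (hn : 1 ≤ n) (a : AddCircle (1:ℝ)) :
    (n:ℝ)^2 ≤ 200 * (1 + (n:ℝ)^2 * ‖a‖^2) * ‖gk n a‖^2 := by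
  have hn' : (1:ℝ) ≤ n := by exact_mod_cast hn
  have h0 := rho_nonneg hn
  have h1 := rho_le_one n
  set z : ℂ := fourier 1 a with hz
  have hzn : ‖z‖ = 1 := by rw [hz, fourier_apply]; exact Circle.norm_coe _
  have hg : (1 - (rho n : ℂ) * z) * gk n a = 1 - ((rho n : ℂ) * z)^n := mul_neg_geom_sum _ _
  have hl : 1/2 ≤ ‖1 - ((rho n : ℂ) * z)^n‖ := by
    have : ‖((rho n : ℂ) * z)^n‖ ≤ 1/2 := by
      rw [norm_pow, norm_mul, hzn, mul_one, Complex.norm_real, Real.norm_eq_abs, abs_of_nonneg h0]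
      exact rho_pow hn
    have h2 := norm_sub_norm_le (1:ℂ) (((rho n : ℂ) * z)^n)
    rw [norm_one] at h2
    linarith
  have hu : ‖1 - (rho n : ℂ) * z‖ ≤ 1 / n + 7 * ‖a‖ := by
    have e : 1 - (rho n : ℂ) * z = ((1 / n : ℝ) : ℂ) - (rho n : ℂ) * (z - 1) := by
      unfold rho; push_cast; ring
    rw [e]
    refine (norm_sub_le _ _).trans ?_
    rw [norm_mul, Complex.norm_real, Complex.norm_real, Real.norm_eq_abs, Real.norm_eq_abs,
      abs_of_nonneg h0, abs_of_nonneg (by positivity)]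
    have h3 := fourier_one_sub a
    rw [← hz] at h3
    have h4 := Real.pi_lt_d2
    have h5 := norm_nonneg a
    have h6 := norm_nonneg (z - 1)
    have : rho n * ‖z - 1‖ ≤ 1 * ‖z - 1‖ := mul_le_mul_of_nonneg_right h1 h6
    nlinarith
  have hm : 1/2 ≤ (1 / n + 7 * ‖a‖) * ‖gk n a‖ := by
    rw [← hg, norm_mul] at hl
    exact hl.trans (mul_le_mul_of_nonneg_right hu (norm_nonneg _))
  have hm2 : (n:ℝ)/2 ≤ (1 + 7 * (n * ‖a‖)) * ‖gk n a‖ := by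
    have h3 := mul_le_mul_of_nonneg_left hm (by linarith : (0:ℝ) ≤ n)
    have e : (n:ℝ) * ((1 / n + 7 * ‖a‖) * ‖gk n a‖) = (1 + 7 * (n * ‖a‖)) * ‖gk n a‖ := by
      field_simp
    rw [e] at h3
    linarith
  have hm3 := pow_le_pow_left₀ (by positivity) hm2 2
  rw [mul_pow] at hm3
  have h7 : (1 + 7 * (n * ‖a‖))^2 ≤ 50 * (1 + (n:ℝ)^2 * ‖a‖^2) := by
    nlinarith [sq_nonneg (7 - n * ‖a‖)]
  have h8 := mul_le_mul_of_nonneg_right h7 (sq_nonneg ‖gk n a‖)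
  nlinarith

def vk (P : ℕ × ℕ) : Fin 2 → ℤ := ![(P.1 : ℤ), (P.2 : ℤ)]

lemma fourier_pow_aux (a : AddCircle (1:ℝ)) (p : ℕ) : (fourier 1 a : ℂ)^p = fourier (p:ℤ) a := by
  simp [fourier_apply, AddCircle.toCircle_nsmul]

lemma gk_prod (n : ℕ) (y : Torus 2) :
    gk n (y 0) * gk n (y 1) = ∑ P ∈ Finset.range n ×ˢ Finset.range n,
      ((rho n ^ (P.1 + P.2) : ℝ) : ℂ) * UnitAddTorus.mFourier (vk P) y := by
  unfold gk
  rw [Finset.sum_mul_sum, Finset.sum_product]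
  apply Finset.sum_congr rfl
  intro p _
  apply Finset.sum_congr rfl
  intro q _
  simp only [UnitAddTorus.mFourier, ContinuousMap.coe_mk, Fin.prod_univ_two, vk,
    Matrix.cons_val_zero, Matrix.cons_val_one, mul_pow, fourier_pow_aux]
  push_cast
  ring

lemma SS_sq {N : ℕ} (x : Fin N → Torus 2) (M : Fin 2 → ℤ) :
    ∑ i, ∑ j, UnitAddTorus.mFourier M (x i - x j) = ((‖SS x M‖^2 : ℝ) : ℂ) := by
  have e : ∀ i j, UnitAddTorus.mFourier M (x i - x j) =
      (starRingEnd ℂ) (UnitAddTorus.mFourier (-M) (x i)) * UnitAddTorus.mFourier (-M) (x j) := by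
    intro i j
    have h1 := mF_add M (x i - x j) (x j)
    rw [sub_add_cancel] at h1
    rw [UnitAddTorus.mFourier_neg, UnitAddTorus.mFourier_neg, Complex.conj_conj, h1, mul_assoc,
      Complex.mul_conj, Complex.normSq_eq_norm_sq, mF_norm]
    simp
  simp only [e]
  rw [← Finset.sum_mul_sum, ← map_sum]
  change (starRingEnd ℂ) (SS x M) * SS x M = _
  rw [mul_comm, Complex.mul_conj, Complex.normSq_eq_norm_sq]

lemma SS_le {N : ℕ} (x : Fin N → Torus 2) (M : Fin 2 → ℤ) : ‖SS x M‖ ≤ N := by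
  unfold SS
  refine (norm_sum_le _ _).trans ?_
  simp [mF_norm]

def boxk (n : ℕ) : Finset (Fin 2 → ℤ) := Finset.Icc (fun _ => -(n:ℤ)) (fun _ => (n:ℤ))

lemma inner_sum_le {N : ℕ} (x : Fin N → Torus 2) (n : ℕ) (Q : ℕ × ℕ)
    (hQ : Q ∈ Finset.range n ×ˢ Finset.range n) :
    ∑ P ∈ Finset.range n ×ˢ Finset.range n, ‖SS x (vk P - vk Q)‖^2 ≤
      ∑ m ∈ boxk n, ‖SS x m‖^2 := by
  have hinj : Set.InjOn (fun P : ℕ × ℕ => vk P - vk Q)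
      ((Finset.range n ×ˢ Finset.range n : Finset (ℕ × ℕ)) : Set (ℕ × ℕ)) := by
    intro P _ P' _ h
    simp only [sub_left_inj] at h
    have h0 := congrFun h 0
    have h1 := congrFun h 1
    simp only [vk, Matrix.cons_val_zero, Matrix.cons_val_one] at h0 h1
    ext
    · exact_mod_cast h0
    · exact_mod_cast h1
  rw [← Finset.sum_image (f := fun m => ‖SS x m‖^2) hinj]
  apply Finset.sum_le_sum_of_subset_of_nonneg
  · intro m hm
    rw [Finset.mem_image] at hm
    obtain ⟨P, hP, rfl⟩ := hm
    rw [Finset.mem_product, Finset.mem_range, Finset.mem_range] at hP hQ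
    unfold boxk
    rw [Finset.mem_Icc]
    constructor
    · intro i; fin_cases i <;> simp [vk] <;> omega
    · intro i; fin_cases i <;> simp [vk] <;> omega
  · intros; positivity

lemma kernel_upper {N : ℕ} (x : Fin N → Torus 2) {n : ℕ} (hn : 1 ≤ n) :
    ∑ i, ∑ j, (‖gk n ((x i - x j) 0)‖ * ‖gk n ((x i - x j) 1)‖)^2 ≤
      (n:ℝ)^2 * ∑ m ∈ boxk n, ‖SS x m‖^2 := by
  set R := Finset.range n ×ˢ Finset.range n with hR
  have e1 : ((∑ i, ∑ j, (‖gk n ((x i - x j) 0)‖ * ‖gk n ((x i - x j) 1)‖)^2 : ℝ) : ℂ) =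
      ((∑ Q ∈ R, ∑ P ∈ R, rho n ^ (P.1 + P.2) * rho n ^ (Q.1 + Q.2) * ‖SS x (vk P - vk Q)‖^2 : ℝ) : ℂ) := by
    have e2 : ∀ y : Torus 2, (((‖gk n (y 0)‖ * ‖gk n (y 1)‖)^2 : ℝ) : ℂ) =
        ∑ Q ∈ R, ∑ P ∈ R, ((rho n ^ (P.1 + P.2) * rho n ^ (Q.1 + Q.2) : ℝ) : ℂ) *
          UnitAddTorus.mFourier (vk P - vk Q) y := by
      intro y
      rw [← norm_mul, ← Complex.normSq_eq_norm_sq, ← Complex.mul_conj, gk_prod, map_sum,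
        mul_comm, Finset.sum_mul_sum]
      apply Finset.sum_congr rfl
      intro Q _
      apply Finset.sum_congr rfl
      intro P _
      rw [map_mul, Complex.conj_ofReal, sub_eq_add_neg, UnitAddTorus.mFourier_add,
        UnitAddTorus.mFourier_neg]
      push_cast
      ring
    rw [Complex.ofReal_sum]
    simp_rw [Complex.ofReal_sum]
    simp_rw [e2]
    simp_rw [Complex.ofReal_mul _ (‖SS x _‖^2), ← SS_sq, Finset.mul_sum]
    have c1 : ∀ i : Fin N, (∑ j : Fin N, ∑ Q ∈ R, ∑ P ∈ R,
        ((rho n ^ (P.1 + P.2) * rho n ^ (Q.1 + Q.2) : ℝ) : ℂ) *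
          UnitAddTorus.mFourier (vk P - vk Q) (x i - x j)) =
        ∑ Q ∈ R, ∑ P ∈ R, ∑ j : Fin N, ((rho n ^ (P.1 + P.2) * rho n ^ (Q.1 + Q.2) : ℝ) : ℂ) *
          UnitAddTorus.mFourier (vk P - vk Q) (x i - x j) := by
      intro i
      rw [Finset.sum_comm]
      apply Finset.sum_congr rfl
      intro Q _
      rw [Finset.sum_comm]
    simp_rw [c1]
    rw [Finset.sum_comm]
    apply Finset.sum_congr rfl
    intro Q _
    rw [Finset.sum_comm]
  have e3 := Complex.ofReal_injective e1
  rw [e3]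
  have h0 := rho_nonneg hn
  have h1 := rho_le_one n
  calc _ ≤ ∑ Q ∈ R, ∑ P ∈ R, ‖SS x (vk P - vk Q)‖^2 := by
        apply Finset.sum_le_sum
        intro Q _
        apply Finset.sum_le_sum
        intro P _
        have : rho n ^ (P.1 + P.2) * rho n ^ (Q.1 + Q.2) ≤ 1 :=
          mul_le_one₀ (pow_le_one₀ h0 h1) (by positivity) (pow_le_one₀ h0 h1)
        exact mul_le_of_le_one_left (by positivity) this
    _ ≤ ∑ Q ∈ R, ∑ m ∈ boxk n, ‖SS x m‖^2 := by
        apply Finset.sum_le_sum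
        intro Q hQ
        exact inner_sum_le x n Q hQ
    _ = _ := by
        rw [Finset.sum_const, hR, Finset.card_product, Finset.card_range, nsmul_eq_mul]
        push_cast
        ring

lemma kernel_lower {n : ℕ} (hn : 1 ≤ n) (x y : Torus 2) :
    (n:ℝ)^2 * ((n:ℝ)^2 / (1 + (n:ℝ)^4 * torusDist x y^4)) ≤
      80000 * (‖gk n ((x - y) 0)‖ * ‖gk n ((x - y) 1)‖)^2 := by
  have h0 := gk_lower hn ((x - y) 0)
  have h1 := gk_lower hn ((x - y) 1)
  have hd : torusDist x y^2 = ‖(x - y) 0‖^2 + ‖(x - y) 1‖^2 := by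
    unfold torusDist
    rw [Real.sq_sqrt (by positivity), Fin.sum_univ_two]
    rfl
  have hd4 : torusDist x y^4 = (‖(x - y) 0‖^2 + ‖(x - y) 1‖^2)^2 := by
    rw [← hd]; ring
  rw [hd4]
  set α := ‖(x - y) 0‖^2
  set β := ‖(x - y) 1‖^2
  have hα : 0 ≤ α := by positivity
  have hβ : 0 ≤ β := by positivity
  set A := ‖gk n ((x - y) 0)‖^2 with hA
  set B := ‖gk n ((x - y) 1)‖^2 with hB
  have hAB : (‖gk n ((x - y) 0)‖ * ‖gk n ((x - y) 1)‖)^2 = A * B := by rw [mul_pow]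
  rw [hAB]
  have hA0 : 0 ≤ A := by positivity
  have hB0 : 0 ≤ B := by positivity
  rw [← mul_div_assoc, div_le_iff₀ (by positivity)]
  have h2 := mul_le_mul h0 h1 (by positivity) (by positivity)
  refine h2.trans ?_
  have h3 : (1 + (n:ℝ)^2 * α) * (1 + (n:ℝ)^2 * β) ≤ 2 * (1 + (n:ℝ)^4 * (α + β)^2) := by
    have u1 : 0 ≤ (n:ℝ)^2 * α := by positivity
    have u2 : 0 ≤ (n:ℝ)^2 * β := by positivity
    have e : (n:ℝ)^4 * (α + β)^2 = ((n:ℝ)^2 * α + (n:ℝ)^2 * β)^2 := by ring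
    rw [e]
    nlinarith [sq_nonneg ((n:ℝ)^2 * α + (n:ℝ)^2 * β - 1), mul_nonneg u1 u2]
  have h4 := mul_le_mul_of_nonneg_right h3 (mul_nonneg hA0 hB0)
  nlinarith

lemma kernel_main {N : ℕ} (x : Fin N → Torus 2) {n : ℕ} (hn : 1 ≤ n) :
    ∑ i, ∑ j, (n:ℝ)^2 / (1 + (n:ℝ)^4 * torusDist (x i) (x j)^4) ≤
      80000 * ∑ m ∈ boxk n, ‖SS x m‖^2 := by
  have hn' : (0:ℝ) < (n:ℝ)^2 := by
    have : (1:ℝ) ≤ n := by exact_mod_cast hn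
    positivity
  rw [← mul_le_mul_iff_right₀ hn']
  calc _ = ∑ i, ∑ j, (n:ℝ)^2 * ((n:ℝ)^2 / (1 + (n:ℝ)^4 * torusDist (x i) (x j)^4)) := by
        simp_rw [Finset.mul_sum]
    _ ≤ ∑ i, ∑ j, 80000 * (‖gk n ((x i - x j) 0)‖ * ‖gk n ((x i - x j) 1)‖)^2 := by
        apply Finset.sum_le_sum
        intro i _
        apply Finset.sum_le_sum
        intro j _
        exact kernel_lower hn _ _
    _ = 80000 * ∑ i, ∑ j, (‖gk n ((x i - x j) 0)‖ * ‖gk n ((x i - x j) 1)‖)^2 := by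
        simp_rw [Finset.mul_sum]
    _ ≤ 80000 * ((n:ℝ)^2 * ∑ m ∈ boxk n, ‖SS x m‖^2) := by
        apply mul_le_mul_of_nonneg_left (kernel_upper x hn) (by norm_num)
    _ = _ := by ring

lemma freq_lower : ∃ (c1 : ℝ) (K0 : ℕ), 0 < c1 ∧ ∀ n : ℕ, ∀ k ∈ boxk n \ boxk K0,
    k ≠ 0 ∧ c1 / (n:ℝ)^3 ≤ ‖∫ y, UnitAddTorus.mFourier (-k) y * indC (1/4) y ∂muT‖^2 +
      ‖∫ y, UnitAddTorus.mFourier (-k) y * indC (1/2) y ∂muT‖^2 := by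
  obtain ⟨c, T, hc, hT, h⟩ := Fz_lower
  refine ⟨c / 108, ⌈T⌉₊, by positivity, ?_⟩
  intro n k hk
  rw [Finset.mem_sdiff] at hk
  obtain ⟨hk1, hk2⟩ := hk
  unfold boxk at hk1 hk2
  rw [Finset.mem_Icc] at hk1 hk2
  have hK : T ≤ (⌈T⌉₊ : ℝ) := Nat.le_ceil T
  have hbig : T^2 ≤ (k 0:ℝ)^2 + (k 1:ℝ)^2 := by
    by_contra hcon
    push Not at hcon
    apply hk2
    have hi : ∀ i : Fin 2, |(k i:ℝ)| ≤ T := by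
      intro i
      apply abs_le_of_sq_le_sq (b := T) ?_ (by linarith)
      fin_cases i
      · show (k 0:ℝ)^2 ≤ _
        nlinarith [sq_nonneg (k 1:ℝ)]
      · show (k 1:ℝ)^2 ≤ _
        nlinarith [sq_nonneg (k 0:ℝ)]
    constructor
    · intro i
      have := (abs_le.mp ((hi i).trans hK)).1
      show -(⌈T⌉₊:ℤ) ≤ k i
      exact_mod_cast this
    · intro i
      have := (abs_le.mp ((hi i).trans hK)).2
      show k i ≤ (⌈T⌉₊:ℤ)
      exact_mod_cast this
  have hk0 : k ≠ 0 := by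
    rintro rfl
    simp at hbig
    nlinarith
  refine ⟨hk0, ?_⟩
  have hup : (k 0:ℝ)^2 + (k 1:ℝ)^2 ≤ 2 * (n:ℝ)^2 := by
    have hi : ∀ i : Fin 2, (k i:ℝ)^2 ≤ (n:ℝ)^2 := by
      intro i
      apply sq_le_sq'
      · have := hk1.1 i
        exact_mod_cast this
      · have := hk1.2 i
        exact_mod_cast this
    linarith [hi 0, hi 1]
  set R := √((k 0:ℝ)^2 + (k 1:ℝ)^2) with hR
  have hR0 : 0 ≤ R := Real.sqrt_nonneg _
  have hRsq : R^2 = (k 0:ℝ)^2 + (k 1:ℝ)^2 := Real.sq_sqrt (by positivity)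
  have hTR : T ≤ R := by
    refine (pow_le_pow_iff_left₀ (by linarith) ?_ two_ne_zero).mp ?_
    · exact hR0
    rw [hRsq]; exact hbig
  have hn0 : (0:ℝ) ≤ n := Nat.cast_nonneg n
  have hRn : R ≤ 3/2 * n := by
    refine (pow_le_pow_iff_left₀ (by linarith) ?_ two_ne_zero).mp ?_
    · positivity
    nlinarith
  have hnpos : (0:ℝ) < n := by linarith
  have A1 := coeff_re (r := 1/4) (by norm_num) (by norm_num) k hk0
  have A2 := coeff_re (r := 1/2) (by norm_num) (by norm_num) k hk0
  rw [← hR] at A1 A2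
  set t := 2 * π * R * (1/4) with ht
  have e2 : 2 * π * R * (1/2) = 2 * t := by rw [ht]; ring
  rw [e2] at A2
  have hπ := Real.pi_gt_three
  have hπ' := Real.pi_lt_d2
  have hTt : T ≤ t := by nlinarith
  have htn : t ≤ 3 * n := by nlinarith
  have ht0 : 0 < t := by linarith
  have hF := h t hTt
  have re_le : ∀ z : ℂ, z.re^2 ≤ ‖z‖^2 := by
    intro z
    rw [← sq_abs z.re]
    exact pow_le_pow_left₀ (abs_nonneg _) (Complex.abs_re_le_norm z) 2
  have B1 := re_le (∫ y, UnitAddTorus.mFourier (-k) y * indC (1/4) y ∂muT)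
  have B2 := re_le (∫ y, UnitAddTorus.mFourier (-k) y * indC (1/2) y ∂muT)
  rw [A1] at B1
  rw [A2] at B2
  refine le_trans ?_ (add_le_add B1 B2)
  have h3 : t^3 ≤ (3*n:ℝ)^3 := pow_le_pow_left₀ ht0.le htn 3
  rw [div_le_iff₀ (by positivity)]
  have hS : 0 ≤ Fz t ^ 2 + Fz (2*t) ^ 2 := by positivity
  have h4 : t^3 * (Fz t ^ 2 + Fz (2*t) ^ 2) ≤ (3*n:ℝ)^3 * (Fz t ^ 2 + Fz (2*t) ^ 2) :=
    mul_le_mul_of_nonneg_right h3 hS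
  have h5 : 0 ≤ (n:ℝ)^3 * Fz (2*t)^2 := by positivity
  nlinarith

lemma term_compare {N n L E : ℝ} (hN : 1 ≤ N) (hL : 1 ≤ L) (hE : 0 ≤ E)
    (h1 : L^2 * N ≤ n^2) (h2 : n^2 ≤ 4 * L^2 * N) :
    N / (1 + N^2 * E) ≤ 16 * L^2 * (n^2 / (1 + n^4 * E)) := by
  rw [← mul_div_assoc, div_le_div_iff₀ (by positivity) (by positivity)]
  have hLL : 1 ≤ L^2 := by nlinarith
  have a1 : N ≤ n^2 := by nlinarith
  have a2 : N ≤ 16 * L^2 * n^2 := by nlinarith [sq_nonneg n]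
  have a3 : N * (n^4 * E) ≤ 16 * L^2 * n^2 * (N^2 * E) := by
    have : n^2 * (n^2 * N * E) ≤ (4 * L^2 * N) * (n^2 * N * E) :=
      mul_le_mul_of_nonneg_right h2 (by positivity)
    have h0 : 0 ≤ L^2 * n^2 * (N^2 * E) := by positivity
    nlinarith
  nlinarith

lemma boxk_card (K : ℕ) : ((boxk K).card : ℝ) = (2 * K + 1)^2 := by
  unfold boxk
  rw [Pi.card_Icc]
  simp only [Int.card_Icc, Finset.prod_const, Finset.card_univ, Fintype.card_fin]
  have : ((K:ℤ) + 1 - -(K:ℤ)).toNat = 2 * K + 1 := by omega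
  rw [this]
  push_cast
  ring

lemma torusDist_self' (x : Torus 2) : torusDist x x = 0 := by
  simp [torusDist]

lemma diag_lower {N : ℕ} (x : Fin N → Torus 2) (n : ℝ) :
    (N:ℝ) * n^2 ≤ ∑ i, ∑ j, n^2 / (1 + n^4 * torusDist (x i) (x j)^4) := by
  have : (N:ℝ) * n^2 = ∑ _i : Fin N, n^2 := by simp
  rw [this]
  apply Finset.sum_le_sum
  intro i _
  have h := Finset.single_le_sum (f := fun j => n^2 / (1 + n^4 * torusDist (x i) (x j)^4))
    (fun j _ => by positivity) (Finset.mem_univ i)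
  simpa [torusDist_self'] using h

lemma energy_lower : ∃ c2 : ℝ, 0 < c2 ∧ ∀ (N : ℕ), 1 ≤ N → ∀ x : Fin N → Torus 2,
    ∃ s : Finset (Fin 2 → ℤ), (∀ k ∈ s, k ≠ 0) ∧
      c2 * ((N : ℝ) ^ (-(3:ℝ)/2) *
            ∑ i, ∑ j, (N : ℝ) / (1 + (N : ℝ) ^ 2 * torusDist (x i) (x j) ^ 4)) ≤
      ∑ k ∈ s, ‖SS x k‖^2 * (‖∫ y, UnitAddTorus.mFourier (-k) y * indC (1/4) y ∂muT‖^2 +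
        ‖∫ y, UnitAddTorus.mFourier (-k) y * indC (1/2) y ∂muT‖^2) := by
  obtain ⟨c1, K0, hc1, hfreq⟩ := freq_lower
  set P : ℝ := (2 * K0 + 1)^2 with hP
  obtain ⟨L, hL⟩ : ∃ L : ℕ, 1 ≤ L ∧ 160000 * P ≤ (L:ℝ)^2 := by
    refine ⟨400 * (2 * K0 + 1), by omega, ?_⟩
    rw [hP]; push_cast
    apply le_of_eq; ring
  obtain ⟨hL1, hL2⟩ := hL
  have hL1' : (1:ℝ) ≤ L := by exact_mod_cast hL1
  refine ⟨c1 / (8 * 16 * 160000 * (L:ℝ)^5), by positivity, ?_⟩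
  intro N hN x
  have hN' : (1:ℝ) ≤ N := by exact_mod_cast hN
  set q := √(N:ℝ) with hq
  have hq1 : 1 ≤ q := by rw [hq]; exact Real.one_le_sqrt.mpr hN'
  have hqq : q^2 = N := Real.sq_sqrt (by positivity)
  set n : ℕ := L * ⌈q⌉₊ with hn
  have hn1 : (L:ℝ) * q ≤ n := by
    rw [hn]; push_cast
    exact mul_le_mul_of_nonneg_left (Nat.le_ceil q) (by positivity)
  have hn2 : (n:ℝ) ≤ 2 * L * q := by
    rw [hn]; push_cast
    have := (Nat.ceil_lt_add_one (by linarith : 0 ≤ q)).le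
    nlinarith
  have hLq : 1 ≤ (L:ℝ) * q := by nlinarith
  have hnpos : (1:ℝ) ≤ n := by linarith
  have hnn : 1 ≤ n := by exact_mod_cast hnpos
  have hs1 : (L:ℝ)^2 * N ≤ (n:ℝ)^2 := by
    rw [← hqq, ← mul_pow]; exact pow_le_pow_left₀ (by positivity) hn1 2
  have hs2 : (n:ℝ)^2 ≤ 4 * (L:ℝ)^2 * N := by
    have := pow_le_pow_left₀ (by positivity) hn2 2
    rw [← hqq]; nlinarith
  have hs3 : (n:ℝ)^3 ≤ 8 * (L:ℝ)^3 * q^3 := by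
    have := pow_le_pow_left₀ (by positivity) hn2 3
    refine this.trans (le_of_eq ?_)
    ring
  refine ⟨boxk n \ boxk K0, fun k hk => (hfreq n k hk).1, ?_⟩
  set S := ∑ k ∈ boxk n \ boxk K0, ‖SS x k‖^2 with hS
  set Q := ∑ i, ∑ j, (n:ℝ)^2 / (1 + (n:ℝ)^4 * torusDist (x i) (x j)^4) with hQ
  set Y := ∑ i, ∑ j, (N : ℝ) / (1 + (N : ℝ) ^ 2 * torusDist (x i) (x j) ^ 4) with hY
  have hk : Q ≤ 80000 * ∑ m ∈ boxk n, ‖SS x m‖^2 := kernel_main x hnn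
  have hsplit : ∑ m ∈ boxk n, ‖SS x m‖^2 ≤ S + P * (N:ℝ)^2 := by
    have h1 : ∑ m ∈ boxk n, ‖SS x m‖^2 ≤
        ∑ m ∈ (boxk n \ boxk K0) ∪ boxk K0, ‖SS x m‖^2 := by
      apply Finset.sum_le_sum_of_subset_of_nonneg
      · intro m hm
        rw [Finset.mem_union, Finset.mem_sdiff]
        tauto
      · intros; positivity
    rw [Finset.sum_union Finset.sdiff_disjoint] at h1
    have h2 : ∑ m ∈ boxk K0, ‖SS x m‖^2 ≤ P * (N:ℝ)^2 := by
      have := Finset.sum_le_card_nsmul (boxk K0) (fun m => ‖SS x m‖^2) ((N:ℝ)^2)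
        (fun m _ => pow_le_pow_left₀ (norm_nonneg _) (SS_le x m) 2)
      rw [nsmul_eq_mul, boxk_card] at this
      exact this
    linarith
  have hd : (N:ℝ) * (n:ℝ)^2 ≤ Q := diag_lower x n
  have hQS : Q ≤ 160000 * S := by
    have h1 : 160000 * P * (N:ℝ)^2 ≤ (L:ℝ)^2 * (N:ℝ)^2 :=
      mul_le_mul_of_nonneg_right hL2 (by positivity)
    have h2 : (L:ℝ)^2 * (N:ℝ)^2 ≤ N * (n:ℝ)^2 := by
      have := mul_le_mul_of_nonneg_left hs1 (by positivity : (0:ℝ) ≤ N)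
      linarith
    linarith
  have hYQ : Y ≤ 16 * (L:ℝ)^2 * Q := by
    rw [hY, hQ, Finset.mul_sum]
    apply Finset.sum_le_sum
    intro i _
    rw [Finset.mul_sum]
    apply Finset.sum_le_sum
    intro j _
    exact term_compare hN' hL1' (by positivity) hs1 hs2
  have hpow : (N:ℝ) ^ (-(3:ℝ)/2) = 1 / q^3 := by
    rw [hq, Real.sqrt_eq_rpow, ← Real.rpow_natCast, ← Real.rpow_mul (by positivity), one_div,
      ← Real.rpow_neg (by positivity)]
    norm_num
  have hlow : c1 / (n:ℝ)^3 * S ≤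
      ∑ k ∈ boxk n \ boxk K0, ‖SS x k‖^2 *
        (‖∫ y, UnitAddTorus.mFourier (-k) y * indC (1/4) y ∂muT‖^2 +
        ‖∫ y, UnitAddTorus.mFourier (-k) y * indC (1/2) y ∂muT‖^2) := by
    rw [hS, Finset.mul_sum]
    apply Finset.sum_le_sum
    intro k hk
    rw [mul_comm]
    exact mul_le_mul_of_nonneg_left (hfreq n k hk).2 (by positivity)
  refine le_trans ?_ hlow
  rw [hpow]
  have hS0 : 0 ≤ S := Finset.sum_nonneg (fun _ _ => by positivity)
  have hYS : Y ≤ 16 * (L:ℝ)^2 * (160000 * S) :=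
    hYQ.trans (mul_le_mul_of_nonneg_left hQS (by positivity))
  calc c1 / (8 * 16 * 160000 * (L:ℝ)^5) * (1 / q^3 * Y)
      ≤ c1 / (8 * 16 * 160000 * (L:ℝ)^5) * (1 / q^3 * (16 * (L:ℝ)^2 * (160000 * S))) := by
        gcongr
    _ = c1 / (8 * (L:ℝ)^3 * q^3) * S := by
        have : (L:ℝ) ≠ 0 := by positivity
        have : q ≠ 0 := by positivity
        field_simp
        try ring
    _ ≤ c1 / (n:ℝ)^3 * S := by
        gcongr

/-- Corollary 1: irregularities of distribution for disks of radius 1/4 or 1/2. -/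
theorem corollary_one :
    ∃ c : ℝ, 0 < c ∧ ∀ (N : ℕ), 1 ≤ N → ∀ x : Fin N → Torus 2,
      ∃ (center : Torus 2) (r : ℝ), (r = 1/4 ∨ r = 1/2) ∧
        c * Real.sqrt ((N : ℝ) ^ (-(3:ℝ)/2) *
            ∑ i, ∑ j, (N : ℝ) / (1 + (N : ℝ) ^ 2 * torusDist (x i) (x j) ^ 4)) ≤
          |(Nat.card {i : Fin N // torusDist (x i) center ≤ r} : ℝ) - N * (π * r ^ 2)| := by
  obtain ⟨c2, hc2, hmain⟩ := energy_lower
  refine ⟨√c2 / 2, by positivity, ?_⟩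
  intro N hN x
  have hN' : (1:ℝ) ≤ N := by exact_mod_cast hN
  obtain ⟨s, hs, hle⟩ := hmain N hN x
  set X := (N : ℝ) ^ (-(3:ℝ)/2) *
            ∑ i, ∑ j, (N : ℝ) / (1 + (N : ℝ) ^ 2 * torusDist (x i) (x j) ^ 4) with hX
  have hXpos : 0 < X := by
    apply mul_pos (by positivity)
    have : Nonempty (Fin N) := ⟨⟨0, hN⟩⟩
    apply Finset.sum_pos _ Finset.univ_nonempty
    intro i _
    apply Finset.sum_pos _ Finset.univ_nonempty
    intro j _
    positivity
  by_contra hcon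
  push Not at hcon
  have b1 := bessel_ineq x (1/4) (N * (π * (1/4)^2)) (√c2 / 2 * √X)
    (fun y => (hcon y (1/4) (Or.inl rfl)).le) s hs
  have b2 := bessel_ineq x (1/2) (N * (π * (1/2)^2)) (√c2 / 2 * √X)
    (fun y => (hcon y (1/2) (Or.inr rfl)).le) s hs
  have hB : (√c2 / 2 * √X)^2 = c2 / 4 * X := by
    rw [mul_pow, div_pow, Real.sq_sqrt hc2.le, Real.sq_sqrt hXpos.le]
    norm_num
  rw [hB] at b1 b2
  simp only [mul_add, Finset.sum_add_distrib] at hle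
  have : 0 < c2 * X := by positivity
  linarith
end
end

section
/- (Theorem 3) For every dimension d ≥ 1 there exists a constant c_d > 0 such that for every N ≥ 1, every collection of points x_1, …, x_N ∈ 𝕋^d, and all real numbers X_1, …, X_d ≥ 1, one has Σ_{k ∈ ℤ^d, |k_m| ≤ X_m for all m} |Σ_{n=1}^N e^{2πi⟨k, x_n⟩}|² ≥ c_d · Σ_{i,j=1}^N ∏_{m=1}^d [ X_m · log(e + X_m ‖x_{i,m} − x_{j,m}‖_𝕋) / (1 + X_m² ‖x_{i,m} − x_{j,m}‖_𝕋²) ], where x_{i,m} denotes the m-th coordinate of x_i and ‖·‖_𝕋 denotes distance on the circle ℝ/ℤ. -/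
open scoped Real BigOperators
open MeasureTheory
noncomputable section


/-- weighted sine sum -/
def sinSum (M : ℕ) (s : ℝ) : ℝ := ∑ y ∈ Finset.range M, Real.sin (π * (y + 1) * s) ^ 2 / ((y : ℝ) + 1)

lemma sinSum_mono {M M' : ℕ} (h : M ≤ M') (s : ℝ) : sinSum M s ≤ sinSum M' s := by
  unfold sinSum
  apply Finset.sum_le_sum_of_subset_of_nonneg
  · simpa using h
  · intros; positivity

lemma sinSum_small (M : ℕ) (s : ℝ) (hs : 0 ≤ s) (h : M * s ≤ 1 / 2) :
    2 * ((M : ℝ) * s) ^ 2 ≤ sinSum M s := by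
  have h1 : ∀ y ∈ Finset.range M, 4 * s ^ 2 * ((y : ℝ) + 1) ≤
      Real.sin (π * (y + 1) * s) ^ 2 / ((y : ℝ) + 1) := by
    intro y hy
    have hy' : (y : ℝ) + 1 ≤ M := by exact_mod_cast Finset.mem_range.mp hy
    have hpos : (0 : ℝ) < (y : ℝ) + 1 := by positivity
    have hle : ((y : ℝ) + 1) * s ≤ 1 / 2 := le_trans (mul_le_mul_of_nonneg_right hy' hs) h
    have := Real.mul_le_sin (x := π * (y + 1) * s) (by positivity) (by nlinarith [Real.pi_pos])
    have e : 2 / π * (π * (y + 1) * s) = 2 * ((y + 1) * s) := by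
      field_simp
    rw [e] at this
    rw [le_div_iff₀ hpos]
    have h0 : 0 ≤ 2 * (((y : ℝ) + 1) * s) := by positivity
    calc _ = (2 * (((y : ℝ) + 1) * s)) ^ 2 := by ring
      _ ≤ _ := by gcongr
  have h2 : ∀ M : ℕ, ∑ y ∈ Finset.range M, 4 * s ^ 2 * ((y : ℝ) + 1) = 2 * s ^ 2 * (M * (M + 1)) := by
    intro M
    induction M with
    | zero => simp
    | succ k ih => rw [Finset.sum_range_succ, ih]; push_cast; ring
  have h3 := Finset.sum_le_sum h1
  rw [h2] at h3
  refine le_trans ?_ h3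
  have : 0 ≤ s ^ 2 * M := by positivity
  nlinarith

lemma pair_bound (a θ : ℝ) (h1 : π / 4 ≤ θ) (h2 : θ ≤ 3 * π / 4) :
    1 / 4 ≤ Real.sin a ^ 2 + Real.sin (a + θ) ^ 2 := by
  have hs : Real.sin a ^ 2 + Real.sin (a + θ) ^ 2 = 1 - Real.cos (2 * a + θ) * Real.cos θ := by
    have e1 : Real.cos (2 * a) = Real.cos ((2 * a + θ) - θ) := by ring_nf
    have e2 : Real.cos (2 * (a + θ)) = Real.cos ((2 * a + θ) + θ) := by ring_nf
    rw [Real.cos_sub] at e1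
    rw [Real.cos_add] at e2
    rw [Real.sin_sq_eq_half_sub, Real.sin_sq_eq_half_sub, e1, e2]
    ring
  have hc1 : Real.cos θ ≤ √2 / 2 := by
    rw [← Real.cos_pi_div_four]
    exact Real.cos_le_cos_of_nonneg_of_le_pi (by positivity) (by linarith [Real.pi_pos]) h1
  have hc2 : -(√2 / 2) ≤ Real.cos θ := by
    have : Real.cos (3 * π / 4) = -(√2 / 2) := by
      rw [show 3 * π / 4 = π - π / 4 by ring, Real.cos_pi_sub, Real.cos_pi_div_four]
    rw [← this]
    exact Real.cos_le_cos_of_nonneg_of_le_pi (by linarith [Real.pi_pos]) (by linarith [Real.pi_pos]) h2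
  have hsq : √2 / 2 ≤ 3 / 4 := by
    have : √2 ≤ 3 / 2 := by
      rw [Real.sqrt_le_left (by norm_num)]; norm_num
    linarith
  have habs : |Real.cos θ| ≤ 3 / 4 := abs_le.mpr ⟨by linarith, by linarith⟩
  have := abs_mul (Real.cos (2 * a + θ)) (Real.cos θ)
  have h3 : |Real.cos (2 * a + θ) * Real.cos θ| ≤ 3 / 4 := by
    rw [this]
    nlinarith [Real.abs_cos_le_one (2 * a + θ), abs_nonneg (Real.cos θ), abs_nonneg (Real.cos (2 * a + θ))]
  have := le_abs_self (Real.cos (2 * a + θ) * Real.cos θ)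
  rw [hs]; linarith

lemma harm_bound (L K : ℕ) :
    Real.log (((L : ℝ) + K + 1) / (L + 1)) ≤ ∑ y ∈ Finset.range K, 1 / ((y : ℝ) + 1 + L) := by
  induction K with
  | zero => simp
  | succ k ih =>
    rw [Finset.sum_range_succ]
    have : Real.log (((L : ℝ) + (k + 1 : ℕ) + 1) / (L + 1)) =
        Real.log (((L : ℝ) + k + 1) / (L + 1)) + Real.log (1 + 1 / ((k : ℝ) + 1 + L)) := by
      rw [← Real.log_mul (by positivity) (by positivity)]
      congr 1
      push_cast
      field_simp
      ring
    rw [this]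
    have := Real.log_le_sub_one_of_pos (x := 1 + 1 / ((k : ℝ) + 1 + L)) (by positivity)
    linarith

lemma sinSum_large (M L : ℕ) (s : ℝ) (h1 : 1 / 4 ≤ L * s) (h2 : L * s ≤ 3 / 4) (hL : L ≤ M) :
    1 / 8 * Real.log (((M : ℝ) + 1) / (L + 1)) ≤ sinSum M s := by
  obtain ⟨K, rfl⟩ := Nat.exists_eq_add_of_le hL
  have hb := harm_bound L K
  have hA : ∑ y ∈ Finset.range K, Real.sin (π * (y + 1) * s) ^ 2 / ((y : ℝ) + 1) ≤ sinSum (L + K) s :=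
    sinSum_mono (Nat.le_add_left K L) s
  have hB : ∑ y ∈ Finset.range K, Real.sin (π * ((y + 1) + L) * s) ^ 2 / ((y : ℝ) + 1 + L) ≤
      sinSum (L + K) s := by
    unfold sinSum
    rw [Finset.sum_range_add]
    have : 0 ≤ ∑ y ∈ Finset.range L, Real.sin (π * (y + 1) * s) ^ 2 / ((y : ℝ) + 1) := by positivity
    refine le_trans (le_of_eq ?_) (le_add_of_nonneg_left this)
    apply Finset.sum_congr rfl
    intro y _
    push_cast
    ring_nf
  have hC : ∑ y ∈ Finset.range K, 1 / 4 * (1 / ((y : ℝ) + 1 + L)) ≤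
      ∑ y ∈ Finset.range K, (Real.sin (π * (y + 1) * s) ^ 2 / ((y : ℝ) + 1) +
        Real.sin (π * ((y + 1) + L) * s) ^ 2 / ((y : ℝ) + 1 + L)) := by
    apply Finset.sum_le_sum
    intro y _
    have hp := pair_bound (π * (y + 1) * s) (π * (L * s)) (by nlinarith [Real.pi_pos])
      (by nlinarith [Real.pi_pos])
    have e : π * (y + 1) * s + π * (L * s) = π * ((y + 1) + L) * s := by ring
    rw [e] at hp
    have h3 : Real.sin (π * (y + 1) * s) ^ 2 / ((y : ℝ) + 1 + L) ≤
        Real.sin (π * (y + 1) * s) ^ 2 / ((y : ℝ) + 1) := by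
      have : (0 : ℝ) ≤ L := by positivity
      exact div_le_div_of_nonneg_left (by positivity) (by positivity) (by linarith)
    refine le_trans ?_ (add_le_add_left h3 _)
    rw [← add_div, mul_one_div]
    exact div_le_div_of_nonneg_right hp (by positivity)
  rw [← Finset.mul_sum, Finset.sum_add_distrib] at hC
  push_cast
  linarith

lemma sinSum_bound (M : ℕ) (X s : ℝ) (hM : 1 ≤ M) (hX : X ≤ M + 1) (hX1 : 1 ≤ X) (hs : 0 < s)
    (hs2 : s ≤ 1 / 2) :
    1 / 16 * ((X * s) ^ 2 * Real.log (Real.exp 1 + X * s) / (1 + (X * s) ^ 2)) ≤ sinSum M s := by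
  have hu0 : 0 < X * s := by positivity
  have hM1 : (1 : ℝ) ≤ M := by exact_mod_cast hM
  have hXM : X / 2 ≤ M := by linarith
  have he1 := Real.exp_one_gt_d9
  have he2 := Real.exp_one_lt_d9
  have hlog0 : 0 ≤ Real.log (Real.exp 1 + X * s) := Real.log_nonneg (by linarith)
  have hfrac : (X * s) ^ 2 / (1 + (X * s) ^ 2) ≤ 1 := by
    rw [div_le_one (by positivity)]; linarith
  have hfrac0 : 0 ≤ (X * s) ^ 2 / (1 + (X * s) ^ 2) := by positivity
  have hre : (X * s) ^ 2 * Real.log (Real.exp 1 + X * s) / (1 + (X * s) ^ 2) =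
      (X * s) ^ 2 / (1 + (X * s) ^ 2) * Real.log (Real.exp 1 + X * s) := by ring
  rw [hre]
  by_cases hu : X * s ≤ 4
  · have hS : 1 / 8 * ((X * s) ^ 2 / (1 + (X * s) ^ 2)) ≤ sinSum M s := by
      by_cases hm : M * s ≤ 1 / 2
      · have := sinSum_small M s hs.le hm
        have h3 : X * s / 2 ≤ M * s := by nlinarith
        have h4 : (X * s / 2) ^ 2 ≤ (M * s) ^ 2 := by gcongr
        have h5 : (X * s) ^ 2 / (1 + (X * s) ^ 2) ≤ (X * s) ^ 2 := by
          apply div_le_self (by positivity); nlinarith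
        nlinarith
      · push Not at hm
        set M' := ⌊1 / (2 * s)⌋₊ with hM'
        have ha : (M' : ℝ) ≤ 1 / (2 * s) := Nat.floor_le (by positivity)
        have hb : 1 / (2 * s) < M' + 1 := Nat.lt_floor_add_one _
        rw [le_div_iff₀ (by positivity)] at ha
        rw [div_lt_iff₀ (by positivity)] at hb
        have hc : 1 ≤ M' := by
          apply Nat.le_floor
          rw [le_div_iff₀ (by positivity)]
          push_cast; linarith
        have hc' : (1 : ℝ) ≤ M' := by exact_mod_cast hc
        have hlt : (M' : ℝ) ≤ M := by nlinarith
        have hlt' : M' ≤ M := by exact_mod_cast hlt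
        have h5 := sinSum_small M' s hs.le (by linarith)
        have h6 := sinSum_mono hlt' s
        have h7 : 1 / 4 ≤ M' * s := by nlinarith
        have h8 : (1 / 4) ^ 2 ≤ ((M' : ℝ) * s) ^ 2 := by gcongr
        linarith
    have hl : Real.log (Real.exp 1 + X * s) ≤ 2 := by
      rw [Real.log_le_iff_le_exp (by positivity)]
      have : Real.exp 2 = Real.exp 1 * Real.exp 1 := by rw [← Real.exp_add]; norm_num
      rw [this]; nlinarith
    nlinarith
  · push Not at hu
    set L := ⌈1 / (4 * s)⌉₊ with hL
    have ha : 1 / (4 * s) ≤ L := Nat.le_ceil _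
    have hb : (L : ℝ) < 1 / (4 * s) + 1 := Nat.ceil_lt_add_one (by positivity)
    have hsi : 1 / (4 * s) * s = 1 / 4 := by field_simp
    have h1 : 1 / 4 ≤ L * s := by nlinarith
    have h2 : L * s ≤ 3 / 4 := by nlinarith
    have hLM : (L : ℝ) ≤ M := by nlinarith
    have h3 := sinSum_large M L s h1 h2 (by exact_mod_cast hLM)
    have h4 : 4 / 5 * (X * s) ≤ ((M : ℝ) + 1) / (L + 1) := by
      rw [le_div_iff₀ (by positivity)]
      have : (L + 1) * s ≤ 5 / 4 := by linarith
      nlinarith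
    have h5 := Real.log_le_log (by positivity) h4
    have h6 : Real.log (Real.exp 1 + X * s) ≤ 2 * Real.log (4 / 5 * (X * s)) := by
      have : 2 * Real.log (4 / 5 * (X * s)) = Real.log ((4 / 5 * (X * s)) ^ 2) := by
        rw [Real.log_pow]; norm_num
      rw [this]
      apply Real.log_le_log (by positivity)
      nlinarith
    nlinarith

/-- Fejer coefficient -/
def fejC (Y : ℕ) (k : ℤ) : ℝ :=
  (1 / (Y : ℝ)) * ∑ p ∈ Finset.range Y, ∑ q ∈ Finset.range Y, if (p : ℤ) - q = k then 1 else 0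

lemma fejC_nonneg (Y : ℕ) (k : ℤ) : 0 ≤ fejC Y k := by
  unfold fejC
  refine mul_nonneg (by positivity) (Finset.sum_nonneg fun p _ => Finset.sum_nonneg fun q _ => ?_)
  split_ifs <;> norm_num

lemma fejC_le_one (Y : ℕ) (k : ℤ) : fejC Y k ≤ 1 := by
  unfold fejC
  have h : ∀ p ∈ Finset.range Y,
      (∑ q ∈ Finset.range Y, if (p : ℤ) - q = k then (1 : ℝ) else 0) ≤ 1 := by
    intro p _
    rw [Finset.sum_boole]
    have : ((Finset.range Y).filter (fun q : ℕ => (p : ℤ) - q = k)).card ≤ 1 := by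
      rw [Finset.card_le_one]
      intro a ha b hb
      simp only [Finset.mem_filter] at ha hb
      omega
    exact_mod_cast this
  have h2 := Finset.sum_le_sum h
  simp only [Finset.sum_const, Finset.card_range, nsmul_eq_mul, mul_one] at h2
  rcases Nat.eq_zero_or_pos Y with h0 | h0
  · subst h0; simp
  · rw [one_div, inv_mul_le_iff₀ (by exact_mod_cast h0)]; linarith

lemma fejC_sum (Y M : ℕ) (hY : Y ≤ M + 1) (t : AddCircle (1 : ℝ)) :
    ∑ k ∈ Finset.Icc (-(M : ℤ)) M, (fejC Y k : ℂ) * fourier k t =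
      (((1 / (Y : ℝ)) * ‖∑ p ∈ Finset.range Y, (fourier (p : ℤ) t : ℂ)‖ ^ 2 : ℝ) : ℂ) := by
  push_cast
  rw [← Complex.mul_conj', map_sum, Finset.sum_mul_sum]
  simp only [fejC]
  push_cast
  simp only [mul_assoc]
  rw [← Finset.mul_sum]
  congr 1
  simp only [Finset.sum_mul]
  rw [Finset.sum_comm]
  apply Finset.sum_congr rfl
  intro p hp
  rw [Finset.sum_comm]
  apply Finset.sum_congr rfl
  intro q hq
  rw [Finset.mem_range] at hp hq
  simp only [apply_ite Complex.ofReal, Complex.ofReal_one, Complex.ofReal_zero, ite_mul, one_mul, zero_mul]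
  rw [Finset.sum_ite_eq, if_pos (by rw [Finset.mem_Icc]; omega), sub_eq_add_neg, fourier_add, fourier_neg]

/-- averaged coefficient -/
def avC (X : ℝ) (k : ℤ) : ℝ := 1 / X * ∑ y ∈ Finset.range ⌊X⌋₊, fejC (y + 1) k

lemma avC_nonneg (X : ℝ) (hX : 1 ≤ X) (k : ℤ) : 0 ≤ avC X k :=
  mul_nonneg (by positivity) (Finset.sum_nonneg fun _ _ => fejC_nonneg _ _)

lemma avC_le_one (X : ℝ) (hX : 1 ≤ X) (k : ℤ) : avC X k ≤ 1 := by
  unfold avC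
  have h := Finset.sum_le_sum (fun y (_ : y ∈ Finset.range ⌊X⌋₊) => fejC_le_one (y + 1) k)
  simp only [Finset.sum_const, Finset.card_range, nsmul_eq_mul, mul_one] at h
  have := Nat.floor_le (show 0 ≤ X by linarith)
  rw [one_div, inv_mul_le_iff₀ (by linarith)]; linarith

/-- averaged kernel -/
def avK (X : ℝ) (t : AddCircle (1 : ℝ)) : ℝ :=
  1 / X * ∑ y ∈ Finset.range ⌊X⌋₊,
    1 / ((y : ℝ) + 1) * ‖∑ p ∈ Finset.range (y + 1), (fourier (p : ℤ) t : ℂ)‖ ^ 2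

lemma avC_sum (X : ℝ) (t : AddCircle (1 : ℝ)) :
    ∑ k ∈ Finset.Icc (-(⌊X⌋₊ : ℤ)) ⌊X⌋₊, (avC X k : ℂ) * fourier k t = (avK X t : ℂ) := by
  unfold avC avK
  push_cast
  simp only [mul_assoc, ← Finset.mul_sum]
  congr 1
  simp only [Finset.sum_mul]
  rw [Finset.sum_comm]
  apply Finset.sum_congr rfl
  intro y hy
  rw [fejC_sum (y + 1) _ (by have := Finset.mem_range.mp hy; omega)]
  push_cast
  rfl

lemma exists_rep (t : AddCircle (1 : ℝ)) : ∃ r : ℝ, (r : AddCircle (1 : ℝ)) = t ∧ |r| = ‖t‖ := by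
  induction t using QuotientAddGroup.induction_on with
  | H r =>
    refine ⟨r - round r, ?_, ?_⟩
    · rw [AddCircle.coe_sub, sub_eq_self, AddCircle.coe_eq_zero_iff]
      exact ⟨round r, by simp⟩
    · exact (UnitAddCircle.norm_eq).symm

lemma norm_fourier_sub_one (n : ℕ) (t : AddCircle (1 : ℝ)) :
    ‖(fourier (n : ℤ) t : ℂ) - 1‖ ^ 2 = 4 * Real.sin (π * n * ‖t‖) ^ 2 := by
  obtain ⟨r, rfl, hr⟩ := exists_rep t
  have hs : Real.sin (π * n * ‖(r : AddCircle (1 : ℝ))‖) ^ 2 = Real.sin (π * n * r) ^ 2 := by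
    rw [← hr]
    rcases abs_choice r with h | h <;> rw [h]
    rw [mul_neg, Real.sin_neg, neg_sq]
  rw [hs, fourier_coe_apply]
  have := Complex.norm_exp_I_mul_ofReal_sub_one (2 * π * n * r)
  rw [show 2 * π * n * r / 2 = π * n * r by ring] at this
  rw [show 2 * (π : ℂ) * Complex.I * ((n : ℤ) : ℂ) * r / ((1 : ℝ) : ℂ) =
    Complex.I * ((2 * π * n * r : ℝ) : ℂ) by push_cast; ring, this, Real.norm_eq_abs, sq_abs]
  ring

lemma avK_bound (X : ℝ) (hX : 1 ≤ X) (t : AddCircle (1 : ℝ)) :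
    1 / (16 * π ^ 2) * (X * Real.log (Real.exp 1 + X * ‖t‖) / (1 + X ^ 2 * ‖t‖ ^ 2)) ≤ avK X t := by
  have hM : 1 ≤ ⌊X⌋₊ := Nat.le_floor (by simpa using hX)
  have hM1 : (1 : ℝ) ≤ ⌊X⌋₊ := by exact_mod_cast hM
  have hXM : X ≤ ⌊X⌋₊ + 1 := (Nat.lt_floor_add_one X).le
  have hpi := Real.pi_gt_three
  by_cases ht : t = 0
  · subst ht
    have hk : avK X 0 = 1 / X * (⌊X⌋₊ * (⌊X⌋₊ + 1) / 2) := by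
      unfold avK
      congr 1
      generalize ⌊X⌋₊ = M
      induction M with
      | zero => simp
      | succ k ih =>
        rw [Finset.sum_range_succ, ih]
        simp only [fourier_eval_zero, Finset.sum_const, Finset.card_range, nsmul_eq_mul, mul_one, Complex.norm_natCast]
        push_cast
        field_simp
        ring
    rw [hk]
    simp only [norm_zero, mul_zero, add_zero, Real.log_exp, mul_one, ne_eq, OfNat.ofNat_ne_zero, not_false_eq_true, zero_pow, div_one]
    have h1 : X ≤ 1 / X * (⌊X⌋₊ * (⌊X⌋₊ + 1) / 2) * 4 := by
      have : X * X ≤ (⌊X⌋₊ * (⌊X⌋₊ + 1) / 2) * 4 := by nlinarith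
      rw [mul_assoc, one_div, ← div_eq_inv_mul, le_div_iff₀ (by linarith)]
      exact this
    have h2 : 1 / (16 * π ^ 2) ≤ 1 / 4 := by
      apply one_div_le_one_div_of_le (by norm_num); nlinarith
    nlinarith
  · have hs : 0 < ‖t‖ := norm_pos_iff.mpr ht
    have hs2 : ‖t‖ ≤ 1 / 2 := by
      have := AddCircle.norm_le_half_period (p := (1 : ℝ)) (x := t) (by norm_num)
      simpa using this
    have hb := sinSum_bound ⌊X⌋₊ X ‖t‖ hM hXM hX hs hs2
    have hd : 1 / X * (1 / (π * ‖t‖) ^ 2 * sinSum ⌊X⌋₊ ‖t‖) ≤ avK X t := by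
      unfold avK sinSum
      rw [Finset.mul_sum]
      refine mul_le_mul_of_nonneg_left (Finset.sum_le_sum fun y hy => ?_) (by positivity)
      have hg := geom_sum_mul (fourier (1 : ℤ) t : ℂ) (y + 1)
      have hpow : ∀ p : ℕ, (fourier (1 : ℤ) t : ℂ) ^ p = fourier (p : ℤ) t := by
        intro p
        rw [fourier_one, fourier_apply, natCast_zsmul, AddCircle.toCircle_nsmul, Circle.coe_pow]
      simp only [hpow] at hg
      have h1 := norm_fourier_sub_one 1 t
      have h2 := norm_fourier_sub_one (y + 1) t
      rw [← hg, norm_mul, mul_pow] at h2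
      simp only [Nat.cast_one, mul_one] at h1
      rw [h1] at h2
      push_cast at h2
      have hsin : Real.sin (π * ‖t‖) ^ 2 ≤ (π * ‖t‖) ^ 2 := by
        have h3 : 0 ≤ Real.sin (π * ‖t‖) := Real.sin_nonneg_of_nonneg_of_le_pi (by positivity) (by nlinarith)
        have h4 := Real.sin_le (x := π * ‖t‖) (by positivity)
        gcongr
      set Z := ‖∑ p ∈ Finset.range (y + 1), (fourier (p : ℤ) t : ℂ)‖ ^ 2 with hZ
      have hZ0 : 0 ≤ Z := by positivity
      have h5 : Real.sin (π * (y + 1) * ‖t‖) ^ 2 ≤ (π * ‖t‖) ^ 2 * Z := by nlinarith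
      rw [show 1 / (π * ‖t‖) ^ 2 * (Real.sin (π * (y + 1) * ‖t‖) ^ 2 / ((y : ℝ) + 1)) =
        1 / ((y : ℝ) + 1) * (Real.sin (π * (y + 1) * ‖t‖) ^ 2 / (π * ‖t‖) ^ 2) by ring]
      refine mul_le_mul_of_nonneg_left ?_ (by positivity)
      rw [div_le_iff₀ (by positivity)]
      linarith
    refine le_trans ?_ hd
    refine le_trans (le_of_eq ?_) (mul_le_mul_of_nonneg_left (mul_le_mul_of_nonneg_left hb (by positivity)) (by positivity))
    have : X ≠ 0 := by linarith
    have : ‖t‖ ≠ 0 := hs.ne'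
    rw [mul_pow]
    field_simp

lemma fourier_mul_conj (k : ℤ) (a b : AddCircle (1 : ℝ)) :
    (fourier k a : ℂ) * (starRingEnd ℂ) (fourier k b) = fourier k (a - b) := by
  rw [← fourier_neg]
  simp only [fourier_apply]
  rw [neg_zsmul, ← zsmul_neg, ← Circle.coe_mul, ← AddCircle.toCircle_add, ← zsmul_add, sub_eq_add_neg]

lemma weighted_eq {d N : ℕ} (x : Fin N → Torus d) (X : Fin d → ℝ) :
    ∑ k ∈ Fintype.piFinset (fun m => Finset.Icc (-(⌊X m⌋₊ : ℤ)) ⌊X m⌋₊),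
      (∏ m, avC (X m) (k m)) * ‖∑ n, torusChar k (x n)‖ ^ 2 =
    ∑ i, ∑ j, ∏ m, avK (X m) (x i m - x j m) := by
  apply Complex.ofReal_injective
  push_cast
  simp only [← avC_sum, Finset.prod_univ_sum]
  have h : ∀ k : Fin d → ℤ, (∏ m, (avC (X m) (k m) : ℂ)) * (‖∑ n, torusChar k (x n)‖ : ℂ) ^ 2 =
      ∑ i, ∑ j, ∏ m, (avC (X m) (k m) : ℂ) * fourier (k m) (x i m - x j m) := by
    intro k
    rw [← Complex.mul_conj', map_sum, Finset.sum_mul_sum, Finset.mul_sum]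
    refine Finset.sum_congr rfl fun i _ => ?_
    rw [Finset.mul_sum]
    refine Finset.sum_congr rfl fun j _ => ?_
    rw [Finset.prod_mul_distrib]
    congr 1
    unfold torusChar
    rw [map_prod, ← Finset.prod_mul_distrib]
    exact Finset.prod_congr rfl fun m _ => fourier_mul_conj _ _ _
  simp only [h]
  rw [Finset.sum_comm]
  refine Finset.sum_congr rfl fun i _ => ?_
  rw [Finset.sum_comm]

/-- Theorem 3.  Here `‖x i m - x j m‖` is the circle distance on `ℝ/ℤ` between the `m`-th
coordinates of `x i` and `x j`. -/
theorem theorem_three (d : ℕ) (hd : 1 ≤ d) :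
    ∃ c : ℝ, 0 < c ∧ ∀ (N : ℕ), 1 ≤ N → ∀ (x : Fin N → Torus d) (X : Fin d → ℝ),
      (∀ m, 1 ≤ X m) →
      c * ∑ i, ∑ j, ∏ m,
          (X m * Real.log (Real.exp 1 + X m * ‖x i m - x j m‖) /
            (1 + X m ^ 2 * ‖x i m - x j m‖ ^ 2)) ≤
        ∑' k : {k : Fin d → ℤ // ∀ m, |(k m : ℝ)| ≤ X m},
          ‖∑ n, torusChar k.1 (x n)‖ ^ 2 := by
  refine ⟨(1 / (16 * π ^ 2)) ^ d, by positivity, ?_⟩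
  intro N _ x X hX
  have hset : ∑' k : {k : Fin d → ℤ // ∀ m, |(k m : ℝ)| ≤ X m}, ‖∑ n, torusChar k.1 (x n)‖ ^ 2 =
      ∑ k ∈ Fintype.piFinset (fun m => Finset.Icc (-(⌊X m⌋₊ : ℤ)) ⌊X m⌋₊),
        ‖∑ n, torusChar k (x n)‖ ^ 2 := by
    rw [← Finset.tsum_subtype]
    have hs : {k : Fin d → ℤ | ∀ m, |(k m : ℝ)| ≤ X m} =
        {k | k ∈ Fintype.piFinset (fun m => Finset.Icc (-(⌊X m⌋₊ : ℤ)) ⌊X m⌋₊)} := by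
      ext k
      simp only [Set.mem_ofPred_eq, Fintype.mem_piFinset, Finset.mem_Icc]
      refine forall_congr' fun m => ?_
      have h0 : 0 ≤ X m := by linarith [hX m]
      rw [← abs_le, ← Int.cast_abs, ← Int.le_floor, Int.natCast_floor_eq_floor h0]
    exact tsum_congr_set_coe (fun k : Fin d → ℤ => ‖∑ n, torusChar k (x n)‖ ^ 2) hs
  rw [hset]
  have h1 : ∑ i, ∑ j, ∏ m, avK (X m) (x i m - x j m) ≤
      ∑ k ∈ Fintype.piFinset (fun m => Finset.Icc (-(⌊X m⌋₊ : ℤ)) ⌊X m⌋₊),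
        ‖∑ n, torusChar k (x n)‖ ^ 2 := by
    rw [← weighted_eq]
    refine Finset.sum_le_sum fun k _ => ?_
    apply mul_le_of_le_one_left (by positivity)
    exact Finset.prod_le_one (fun m _ => avC_nonneg _ (hX m) _) (fun m _ => avC_le_one _ (hX m) _)
  refine le_trans ?_ h1
  rw [Finset.mul_sum]
  refine Finset.sum_le_sum fun i _ => ?_
  rw [Finset.mul_sum]
  refine Finset.sum_le_sum fun j _ => ?_
  have hc : (1 / (16 * π ^ 2)) ^ d = ∏ _m : Fin d, 1 / (16 * π ^ 2) := by simp
  rw [hc, ← Finset.prod_mul_distrib]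
  refine Finset.prod_le_prod (fun m _ => ?_) (fun m _ => avK_bound _ (hX m) _)
  have h0 : 0 ≤ X m := by linarith [hX m]
  have hl : 0 ≤ Real.log (Real.exp 1 + X m * ‖x i m - x j m‖) := by
    apply Real.log_nonneg
    have := Real.exp_one_gt_d9
    have : 0 ≤ X m * ‖x i m - x j m‖ := by positivity
    linarith
  positivity
end
end

section
/- (Theorem 4) For every dimension d ≥ 1 there exist constants c_d > 0 and C_d > 0 such that for every N ≥ 1, every collection of points x_1, …, x_N ∈ 𝕋^d, and every real X ≥ 1, one has Σ_{k ∈ ℤ^d, ‖k‖ ≤ X} |Σ_{n=1}^N e^{2πi⟨k, x_n⟩}|² ≤ C_d · Σ_{i,j=1}^N X^d e^{−c_d X² ‖x_i − x_j‖²}. -/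
open scoped Real BigOperators
open MeasureTheory

noncomputable section

lemma gauss_summable {T : ℝ} (hT : 0 < T) :
    Summable fun n : ℤ => Real.exp (-π * T * (n : ℝ) ^ 2) := by
  have h := summable_pow_mul_jacobiTheta₂_term_bound 0 hT 0
  refine h.congr fun n => ?_
  simp only [pow_zero, one_mul]
  congr 1
  ring

/-- The one-dimensional weighted term. -/
def gterm (X : ℝ) (y : AddCircle (1 : ℝ)) (n : ℤ) : ℂ :=
  (Real.exp (-π * (1 / X ^ 2) * (n : ℝ) ^ 2) : ℝ) * fourier n y

lemma gterm_summable {X : ℝ} (hX : 1 ≤ X) (y : AddCircle (1 : ℝ)) : Summable (gterm X y) := by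
  have hT : 0 < 1 / X ^ 2 := by positivity
  refine (gauss_summable hT).of_norm_bounded fun n => ?_
  rw [gterm, norm_mul, Complex.norm_real, Real.norm_of_nonneg (Real.exp_pos _).le]
  have h1 : ‖(fourier n y : ℂ)‖ = 1 := by rw [fourier_apply]; exact Circle.norm_coe _
  rw [h1, mul_one]

lemma rep_exists (y : AddCircle (1 : ℝ)) : ∃ t : ℝ, (t : AddCircle (1 : ℝ)) = y ∧ |t| ≤ 1 / 2 ∧
    ‖y‖ = |t| := by
  obtain ⟨x, rfl⟩ := QuotientAddGroup.mk_surjective y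
  refine ⟨x - round x, ?_, abs_sub_round x, ?_⟩
  · rw [AddCircle.coe_sub]
    have : ((round x : ℝ) : AddCircle (1 : ℝ)) = 0 := by
      rw [AddCircle.coe_eq_zero_iff]
      exact ⟨round x, by simp⟩
    rw [this, sub_zero]
  · exact UnitAddCircle.norm_eq

lemma theta_bound {X : ℝ} (hX : 1 ≤ X) (y : AddCircle (1 : ℝ)) :
    ‖∑' n, gterm X y n‖ ≤ (∑' n : ℤ, Real.exp (-π * (1 / 8) * (n : ℝ) ^ 2)) *
      (X * Real.exp (-(π / 2) * X ^ 2 * ‖y‖ ^ 2)) := by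
  obtain ⟨t, rfl, ht, hn⟩ := rep_exists y
  have hX0 : 0 < X := by linarith
  have ha : 0 < ((1 / X ^ 2 : ℝ) : ℂ).re := by
    rw [Complex.ofReal_re]; positivity
  have h := Complex.tsum_exp_neg_quadratic ha (Complex.I * t)
  have e1 : ∀ n : ℤ, gterm X t n = Complex.exp (-π * ((1 / X ^ 2 : ℝ) : ℂ) * n ^ 2
      + 2 * π * (Complex.I * t) * n) := by
    intro n
    rw [gterm, fourier_coe_apply, Complex.ofReal_exp, ← Complex.exp_add]
    congr 1
    push_cast
    ring
  simp_rw [e1]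
  rw [h, norm_mul]
  have e2 : ‖1 / ((1 / X ^ 2 : ℝ) : ℂ) ^ (1 / 2 : ℂ)‖ = X := by
    have : ((1 / X ^ 2 : ℝ) : ℂ) ^ (1 / 2 : ℂ) = ((1 / X : ℝ) : ℂ) := by
      have h2 : (1 / 2 : ℂ) = ((1 / 2 : ℝ) : ℂ) := by push_cast; rfl
      rw [h2, ← Complex.ofReal_cpow (by positivity), ← Real.sqrt_eq_rpow]
      congr 1
      rw [show 1 / X ^ 2 = (1 / X) ^ 2 by ring, Real.sqrt_sq (by positivity)]
    rw [this, norm_div, Complex.norm_real, Real.norm_of_nonneg (by positivity)]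
    simp
  rw [e2, mul_left_comm (∑' n : ℤ, Real.exp (-π * (1 / 8) * (n : ℝ) ^ 2)) X]
  refine mul_le_mul_of_nonneg_left ?_ hX0.le
  rw [← tsum_mul_right]
  have hs : Summable fun n : ℤ => Real.exp (-π * (1 / 8) * (n : ℝ) ^ 2) *
      Real.exp (-(π / 2) * X ^ 2 * ‖(t : AddCircle (1 : ℝ))‖ ^ 2) :=
    (gauss_summable (by norm_num)).mul_right _
  refine tsum_of_norm_bounded hs.hasSum fun n => ?_
  have e3 : -π / ((1 / X ^ 2 : ℝ) : ℂ) * (n + Complex.I * (Complex.I * t)) ^ 2 =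
      ((-π * X ^ 2 * (n - t) ^ 2 : ℝ) : ℂ) := by
    rw [← mul_assoc Complex.I, Complex.I_mul_I]
    push_cast
    field_simp
    ring
  rw [e3, ← Complex.ofReal_exp, Complex.norm_real, Real.norm_of_nonneg (Real.exp_pos _).le,
    ← Real.exp_add, Real.exp_le_exp, hn, sq_abs]
  have hX2 : 1 ≤ X ^ 2 := by nlinarith
  have key : t ^ 2 / 2 + (n : ℝ) ^ 2 / 8 ≤ (n - t) ^ 2 := by
    obtain ⟨h1, h2⟩ := abs_le.mp ht
    rcases lt_trichotomy n 0 with h0 | h0 | h0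
    · have : (n : ℝ) ≤ -1 := by exact_mod_cast (by omega : n ≤ -1)
      nlinarith
    · subst h0; push_cast; nlinarith [sq_nonneg t]
    · have : (1 : ℝ) ≤ n := by exact_mod_cast (by omega : 1 ≤ n)
      nlinarith
  have key2 : (n : ℝ) ^ 2 / 8 + X ^ 2 * (t ^ 2 / 2) ≤ X ^ 2 * (n - t) ^ 2 := by
    nlinarith [sq_nonneg (n : ℝ)]
  nlinarith [Real.pi_pos, mul_le_mul_of_nonneg_left key2 Real.pi_pos.le]

lemma fourier_sub_arg (n : ℤ) (x y : AddCircle (1 : ℝ)) :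
    (fourier n (x - y) : ℂ) = fourier n x * (starRingEnd ℂ) (fourier n y) := by
  rw [← fourier_neg, fourier_apply, fourier_apply, fourier_apply, smul_sub, sub_eq_add_neg,
    AddCircle.toCircle_add, neg_smul]
  simp

lemma box_identity {d N : ℕ} (x : Fin N → Torus d) (X : ℝ) (s : Finset ℤ) :
    ((∑ k ∈ Fintype.piFinset (fun _ : Fin d => s),
      (∏ m, Real.exp (-π * (1 / X ^ 2) * (k m : ℝ) ^ 2)) * ‖∑ n, torusChar k (x n)‖ ^ 2 : ℝ) : ℂ) =
      ∑ i, ∑ j, ∏ m, ∑ n ∈ s, gterm X (x i m - x j m) n := by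
  simp_rw [Finset.prod_univ_sum]
  push_cast
  have : ∀ k : Fin d → ℤ, ((‖∑ n, torusChar k (x n)‖ : ℂ)) ^ 2 =
      ∑ i, ∑ j, ∏ m, (fourier (k m) (x i m - x j m) : ℂ) := by
    intro k
    rw [← Complex.mul_conj', map_sum, Finset.sum_mul_sum]
    refine Finset.sum_congr rfl fun i _ => Finset.sum_congr rfl fun j _ => ?_
    simp_rw [fourier_sub_arg, Finset.prod_mul_distrib, torusChar, map_prod]
  simp_rw [this, Finset.mul_sum]
  rw [Finset.sum_comm]
  refine Finset.sum_congr rfl fun i _ => ?_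
  rw [Finset.sum_comm]
  refine Finset.sum_congr rfl fun j _ => Finset.sum_congr rfl fun k _ => ?_
  rw [← Finset.prod_mul_distrib]
  refine Finset.prod_congr rfl fun m _ => ?_
  rw [gterm]
  push_cast
  rfl

lemma box_bound {d N : ℕ} (x : Fin N → Torus d) {X : ℝ} (hX : 1 ≤ X) (M : ℕ) :
    ∑ k ∈ Fintype.piFinset (fun _ : Fin d => Finset.Icc (-(M : ℤ)) M),
      (∏ m, Real.exp (-π * (1 / X ^ 2) * (k m : ℝ) ^ 2)) * ‖∑ n, torusChar k (x n)‖ ^ 2 ≤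
    (∑' n : ℤ, Real.exp (-π * (1 / 8) * (n : ℝ) ^ 2)) ^ d *
      ∑ i, ∑ j, X ^ d * Real.exp (-(π / 2) * X ^ 2 * torusDist (x i) (x j) ^ 2) := by
  set F : ℕ → ℝ := fun M => ∑ k ∈ Fintype.piFinset (fun _ : Fin d => Finset.Icc (-(M : ℤ)) M),
      (∏ m, Real.exp (-π * (1 / X ^ 2) * (k m : ℝ) ^ 2)) * ‖∑ n, torusChar k (x n)‖ ^ 2 with hF
  have hF0 : ∀ M, 0 ≤ F M := fun M => Finset.sum_nonneg fun k _ => by positivity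
  have hmono : Monotone F := by
    intro a b hab
    refine Finset.sum_le_sum_of_subset_of_nonneg ?_ fun k _ _ => by positivity
    refine Fintype.piFinset_subset _ _ fun _ => Finset.Icc_subset_Icc ?_ ?_
    · simpa using hab
    · exact_mod_cast hab
  have hlim : Filter.Tendsto (fun M => ‖(F M : ℂ)‖) Filter.atTop
      (nhds ‖∑ i, ∑ j, ∏ m, ∑' n, gterm X (x i m - x j m) n‖) := by
    simp only [hF, box_identity]
    refine Filter.Tendsto.norm ?_
    refine tendsto_finsetSum _ fun i _ => tendsto_finsetSum _ fun j _ =>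
      tendsto_finsetProd _ fun m _ => ?_
    exact (gterm_summable hX _).hasSum.comp Finset.tendsto_Icc_neg
  have h1 : F M ≤ ‖∑ i, ∑ j, ∏ m, ∑' n, gterm X (x i m - x j m) n‖ := by
    refine ge_of_tendsto hlim ?_
    filter_upwards [Filter.eventually_ge_atTop M] with b hb
    rw [Complex.norm_real, Real.norm_of_nonneg (hF0 b)]
    exact hmono hb
  refine h1.trans ?_
  rw [Finset.mul_sum]
  refine norm_sum_le_of_le _ fun i _ => ?_
  rw [Finset.mul_sum]
  refine norm_sum_le_of_le _ fun j _ => ?_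
  rw [norm_prod]
  refine (Finset.prod_le_prod (fun m _ => norm_nonneg _)
    (fun m _ => theta_bound hX (x i m - x j m))).trans (le_of_eq ?_)
  rw [Finset.prod_mul_distrib, Finset.prod_mul_distrib, ← Real.exp_sum, ← Finset.mul_sum,
    torusDist, Real.sq_sqrt (Finset.sum_nonneg fun _ _ => by positivity)]
  simp

/-- Theorem 4. -/
theorem theorem_four (d : ℕ) (hd : 1 ≤ d) :
    ∃ c C : ℝ, 0 < c ∧ 0 < C ∧ ∀ (N : ℕ), 1 ≤ N → ∀ (x : Fin N → Torus d) (X : ℝ), 1 ≤ X →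
      (∑' k : {k : Fin d → ℤ // znorm k ≤ X}, ‖∑ n, torusChar k.1 (x n)‖ ^ 2) ≤
        C * ∑ i, ∑ j, X ^ d * Real.exp (-c * X ^ 2 * torusDist (x i) (x j) ^ 2) := by
  have hK : 0 < ∑' n : ℤ, Real.exp (-π * (1 / 8) * (n : ℝ) ^ 2) :=
    (gauss_summable (by norm_num)).tsum_pos (fun _ => (Real.exp_pos _).le) 0 (Real.exp_pos _)
  refine ⟨π / 2, Real.exp π * (∑' n : ℤ, Real.exp (-π * (1 / 8) * (n : ℝ) ^ 2)) ^ d,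
    by positivity, by positivity, fun N _ x X hX => ?_⟩
  have hX0 : 0 < X := by linarith
  refine Real.tsum_le_of_sum_le (fun k => by positivity) fun u => ?_
  rw [mul_assoc]
  refine le_trans ?_ (mul_le_mul_of_nonneg_left (box_bound x hX ⌈X⌉₊) (Real.exp_pos π).le)
  rw [Finset.mul_sum]
  refine le_trans (Finset.sum_map u (Function.Embedding.subtype _)
    (fun k : Fin d → ℤ => ‖∑ n, torusChar k (x n)‖ ^ 2)).symm.le ?_
  have hmem : ∀ k ∈ u.map (Function.Embedding.subtype _), ∑ m, (k m : ℝ) ^ 2 ≤ X ^ 2 := by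
    intro k hk
    obtain ⟨k', _, rfl⟩ := Finset.mem_map.mp hk
    have := k'.2
    rw [znorm, Real.sqrt_le_left hX0.le] at this
    exact this
  refine (Finset.sum_le_sum fun k hk => ?_).trans
    (Finset.sum_le_sum_of_subset_of_nonneg ?_ fun k _ _ => by positivity)
  · rw [← mul_assoc]
    refine le_mul_of_one_le_left (by positivity) ?_
    rw [← Real.exp_sum, ← Real.exp_add, Real.one_le_exp_iff, ← Finset.mul_sum]
    have h := hmem k hk
    have : (1 / X ^ 2) * ∑ m, (k m : ℝ) ^ 2 ≤ 1 := by
      rw [one_div, inv_mul_le_iff₀ (by positivity), mul_one]; exact h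
    nlinarith [Real.pi_pos]
  · intro k hk
    have h := hmem k hk
    rw [Fintype.mem_piFinset]
    intro m
    have h2 : (k m : ℝ) ^ 2 ≤ X ^ 2 :=
      (Finset.single_le_sum (f := fun m => (k m : ℝ) ^ 2) (fun _ _ => by positivity)
        (Finset.mem_univ m)).trans h
    have h3 := abs_le.mp (abs_le_of_sq_le_sq h2 hX0.le)
    have h4 := Nat.le_ceil X
    rw [Finset.mem_Icc]
    constructor
    · have : (-(⌈X⌉₊ : ℝ)) ≤ k m := by linarith [h3.1]
      exact_mod_cast this
    · have : (k m : ℝ) ≤ ⌈X⌉₊ := by linarith [h3.2]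
      exact_mod_cast this
end
end

section
/- (Corollary 2) For every dimension d ≥ 1 and every δ > 0 there exist constants c > 0 and C > 0 (depending only on d and δ) such that: for every N ≥ 1, if x_1, …, x_N ∈ 𝕋^d satisfy ‖x_i − x_j‖ ≥ δ N^{−1/d} for all i ≠ j, then for every real X ≥ N^{1/d} one has c · N X^d ≤ Σ_{k ∈ ℤ^d, ‖k‖ ≤ X} |Σ_{n=1}^N e^{2πi⟨k, x_n⟩}|² ≤ C · N X^d. -/
open scoped Real BigOperators
open MeasureTheory

noncomputable section

/-- Haar probability measure on the torus. -/
def tmu (d : ℕ) : Measure (Torus d) := Measure.pi (fun _ => AddCircle.haarAddCircle)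

instance (d : ℕ) : IsProbabilityMeasure (tmu d) := by unfold tmu; infer_instance
instance (d : ℕ) : (tmu d).IsAddHaarMeasure := by unfold tmu; infer_instance

lemma haar_closedBall (x : AddCircle (1:ℝ)) (r : ℝ) :
    AddCircle.haarAddCircle (Metric.closedBall x r) = ENNReal.ofReal (min 1 (2 * r)) := by
  have h := AddCircle.volume_closedBall (T := (1:ℝ)) (x := x) r
  rw [AddCircle.volume_eq_smul_haarAddCircle] at h
  simpa using h

lemma tmu_closedBall {d : ℕ} (x : Torus d) {r : ℝ} (hr : 0 ≤ r) :
    (tmu d).real (Metric.closedBall x r) = (min 1 (2 * r)) ^ d := by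
  rw [Measure.real, tmu, Measure.pi_closedBall _ _ hr]
  simp only [haar_closedBall, Finset.prod_const, Finset.card_univ, Fintype.card_fin]
  rw [ENNReal.toReal_pow, ENNReal.toReal_ofReal (by positivity)]

lemma torusChar_eq {d : ℕ} (k : Fin d → ℤ) (x : Torus d) :
    torusChar k x = UnitAddTorus.mFourier k x := rfl

lemma torusChar_neg {d : ℕ} (k : Fin d → ℤ) (x : Torus d) :
    torusChar (-k) x = (starRingEnd ℂ) (torusChar k x) :=
  UnitAddTorus.mFourier_neg (n := k) (x := x)

lemma torusChar_add {d : ℕ} (k l : Fin d → ℤ) (x : Torus d) :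
    torusChar (k + l) x = torusChar k x * torusChar l x :=
  UnitAddTorus.mFourier_add (m := k) (n := l) (x := x)

lemma torusChar_sub {d : ℕ} (k l : Fin d → ℤ) (x : Torus d) :
    torusChar (k - l) x = torusChar k x * (starRingEnd ℂ) (torusChar l x) := by
  rw [sub_eq_add_neg, torusChar_add, torusChar_neg]

lemma torusChar_continuous {d : ℕ} (k : Fin d → ℤ) : Continuous (torusChar k) :=
  (UnitAddTorus.mFourier k).continuous

lemma torusChar_norm {d : ℕ} (k : Fin d → ℤ) (x : Torus d) : ‖torusChar k x‖ = 1 := by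
  rw [torusChar, norm_prod]
  exact Finset.prod_eq_one fun m _ => Circle.norm_coe _

lemma torusChar_add_right {d : ℕ} (k : Fin d → ℤ) (x y : Torus d) :
    torusChar k (x + y) = torusChar k x * torusChar k y := by
  simp only [torusChar, ← Finset.prod_mul_distrib]
  refine Finset.prod_congr rfl fun m _ => ?_
  simp [fourier_apply, smul_add, AddCircle.toCircle_add]

lemma bessel {d : ℕ} (f : Torus d → ℂ) (hf : MemLp f 2 (tmu d)) (T : Finset (Fin d → ℤ)) :
    ∑ k ∈ T, ‖∫ t, torusChar (-k) t * f t ∂(tmu d)‖ ^ 2 ≤ ∫ t, ‖f t‖ ^ 2 ∂(tmu d) := by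
  have h := UnitAddTorus.hasSum_sq_mFourierCoeff (d := Fin d) (hf.toLp f)
  have h1 : ∫ t, ‖(hf.toLp f) t‖ ^ 2 ∂(tmu d) = ∫ t, ‖f t‖ ^ 2 ∂(tmu d) := by
    apply integral_congr_ae
    filter_upwards [hf.coeFn_toLp] with t ht
    rw [ht]
  have h2 : ∀ k, UnitAddTorus.mFourierCoeff (hf.toLp f) k
      = ∫ t, torusChar (-k) t * f t ∂(tmu d) := by
    intro k
    apply integral_congr_ae
    have := hf.coeFn_toLp
    filter_upwards [this] with t ht
    rw [ht]; rfl
  have h3 : HasSum (fun k => ‖∫ t, torusChar (-k) t * f t ∂(tmu d)‖ ^ 2) (∫ t, ‖f t‖ ^ 2 ∂(tmu d)) := by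
    rw [← h1]
    simp_rw [← h2]
    exact h
  exact sum_le_hasSum T (fun _ _ => by positivity) h3

lemma fourier_sub_one_le (k : ℤ) (t : AddCircle (1:ℝ)) :
    ‖(fourier k t : ℂ) - 1‖ ≤ 2 * π * |(k:ℝ)| * ‖t‖ := by
  induction t using QuotientAddGroup.induction_on with | H z => ?_
  set y : ℝ := z - round z with hy
  have e : ((z : ℝ) : AddCircle (1:ℝ)) = ((y : ℝ) : AddCircle (1:ℝ)) := by
    rw [hy, AddCircle.coe_sub]
    have : ((round z : ℝ) : AddCircle (1:ℝ)) = 0 := by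
      rw [AddCircle.coe_eq_zero_iff]; exact ⟨round z, by simp⟩
    rw [this, sub_zero]
  have hn : ‖((z : ℝ) : AddCircle (1:ℝ))‖ = |y| := by
    rw [AddCircle.norm_eq]; simp [hy]
  change ‖(fourier k ((z : ℝ) : AddCircle (1:ℝ)) : ℂ) - 1‖ ≤ 2 * π * |(k:ℝ)| * ‖((z : ℝ) : AddCircle (1:ℝ))‖
  rw [hn, e, fourier_coe_apply]
  have := Real.norm_exp_I_mul_ofReal_sub_one_le (x := 2 * π * k * y)
  convert this using 1
  · congr 3; push_cast; ring_nf
  · simp [abs_of_pos Real.pi_pos]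

lemma norm_prod_sub_one_le {ι : Type*} (s : Finset ι) (a : ι → ℂ) (ha : ∀ i, ‖a i‖ = 1) :
    ‖∏ i ∈ s, a i - 1‖ ≤ ∑ i ∈ s, ‖a i - 1‖ := by
  classical
  induction s using Finset.induction_on with
  | empty => simp
  | insert i s hi ih =>
    rw [Finset.prod_insert hi, Finset.sum_insert hi]
    have : a i * ∏ j ∈ s, a j - 1 = (a i - 1) + a i * (∏ j ∈ s, a j - 1) := by ring
    rw [this]
    refine (norm_add_le _ _).trans ?_
    rw [norm_mul, ha, one_mul]
    gcongr

lemma abs_le_znorm {d : ℕ} (k : Fin d → ℤ) (m : Fin d) : |(k m : ℝ)| ≤ znorm k := by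
  rw [znorm]
  apply Real.le_sqrt_of_sq_le
  rw [sq_abs]
  exact Finset.single_le_sum (f := fun m => ((k m : ℝ)) ^ 2) (fun _ _ => by positivity) (Finset.mem_univ m)

lemma torusChar_sub_one_le {d : ℕ} (k : Fin d → ℤ) (t : Torus d) {X η : ℝ} (hX : 0 ≤ X)
    (hk : znorm k ≤ X) (ht : ‖t‖ ≤ η) :
    ‖torusChar k t - 1‖ ≤ 2 * π * d * X * η := by
  rw [torusChar]
  refine (norm_prod_sub_one_le _ _ (fun i => Circle.norm_coe _)).trans ?_
  have : ∀ m ∈ Finset.univ, ‖(fourier (k m) (t m) : ℂ) - 1‖ ≤ 2 * π * X * η := by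
    intro m _
    refine (fourier_sub_one_le _ _).trans ?_
    have h1 := (abs_le_znorm k m).trans hk
    have h2 := (norm_le_pi_norm t m).trans ht
    gcongr
  refine (Finset.sum_le_card_nsmul _ _ _ this).trans ?_
  simp; apply le_of_eq; ring

lemma znorm_finite (d : ℕ) (X : ℝ) : {k : Fin d → ℤ | znorm k ≤ X}.Finite := by
  refine (Set.Finite.pi (fun _ : Fin d => Set.finite_Icc (-⌈X⌉) ⌈X⌉)).subset ?_
  intro k hk m _
  have h := (abs_le_znorm k m).trans hk
  have h2 : |(k m : ℝ)| ≤ (⌈X⌉ : ℝ) := h.trans (Int.le_ceil X)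
  rw [abs_le] at h2
  constructor
  · exact_mod_cast h2.1
  · exact_mod_cast h2.2

/-- The finite set of frequencies. -/
def freq (d : ℕ) (X : ℝ) : Finset (Fin d → ℤ) := (znorm_finite d X).toFinset

lemma mem_freq {d : ℕ} {X : ℝ} {k : Fin d → ℤ} : k ∈ freq d X ↔ znorm k ≤ X := by
  simp [freq]

lemma tsum_freq (d : ℕ) (X : ℝ) (g : (Fin d → ℤ) → ℝ) :
    ∑' k : {k : Fin d → ℤ // znorm k ≤ X}, g k.1 = ∑ k ∈ freq d X, g k := by
  rw [← Finset.tsum_subtype]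
  exact Equiv.tsum_eq (Equiv.subtypeEquivRight (fun k => (mem_freq (X := X) (k := k)).symm))
    (fun k : {k // k ∈ freq d X} => g k.1)

lemma sum_sq_eq {d N : ℕ} (x : Fin N → Torus d) (B : Finset (Fin d → ℤ)) :
    ∑ a ∈ B, ∑ b ∈ B, ‖∑ n, torusChar (a - b) (x n)‖ ^ 2 =
      ∑ i, ∑ j, ‖∑ a ∈ B, torusChar a (x i) * (starRingEnd ℂ) (torusChar a (x j))‖ ^ 2 := by
  apply Complex.ofReal_injective
  push_cast
  simp_rw [← Complex.mul_conj', map_sum, Finset.sum_mul_sum, torusChar_sub, map_mul,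
    Complex.conj_conj]
  have h1 : ∀ a ∈ B, (∑ b ∈ B, ∑ i : Fin N, ∑ j : Fin N,
      torusChar a (x i) * (starRingEnd ℂ) (torusChar b (x i)) *
      ((starRingEnd ℂ) (torusChar a (x j)) * torusChar b (x j))) =
      ∑ i : Fin N, ∑ j : Fin N, ∑ b ∈ B, torusChar a (x i) * (starRingEnd ℂ) (torusChar a (x j)) *
        ((starRingEnd ℂ) (torusChar b (x i)) * torusChar b (x j)) := by
    intro a _
    rw [Finset.sum_comm]
    refine Finset.sum_congr rfl fun i _ => ?_
    rw [Finset.sum_comm]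
    refine Finset.sum_congr rfl fun j _ => ?_
    refine Finset.sum_congr rfl fun b _ => ?_
    ring
  rw [Finset.sum_congr rfl h1, Finset.sum_comm]
  refine Finset.sum_congr rfl fun i _ => ?_
  rw [Finset.sum_comm]

lemma lower_bound {d N : ℕ} (hd : 1 ≤ d) (x : Fin N → Torus d) {X : ℝ} (hX : 0 ≤ X) :
    N * (X / Real.sqrt d) ^ d ≤ ∑ k ∈ freq d X, ‖∑ n, torusChar k (x n)‖ ^ 2 := by
  classical
  have hd0 : (0:ℝ) < d := by exact_mod_cast hd
  set Y := X / Real.sqrt d with hY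
  have hY0 : 0 ≤ Y := by positivity
  set M : ℕ := ⌊Y⌋₊ + 1 with hM
  have hMY : Y ≤ M := by rw [hM]; push_cast; exact (Nat.lt_floor_add_one Y).le
  have hMY' : (M:ℝ) - 1 ≤ Y := by
    rw [hM]; push_cast; have := Nat.floor_le hY0; linarith
  set B : Finset (Fin d → ℤ) := Fintype.piFinset (fun _ => Finset.Ico (0:ℤ) M) with hB
  have hcard : B.card = M ^ d := by simp [hB]
  have hsub : ∀ a ∈ B, ∀ b ∈ B, a - b ∈ freq d X := by
    intro a ha b hb
    rw [mem_freq, znorm]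
    have : ∀ m ∈ Finset.univ, (((a - b) m : ℤ) : ℝ) ^ 2 ≤ Y ^ 2 := by
      intro m _
      simp only [hB, Fintype.mem_piFinset, Finset.mem_Ico] at ha hb
      have ha := ha m
      have hb := hb m
      apply sq_le_sq'
      · have : -((M:ℤ) - 1) ≤ (a - b) m := by simp only [Pi.sub_apply]; omega
        have : -((M:ℝ) - 1) ≤ ((a - b) m : ℤ) := by exact_mod_cast this
        linarith
      · have : (a - b) m ≤ ((M:ℤ) - 1) := by simp only [Pi.sub_apply]; omega
        have : (((a - b) m : ℤ) : ℝ) ≤ ((M:ℝ) - 1) := by exact_mod_cast this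
        linarith
    have h := Finset.sum_le_card_nsmul _ _ _ this
    rw [Real.sqrt_le_left hX]
    refine h.trans (le_of_eq ?_)
    simp [hY, div_pow]
    field_simp
  have h1 : ∑ a ∈ B, ∑ b ∈ B, ‖∑ n, torusChar (a - b) (x n)‖ ^ 2 ≤
      (M:ℝ) ^ d * ∑ k ∈ freq d X, ‖∑ n, torusChar k (x n)‖ ^ 2 := by
    have : ∀ a ∈ B, ∑ b ∈ B, ‖∑ n, torusChar (a - b) (x n)‖ ^ 2 ≤
        ∑ k ∈ freq d X, ‖∑ n, torusChar k (x n)‖ ^ 2 := by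
      intro a ha
      rw [← Finset.sum_image (s := B) (g := fun b => a - b)
        (f := fun k => ‖∑ n, torusChar k (x n)‖ ^ 2) (by intro b _ c _ h; simpa using h)]
      apply Finset.sum_le_sum_of_subset_of_nonneg
      · intro k hk
        obtain ⟨b, hb, rfl⟩ := Finset.mem_image.1 hk
        exact hsub a ha b hb
      · intros; positivity
    refine (Finset.sum_le_card_nsmul _ _ _ this).trans (le_of_eq ?_)
    rw [hcard, nsmul_eq_mul]; push_cast; rfl
  have h2 : (N:ℝ) * ((M:ℝ) ^ d) ^ 2 ≤ ∑ a ∈ B, ∑ b ∈ B, ‖∑ n, torusChar (a - b) (x n)‖ ^ 2 := by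
    rw [sum_sq_eq]
    have : ∀ i ∈ Finset.univ, ((M:ℝ) ^ d) ^ 2 ≤
        ∑ j, ‖∑ a ∈ B, torusChar a (x i) * (starRingEnd ℂ) (torusChar a (x j))‖ ^ 2 := by
      intro i _
      refine le_trans (le_of_eq ?_) (Finset.single_le_sum (f := fun j =>
        ‖∑ a ∈ B, torusChar a (x i) * (starRingEnd ℂ) (torusChar a (x j))‖ ^ 2)
        (fun _ _ => by positivity) (Finset.mem_univ i))
      simp [Complex.mul_conj', torusChar_norm, hcard]
    refine le_trans (le_of_eq ?_) (Finset.card_nsmul_le_sum _ _ _ this)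
    simp
  have hMp : (0:ℝ) < (M:ℝ) ^ d := by positivity
  have h3 := h2.trans h1
  have h4 : (N:ℝ) * (M:ℝ) ^ d ≤ ∑ k ∈ freq d X, ‖∑ n, torusChar k (x n)‖ ^ 2 := by
    have : (M:ℝ) ^ d * ((N:ℝ) * (M:ℝ) ^ d) ≤
      (M:ℝ) ^ d * ∑ k ∈ freq d X, ‖∑ n, torusChar k (x n)‖ ^ 2 := by
      refine le_trans (le_of_eq ?_) h3; ring
    exact le_of_mul_le_mul_left this hMp
  refine le_trans ?_ h4
  gcongr

lemma torusDist_le {d : ℕ} (x y : Torus d) : torusDist x y ≤ Real.sqrt d * dist x y := by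
  rw [torusDist]
  have : ∀ m ∈ Finset.univ, ‖x m - y m‖ ^ 2 ≤ dist x y ^ 2 := by
    intro m _
    rw [← dist_eq_norm]
    gcongr
    exact dist_le_pi_dist x y m
  refine (Real.sqrt_le_sqrt (Finset.sum_le_card_nsmul _ _ _ this)).trans (le_of_eq ?_)
  simp

open Classical in
lemma packing {d N : ℕ} (x : Fin N → Torus d) {r β η : ℝ} (hr : 0 < r) (hr1 : r ≤ 1) (hβ : 0 < β)
    (hβ1 : 2 * β ≤ 1) (hη : 0 ≤ η) (hηr : η ≤ r) (hsep : ∀ i j, i ≠ j → 2 * (r * β) < dist (x i) (x j))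
    (t : Torus d) :
    ((Finset.univ.filter fun n => t ∈ Metric.closedBall (x n) η).card : ℝ) ≤ ((1 + β) / β) ^ d := by
  set A := Finset.univ.filter fun n => t ∈ Metric.closedBall (x n) η with hA
  have h1 : ∑ n ∈ A, (tmu d).real (Metric.closedBall (x n) (r * β)) ≤
      (tmu d).real (Metric.closedBall t (η + r * β)) := by
    rw [← measureReal_biUnion_finset]
    · apply measureReal_mono
      · intro y hy
        simp only [Set.mem_iUnion] at hy
        obtain ⟨n, hn, hy⟩ := hy
        simp only [hA, Finset.mem_filter, Metric.mem_closedBall] at hn hy ⊢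
        have := dist_triangle y (x n) t
        rw [dist_comm (x n) t] at this
        linarith [hn.2]
      · exact measure_ne_top _ _
    · intro i _ j _ hij
      apply Metric.closedBall_disjoint_closedBall
      have := hsep i j hij
      linarith
    · intro n _; exact Metric.isClosed_closedBall.measurableSet
  have hrb : 2 * (r * β) ≤ 1 := by nlinarith
  rw [tmu_closedBall _ (by positivity)] at h1
  simp only [tmu_closedBall _ (by positivity : 0 ≤ r * β), Finset.sum_const, nsmul_eq_mul,
    min_eq_right hrb] at h1
  have h2 : (A.card : ℝ) * (2 * (r * β)) ^ d ≤ (2 * (r * (1 + β))) ^ d := by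
    refine h1.trans ?_
    apply pow_le_pow_left₀ (by positivity)
    refine (min_le_right _ _).trans ?_
    nlinarith
  have h3 : (2 * (r * (1 + β))) ^ d = ((1 + β) / β) ^ d * (2 * (r * β)) ^ d := by
    rw [← mul_pow]; congr 1; field_simp
  rw [h3] at h2
  exact le_of_mul_le_mul_right h2 (by positivity)

open Classical in
lemma upper_bound {d N : ℕ} (x : Fin N → Torus d) {X η K : ℝ} (hX : 0 ≤ X)
    (hη : 0 < η) (hη1 : 2 * η ≤ 1) (hXη : 2 * π * d * X * η ≤ 1 / 2)
    (hK : ∀ t, ((Finset.univ.filter fun n => t ∈ Metric.closedBall (x n) η).card : ℝ) ≤ K) :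
    ∑ k ∈ freq d X, ‖∑ n, torusChar k (x n)‖ ^ 2 ≤ 4 * K * N * (1 / (2 * η)) ^ d := by
  set V : ℝ := (2 * η) ^ d with hV
  have hV0 : 0 < V := by positivity
  have hvol : ∀ y : Torus d, (tmu d).real (Metric.closedBall y η) = V := by
    intro y; rw [tmu_closedBall _ hη.le, min_eq_right hη1]
  have hmeas : ∀ y : Torus d, MeasurableSet (Metric.closedBall y η) :=
    fun y => Metric.isClosed_closedBall.measurableSet
  set f : Torus d → ℂ := fun t => ∑ n, (Metric.closedBall (x n) η).indicator (fun _ => (1:ℂ)) t with hf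
  have hfcard : ∀ t, f t = ((Finset.univ.filter fun n => t ∈ Metric.closedBall (x n) η).card : ℂ) := by
    intro t
    simp only [hf, Set.indicator_apply, Finset.sum_boole]
  have hfL : MemLp f 2 (tmu d) := by
    apply memLp_finsetSum
    intro n _
    exact (memLp_const (1:ℂ)).indicator (hmeas _)
  have hB := bessel f hfL (freq d X)
  -- the L2 norm
  have hL2 : ∫ t, ‖f t‖ ^ 2 ∂(tmu d) ≤ K * (N * V) := by
    have hint : ∀ n ∈ Finset.univ, Integrable
        (fun t => (Metric.closedBall (x n) η).indicator (fun _ => (1:ℝ)) t) (tmu d) :=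
      fun n _ => (integrable_const (1:ℝ)).indicator (hmeas _)
    have e : ∫ t, K * ∑ n, (Metric.closedBall (x n) η).indicator (fun _ => (1:ℝ)) t ∂(tmu d)
        = K * (N * V) := by
      rw [integral_const_mul, integral_finsetSum _ hint]
      simp [integral_indicator, hmeas, hvol]
    rw [← e]
    apply integral_mono
    · exact hfL.integrable_norm_pow (by norm_num)
    · exact (integrable_finsetSum _ hint).const_mul K
    · intro t
      have h1 := hK t
      simp only [hfcard, Set.indicator_apply, Finset.sum_boole, Complex.norm_natCast]
      rw [sq]
      gcongr
  -- the coefficients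
  have hcoef : ∀ k ∈ freq d X, ‖∑ n, torusChar k (x n)‖ ^ 2 * (V / 2) ^ 2 ≤
      ‖∫ t, torusChar (-k) t * f t ∂(tmu d)‖ ^ 2 := by
    intro k hk
    rw [mem_freq] at hk
    set J : ℂ := ∫ t in Metric.closedBall (0 : Torus d) η, torusChar (-k) t ∂(tmu d) with hJ
    have hci : ∀ l : Fin d → ℤ, Integrable (torusChar l) (tmu d) := fun l =>
      Integrable.of_bound (torusChar_continuous l).aestronglyMeasurable 1
        (Filter.Eventually.of_forall fun t => (torusChar_norm l t).le)
    have h1 : ∀ y : Torus d, ∫ t, torusChar (-k) t *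
        (Metric.closedBall y η).indicator (fun _ => (1:ℂ)) t ∂(tmu d) = torusChar (-k) y * J := by
      intro y
      rw [← integral_add_left_eq_self _ y, hJ, ← integral_indicator (hmeas 0),
        ← integral_const_mul]
      congr 1
      ext t
      simp only [Set.indicator_apply, Metric.mem_closedBall, torusChar_add_right, dist_eq_norm,
        add_sub_cancel_left, sub_zero]
      split_ifs <;> simp
    have h2 : ∫ t, torusChar (-k) t * f t ∂(tmu d) =
        (starRingEnd ℂ) (∑ n, torusChar k (x n)) * J := by
      simp only [hf, Finset.mul_sum]
      rw [integral_finsetSum]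
      · simp only [h1]
        simp only [map_sum, Finset.sum_mul, torusChar_neg]
      · intro n _
        have := (hci (-k)).indicator (hmeas (x n))
        refine this.congr (Filter.Eventually.of_forall fun t => ?_)
        simp [Set.indicator_apply]
    have h3 : V / 2 ≤ ‖J‖ := by
      have h4 : ‖J - V‖ ≤ 1 / 2 * V := by
        have : J - V = ∫ t in Metric.closedBall (0 : Torus d) η, (torusChar (-k) t - 1) ∂(tmu d) := by
          rw [integral_sub (hci _).integrableOn (integrable_const _)]
          simp [hJ, hvol]
        rw [this, ← hvol 0]
        apply norm_setIntegral_le_of_norm_le_const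
        · exact measure_lt_top _ _
        · intro t ht
          have hkn : znorm (-k) ≤ X := by simpa [znorm] using hk
          exact (torusChar_sub_one_le (-k) t hX hkn (by simpa using ht)).trans hXη
      have h5 : ‖(V:ℂ)‖ = V := by simp [abs_of_pos hV0]
      have h6 := norm_sub_norm_le (V:ℂ) J
      rw [norm_sub_rev] at h6
      linarith
    rw [h2, norm_mul, RCLike.norm_conj, mul_pow]
    gcongr
  have h := (Finset.sum_le_sum hcoef).trans (hB.trans hL2)
  rw [← Finset.sum_mul] at h
  have h7 : 4 * K * N * (1 / (2 * η)) ^ d * (V / 2) ^ 2 = K * (N * V) := by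
    rw [one_div, inv_pow, ← hV]; field_simp; ring
  rw [← h7] at h
  exact le_of_mul_le_mul_right h (by positivity)

/-- Corollary 2: matching bounds for well-separated point sets in the regime `X ≳ N^{1/d}`. -/
theorem corollary_two (d : ℕ) (hd : 1 ≤ d) (δ : ℝ) (hδ : 0 < δ) :
    ∃ c C : ℝ, 0 < c ∧ 0 < C ∧ ∀ (N : ℕ), 1 ≤ N → ∀ x : Fin N → Torus d,
      (∀ i j, i ≠ j → δ * (N : ℝ) ^ (-(1:ℝ)/d) ≤ torusDist (x i) (x j)) →
      ∀ X : ℝ, (N : ℝ) ^ ((1:ℝ)/d) ≤ X →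
        c * N * X ^ d ≤
          (∑' k : {k : Fin d → ℤ // znorm k ≤ X}, ‖∑ n, torusChar k.1 (x n)‖ ^ 2) ∧
        (∑' k : {k : Fin d → ℤ // znorm k ≤ X}, ‖∑ n, torusChar k.1 (x n)‖ ^ 2) ≤
          C * N * X ^ d := by
  have hd0 : (0:ℝ) < d := by exact_mod_cast hd
  have hd1 : (1:ℝ) ≤ d := by exact_mod_cast hd
  have hsd : 0 < Real.sqrt d := Real.sqrt_pos.2 hd0
  set β : ℝ := min (δ / Real.sqrt d) 1 / 3 with hβ
  have hβ0 : 0 < β := by positivity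
  have hβ1 : β ≤ 1 / 3 := by
    rw [hβ]; have := min_le_right (δ / Real.sqrt d) 1; linarith
  have hβ2 : 3 * β ≤ δ / Real.sqrt d := by
    rw [hβ]; have := min_le_left (δ / Real.sqrt d) 1; linarith
  refine ⟨(1 / Real.sqrt d) ^ d, 4 * ((1 + β) / β) ^ d * (2 * π * d) ^ d, by positivity,
    by positivity, ?_⟩
  intro N hN x hsep X hX
  have hN0 : (0:ℝ) < N := by exact_mod_cast hN
  have hN1 : (1:ℝ) ≤ N := by exact_mod_cast hN
  have hR1 : 1 ≤ (N:ℝ) ^ ((1:ℝ)/d) := Real.one_le_rpow hN1 (by positivity)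
  have hX1 : 1 ≤ X := hR1.trans hX
  have hX0 : 0 < X := by linarith
  rw [tsum_freq d X (fun k => ‖∑ n, torusChar k (x n)‖ ^ 2)]
  constructor
  · refine le_trans (le_of_eq ?_) (lower_bound hd x hX0.le)
    rw [div_pow, div_pow]; ring
  · set r : ℝ := (N:ℝ) ^ (-(1:ℝ)/d) with hr
    have hrR : r = ((N:ℝ) ^ ((1:ℝ)/d))⁻¹ := by
      rw [hr, neg_div, Real.rpow_neg hN0.le]
    have hr0 : 0 < r := by positivity
    have hr1 : r ≤ 1 := by rw [hrR]; exact inv_le_one_of_one_le₀ hR1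
    have hXr : 1 / X ≤ r := by
      rw [hrR, one_div]; exact inv_anti₀ (by linarith) hX
    set η : ℝ := 1 / (4 * π * d * X) with hη
    have hη0 : 0 < η := by positivity
    have hpi := Real.pi_gt_three
    have h4 : 2 ≤ 4 * π * d := by nlinarith
    have hηX : η ≤ (1 / X) / 2 := by
      rw [hη, div_div]
      apply one_div_le_one_div_of_le (by positivity)
      nlinarith
    have hs : ∀ i j, i ≠ j → 2 * (r * β) < dist (x i) (x j) := by
      intro i j hij
      have h1 := (hsep i j hij).trans (torusDist_le _ _)
      have h2 : δ / Real.sqrt d * r ≤ dist (x i) (x j) := by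
        rw [div_mul_eq_mul_div, div_le_iff₀ hsd]; linarith
      have h3 : 3 * β * r ≤ δ / Real.sqrt d * r := by gcongr
      have : 0 < r * β := by positivity
      nlinarith
    have hu := upper_bound x (K := ((1 + β) / β) ^ d) hX0.le hη0 (by linarith)
      (le_of_eq (by rw [hη]; field_simp; norm_num))
      (packing x hr0 hr1 hβ0 (by linarith) hη0.le (by linarith) hs)
    refine hu.trans (le_of_eq ?_)
    have : 1 / (2 * η) = 2 * π * d * X := by rw [hη]; field_simp; norm_num
    rw [this, mul_pow]; ring
end
end

section
/- (Proposition, Section 4.2) For every dimension d ≥ 1, every c > 0 and every δ > 0 there exists a constant C > 0 (depending only on d, c, δ) such that: for every N ≥ 1, if x_1, …, x_N ∈ 𝕋^d satisfy ‖x_i − x_j‖ ≥ δ N^{−1/d} for all i ≠ j, then for every real X ≥ N^{1/d} one has N X^d ≤ Σ_{i,j=1}^N X^d e^{−c X² ‖x_i − x_j‖²} ≤ C · N X^d. -/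
open scoped Real BigOperators
open MeasureTheory

noncomputable section

theorem ge_summ (a : ℝ) (ha : 0 < a) : Summable (fun k : ℤ => Real.exp (-a * (k:ℝ) ^ 2)) := by
  have h1 : Summable (fun k : ℕ => Real.exp (-a * ((k:ℝ)) ^ 2)) := by
    have h2 : Summable (fun k : ℕ => Real.exp ((k:ℝ) * (-a))) :=
      Real.summable_exp_nat_mul_iff.mpr (by linarith)
    refine Summable.of_nonneg_of_le (fun _ => (Real.exp_pos _).le) (fun k => ?_) h2
    apply Real.exp_le_exp.mpr
    have : (k:ℝ) ≤ (k:ℝ) ^ 2 := by exact_mod_cast Nat.le_self_pow (by norm_num) k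
    nlinarith
  apply Summable.of_nat_of_neg
  · simpa using h1
  · simpa using h1

theorem ge_rep (a : AddCircle (1:ℝ)) : ∃ v : ℝ, (v : AddCircle (1:ℝ)) = a ∧ |v| = ‖a‖ := by
  induction a using QuotientAddGroup.induction_on with
  | H u =>
    refine ⟨u - round u, ?_, ?_⟩
    · have : ((round u : ℝ) : AddCircle (1:ℝ)) = 0 := by
        rw [AddCircle.coe_eq_zero_iff]
        exact ⟨round u, by simp⟩
      rw [AddCircle.coe_sub, this, sub_zero]
    · have := AddCircle.norm_eq (p := (1:ℝ)) (x := u)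
      simp at this
      exact this.symm

theorem ge_norm_le (v : ℝ) : ‖(v : AddCircle (1:ℝ))‖ ≤ |v| := by
  rw [AddCircle.norm_eq]
  simpa using round_le v 0

theorem ge_key (d : ℕ) (c : ℝ) (hc : 0 < c) (h : ℝ) (hh : 0 < h) (n : ℝ) (hn : 0 < n)
    (N : ℕ) (x : Fin N → Torus d)
    (hx : ∀ i j, i ≠ j → (h * (d + 1)) * n⁻¹ ≤ torusDist (x i) (x j)) (i : Fin N) :
    ∑ j, Real.exp (-c * n ^ 2 * torusDist (x i) (x j) ^ 2) ≤
      (∑' k : ℤ, Real.exp (c * h ^ 2) * Real.exp (-(c * h ^ 2 / 2) * (k:ℝ) ^ 2)) ^ d := by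
  classical
  set G : ℤ → ℝ := fun k => Real.exp (c * h ^ 2) * Real.exp (-(c * h ^ 2 / 2) * (k:ℝ) ^ 2) with hG
  have hGs : Summable G := (ge_summ _ (by positivity)).mul_left _
  have hG0 : ∀ k, 0 ≤ G k := fun k => by positivity
  choose v hv1 hv2 using fun (j : Fin N) (m : Fin d) => ge_rep (x i m - x j m)
  let K : Fin N → Fin d → ℤ := fun j m => ⌊n * v j m / h⌋
  have hinj : Function.Injective K := by
    intro j l hjl
    by_contra hne
    have h1 := hx j l hne
    have h2 : ∀ m, ‖x j m - x l m‖ ≤ h * n⁻¹ := by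
      intro m
      have e : x j m - x l m = ((v l m - v j m : ℝ) : AddCircle (1:ℝ)) := by
        rw [AddCircle.coe_sub, hv1, hv1]; abel
      rw [e]
      refine (ge_norm_le _).trans ?_
      have h3 : ⌊n * v l m / h⌋ = ⌊n * v j m / h⌋ := (congrFun hjl m).symm
      have h4 := Int.abs_sub_lt_one_of_floor_eq_floor h3
      have h5 : n * v l m / h - n * v j m / h = (v l m - v j m) * (n / h) := by ring
      rw [h5, abs_mul, abs_of_pos (div_pos hn hh)] at h4
      have h6 : |v l m - v j m| = (|v l m - v j m| * (n / h)) * (h * n⁻¹) := by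
        field_simp
      rw [h6]
      have : 0 < h * n⁻¹ := by positivity
      nlinarith
    have h7 : torusDist (x j) (x l) ^ 2 ≤ d * (h * n⁻¹) ^ 2 := by
      unfold torusDist
      rw [Real.sq_sqrt (by positivity)]
      calc _ ≤ ∑ m : Fin d, (h * n⁻¹) ^ 2 := by
            apply Finset.sum_le_sum
            intro m _
            exact pow_le_pow_left₀ (norm_nonneg _) (h2 m) 2
        _ = _ := by simp
    have hp : 0 < h * n⁻¹ := by positivity
    have h8 : (h * (d + 1) * n⁻¹) ^ 2 ≤ torusDist (x j) (x l) ^ 2 :=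
      pow_le_pow_left₀ (by positivity) h1 2
    have h9 : (h * (d + 1) * n⁻¹) ^ 2 = (h * n⁻¹) ^ 2 * (d + 1) ^ 2 := by ring
    have h10 : (0:ℝ) ≤ d := by positivity
    have hp2 : 0 < (h * n⁻¹) ^ 2 := by positivity
    have h11 : (h * n⁻¹) ^ 2 * ((d:ℝ) + 1) ^ 2 ≤ (h * n⁻¹) ^ 2 * d := by linarith
    have h12 := le_of_mul_le_mul_left h11 hp2
    nlinarith
  have hterm : ∀ j, Real.exp (-c * n ^ 2 * torusDist (x i) (x j) ^ 2) ≤ ∏ m, G (K j m) := by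
    intro j
    unfold torusDist
    rw [Real.sq_sqrt (by positivity), Finset.mul_sum, Real.exp_sum]
    apply Finset.prod_le_prod
    · intros; positivity
    · intro m _
      rw [← hv2 j m, sq_abs, hG]
      simp only
      rw [← Real.exp_add]
      apply Real.exp_le_exp.mpr
      have f1 : (K j m : ℝ) ≤ n * v j m / h := Int.floor_le _
      have f2 : n * v j m / h < K j m + 1 := Int.lt_floor_add_one _
      set t := n * v j m / h with ht
      have f3 : n * v j m = h * t := by rw [ht]; field_simp
      have f4 : -c * n ^ 2 * v j m ^ 2 = -c * h ^ 2 * t ^ 2 := by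
        have : n ^ 2 * v j m ^ 2 = h ^ 2 * t ^ 2 := by rw [← mul_pow, f3]; ring
        linear_combination (-c) * this
      rw [f4]
      have f5 : (K j m : ℝ) ^ 2 ≤ 2 * t ^ 2 + 2 := by
        nlinarith [sq_nonneg ((K j m : ℝ) - 2 * t), sq_nonneg ((K j m : ℝ) - t)]
      have : 0 < c * h ^ 2 := by positivity
      nlinarith
  let S : Finset ℤ := Finset.univ.image (fun p : Fin N × Fin d => K p.1 p.2)
  calc _ ≤ ∑ j, ∏ m, G (K j m) := Finset.sum_le_sum fun j _ => hterm j
    _ = ∑ k ∈ Finset.univ.image K, ∏ m, G (k m) := by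
        rw [Finset.sum_image (fun a _ b _ hab => hinj hab)]
    _ ≤ ∑ k ∈ Fintype.piFinset (fun _ : Fin d => S), ∏ m, G (k m) := by
        apply Finset.sum_le_sum_of_subset_of_nonneg
        · intro k hk
          obtain ⟨j, _, rfl⟩ := Finset.mem_image.mp hk
          rw [Fintype.mem_piFinset]
          intro m
          exact Finset.mem_image.mpr ⟨(j, m), Finset.mem_univ _, rfl⟩
        · intro k _ _
          exact Finset.prod_nonneg fun m _ => hG0 _
    _ = ∏ m : Fin d, ∑ k ∈ S, G k := by rw [Finset.prod_univ_sum]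
    _ = (∑ k ∈ S, G k) ^ d := by simp
    _ ≤ _ := pow_le_pow_left₀ (Finset.sum_nonneg fun k _ => hG0 k)
        (hGs.sum_le_tsum _ fun k _ => hG0 k) d

/-- Proposition (Section 4.2): the Gaussian Riesz-type energy of a well-separated point set
is comparable to `N X^d` when `X ≥ N^{1/d}`. -/
theorem proposition_gaussian_energy (d : ℕ) (hd : 1 ≤ d) (c : ℝ) (hc : 0 < c)
    (δ : ℝ) (hδ : 0 < δ) :
    ∃ C : ℝ, 0 < C ∧ ∀ (N : ℕ), 1 ≤ N → ∀ x : Fin N → Torus d,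
      (∀ i j, i ≠ j → δ * (N : ℝ) ^ (-(1:ℝ)/d) ≤ torusDist (x i) (x j)) →
      ∀ X : ℝ, (N : ℝ) ^ ((1:ℝ)/d) ≤ X →
        (N : ℝ) * X ^ d ≤
          (∑ i, ∑ j, X ^ d * Real.exp (-c * X ^ 2 * torusDist (x i) (x j) ^ 2)) ∧
        (∑ i, ∑ j, X ^ d * Real.exp (-c * X ^ 2 * torusDist (x i) (x j) ^ 2)) ≤
          C * N * X ^ d := by
  have hh : 0 < δ / (d + 1) := by positivity
  set h := δ / ((d:ℝ) + 1) with hhd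
  set T : ℝ := (∑' k : ℤ, Real.exp (c * h ^ 2) * Real.exp (-(c * h ^ 2 / 2) * (k:ℝ) ^ 2)) ^ d
    with hT
  have hT0 : 0 ≤ T := pow_nonneg (tsum_nonneg fun k => by positivity) d
  refine ⟨T + 1, by linarith, ?_⟩
  intro N hN x hx X hX
  have hN0 : (0:ℝ) < N := by exact_mod_cast hN
  set n := (N:ℝ) ^ ((1:ℝ)/d) with hnd
  have hn : 0 < n := Real.rpow_pos_of_pos hN0 _
  have hX0 : 0 < X := hn.trans_le hX
  have hx' : ∀ i j, i ≠ j → (h * (d + 1)) * n⁻¹ ≤ torusDist (x i) (x j) := by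
    intro i j hij
    have := hx i j hij
    rw [neg_div, Real.rpow_neg hN0.le] at this
    have e : h * ((d:ℝ) + 1) = δ := by rw [hhd]; field_simp
    rw [e]; exact this
  constructor
  · calc (N:ℝ) * X ^ d = ∑ i : Fin N, X ^ d := by simp
      _ ≤ _ := by
        apply Finset.sum_le_sum
        intro i _
        have h1 := Finset.single_le_sum
          (f := fun j => X ^ d * Real.exp (-c * X ^ 2 * torusDist (x i) (x j) ^ 2))
          (fun j _ => by positivity) (Finset.mem_univ i)
        refine le_trans ?_ h1
        simp [torusDist]
  · calc _ ≤ ∑ i : Fin N, X ^ d * (T + 1) := by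
          apply Finset.sum_le_sum
          intro i _
          rw [← Finset.mul_sum]
          apply mul_le_mul_of_nonneg_left _ (by positivity)
          have h1 := ge_key d c hc h hh n hn N x hx' i
          refine le_trans (Finset.sum_le_sum fun j _ => ?_) (h1.trans (by linarith))
          apply Real.exp_le_exp.mpr
          have h2 : n ^ 2 ≤ X ^ 2 := pow_le_pow_left₀ hn.le hX 2
          have h3 : n ^ 2 * torusDist (x i) (x j) ^ 2 ≤ X ^ 2 * torusDist (x i) (x j) ^ 2 :=
            mul_le_mul_of_nonneg_right h2 (sq_nonneg _)
          nlinarith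
      _ = _ := by simp; ring
end
end
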